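/- For every convex body K in R^2 of unit area, the limit as n → ∞ of n^2 · (p(n,K))^{1/n} equals (e^2/4) · A(K)^3, where A(K) is the supremum of the affine perimeter over all convex subsets of K. -/

import Mathlib

open MeasureTheory Set Filter
noncomputable section

/-- Euclidean space `ℝ^d`. -/
abbrev E (d : ℕ) := EuclideanSpace ℝ (Fin d)

/-- A set of points is in convex position if no point lies in the convex hull of the others. -/
def ConvexPosition {d : ℕ} (X : Set (E d)) : Prop :=
  ∀ x ∈ X, x ∉ convexHull ℝ (X \ {x})

/-- The uniform (normalized Lebesgue) measure on `K`. -/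
def unifOn (d : ℕ) (K : Set (E d)) : Measure (E d) :=
  (volume K)⁻¹ • volume.restrict K

/-- The distribution of `n` independent uniform points in `K`. -/
def sampleMeasure (d n : ℕ) (K : Set (E d)) : Measure (Fin n → E d) :=
  Measure.pi fun _ => unifOn d K

/-- `p(n,K)`: probability that `n` i.i.d. uniform points in `K` are in convex position. -/
def pConvex (d n : ℕ) (K : Set (E d)) : ℝ :=
  (sampleMeasure d n K {x | ConvexPosition (Set.range x)}).toReal

/-- The (convex) floating body: points of `S` not cut off by any halfplane slicing
off volume at most `δ` from `S`. -/
def floatingBody (S : Set (E 2)) (δ : ℝ) : Set (E 2) :=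
  {x ∈ S | ∀ (f : E 2 →L[ℝ] ℝ) (c : ℝ),
    volume {y ∈ S | c < f y} ≤ ENNReal.ofReal δ → f x ≤ c}

/-- The affine perimeter of a planar convex body, defined via the floating-body
asymptotics `Area(S \ S_δ) ∼ (3/(4√2))^{2/3} AP(S) δ^{2/3}` (equivalent to
`∫_{∂S} κ^{1/3} ds` for smooth bodies). -/
def affinePerimeter (S : Set (E 2)) : ℝ :=
  (4 * Real.sqrt 2 / 3) ^ ((2:ℝ)/3) *
    limUnder (nhdsWithin 0 (Set.Ioi 0)) fun δ : ℝ =>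
      ((volume S).toReal - (volume (floatingBody S δ)).toReal) / δ ^ ((2:ℝ)/3)

/-- `A(K)`: the supremum of affine perimeters of convex compact subsets of `K`. -/
def maxAffinePerimeter (K : Set (E 2)) : ℝ :=
  sSup {a | ∃ S, S ⊆ K ∧ Convex ℝ S ∧ IsCompact S ∧ a = affinePerimeter S}

/-- the plane with product structure -/
abbrev P2 := ℝ × ℝ

/-- planar determinant -/
def det2 (u v : P2) : ℝ := u.1 * v.2 - u.2 * v.1

section partP1a

lemma grp_le {α G : Type*} [MeasurableSpace α] {μ : Measure α} [Fintype G] (a : G → α → α)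
    (ha : ∀ g, MeasurePreserving (a g) μ μ) {F Ω : Set α} (hF : MeasurableSet F)
    (disj : ∀ g h z, a g z ∈ F → a h z ∈ F → g = h)
    (hsub : ∀ g z, a g z ∈ F → z ∈ Ω) : (Fintype.card G : ENNReal) * μ F ≤ μ Ω := by
  have h1 : μ (⋃ g, a g ⁻¹' F) = ∑ g, μ (a g ⁻¹' F) := by
    rw [measure_iUnion, tsum_fintype]
    · intro g h hgh
      rw [Function.onFun, Set.disjoint_left]
      exact fun z hz hz' => hgh (disj g h z hz hz')
    · exact fun g => (ha g).measurable hF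
  have h2 : ∀ g, μ (a g ⁻¹' F) = μ F := fun g => (ha g).measure_preimage hF.nullMeasurableSet
  simp only [h2, Finset.sum_const, Finset.card_univ, nsmul_eq_mul] at h1
  rw [← h1]
  exact measure_mono (iUnion_subset fun g z hz => hsub g z hz)

lemma le_grp {α G : Type*} [MeasurableSpace α] {μ : Measure α} [Fintype G] (a : G → α → α)
    (ha : ∀ g, MeasurePreserving (a g) μ μ) {F Ω : Set α} (hF : MeasurableSet F)
    (hcov : ∀ᵐ z ∂μ, z ∈ Ω → ∃ g, a g z ∈ F) : μ Ω ≤ (Fintype.card G : ENNReal) * μ F := by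
  have h2 : ∀ g, μ (a g ⁻¹' F) = μ F := fun g => (ha g).measure_preimage hF.nullMeasurableSet
  calc μ Ω ≤ μ (⋃ g, a g ⁻¹' F) := by
        apply measure_mono_ae
        filter_upwards [hcov] with z hz hzΩ
        obtain ⟨g, hg⟩ := hz hzΩ
        exact mem_iUnion.2 ⟨g, hg⟩
    _ ≤ ∑ g, μ (a g ⁻¹' F) := measure_iUnion_fintype_le μ _
    _ = _ := by simp [h2]

lemma perm_eq_one_of_strictMono {n : ℕ} {β : Type*} [LinearOrder β] (f : Fin n → β) (σ : Equiv.Perm (Fin n))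
    (h1 : StrictMono f) (h2 : StrictMono (f ∘ σ)) : σ = 1 := by
  have h3 : StrictMono σ := fun i j hij => h1.lt_iff_lt.1 (h2 hij)
  have h4 : (h3.orderIsoOfSurjective σ σ.surjective) = OrderIso.refl (Fin n) := Subsingleton.elim _ _
  refine Equiv.ext fun i => ?_
  have := congrArg (fun e : Fin n ≃o Fin n => e i) h4
  simpa using this

/-- vol of increasing tuples -/
lemma vol_incr (k : ℕ) (s t : ℝ) (hst : s ≤ t) :
    volume {z : Fin k → ℝ | StrictMono z ∧ ∀ i, z i ∈ Ioo s t} = ENNReal.ofReal ((t - s) ^ k / k.factorial) := by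
  set F : Set (Fin k → ℝ) := {z | StrictMono z ∧ ∀ i, z i ∈ Ioo s t}
  have hF : MeasurableSet F := by
    have : F = (⋂ i, ⋂ j, ⋂ (_ : i < j), {z : Fin k → ℝ | z i < z j}) ∩ ⋂ i, {z | z i ∈ Ioo s t} := by
      ext z; simp [F, StrictMono]
    rw [this]
    refine MeasurableSet.inter ?_ ?_
    · refine MeasurableSet.iInter fun i => MeasurableSet.iInter fun j => MeasurableSet.iInter fun _ => ?_
      exact measurableSet_lt (measurable_pi_apply i) (measurable_pi_apply j)
    · exact MeasurableSet.iInter fun i => (measurable_pi_apply i) measurableSet_Ioo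
  let a : Equiv.Perm (Fin k) → (Fin k → ℝ) → (Fin k → ℝ) := fun σ z => z ∘ σ
  have ha : ∀ σ, MeasurePreserving (a σ) volume volume := by
    intro σ
    have := volume_measurePreserving_piCongrLeft (fun _ : Fin k => ℝ) σ.symm
    convert this using 1
    ext z i
    simp [a, MeasurableEquiv.piCongrLeft, Equiv.piCongrLeft, Equiv.piCongrLeft']
  have hΩ : volume (Set.univ.pi fun _ : Fin k => Ioo s t) = ENNReal.ofReal ((t - s) ^ k) := by
    rw [volume_pi_pi]
    simp [Real.volume_Ioo, ENNReal.ofReal_pow (sub_nonneg.2 hst)]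
  have h1 := grp_le a ha (F := F) (Ω := Set.univ.pi fun _ : Fin k => Ioo s t) hF
    (by
      rintro σ τ z ⟨h1, _⟩ ⟨h2, _⟩
      have : τ⁻¹ * σ = 1 := by
        refine perm_eq_one_of_strictMono (z ∘ τ) _ h2 ?_
        have e : (z ∘ τ) ∘ ⇑(τ⁻¹ * σ) = z ∘ σ := by funext i; simp
        rw [e]; exact h1
      rw [inv_mul_eq_one] at this; exact this.symm)
    (by
      rintro σ z ⟨_, h2⟩ i -
      have := h2 (σ⁻¹ i)
      simpa [a] using this)
  have h2 := le_grp a ha (F := F) (Ω := Set.univ.pi fun _ : Fin k => Ioo s t) hF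
    (by
      have hinj : ∀ᵐ z : Fin k → ℝ, ∀ i j, i ≠ j → z i ≠ z j := by
        rw [ae_all_iff]; intro i; rw [ae_all_iff]; intro j
        by_cases hij : i = j
        · simp [hij]
        · simp only [ne_eq, hij, not_false_eq_true, forall_const]
          let W : Submodule ℝ (Fin k → ℝ) := LinearMap.ker (LinearMap.proj (R := ℝ) (φ := fun _ : Fin k => ℝ) i - LinearMap.proj j)
          have hW : volume (W : Set (Fin k → ℝ)) = 0 := by
            apply Measure.addHaar_submodule
            intro h
            have : Pi.single i (1:ℝ) ∈ W := by rw [h]; trivial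
            simp [W, Ne.symm hij] at this
          rw [ae_iff]; convert hW using 2
          ext z; simp [W, sub_eq_zero]
      filter_upwards [hinj] with z hz hzΩ
      refine ⟨Tuple.sort z, (Tuple.monotone_sort z).strictMono_of_injective ?_, fun i => hzΩ _ trivial⟩
      intro i j hij
      by_contra hne
      exact hz _ _ (fun h => hne ((Tuple.sort z).injective h)) hij)
  have h3 := le_antisymm h1 h2
  rw [hΩ, Fintype.card_perm, Fintype.card_fin] at h3
  have hk : (k.factorial : ENNReal) ≠ 0 := by exact_mod_cast k.factorial_ne_zero
  have hk' : (k.factorial : ENNReal) ≠ ⊤ := ENNReal.natCast_ne_top _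
  have hkp : (0:ℝ) < k.factorial := by exact_mod_cast k.factorial_pos
  rw [ENNReal.ofReal_div_of_pos hkp, ENNReal.ofReal_natCast, ENNReal.eq_div_iff hk hk', h3]

end partP1a

section partP1b

/-- the chain `x, z 0, …, z (k-1), y, y, …` -/
def ZZ {k : ℕ} (x y : P2) (z : Fin k → P2) (n : ℕ) : P2 :=
  if n = 0 then x else if h : n - 1 < k then z ⟨n - 1, h⟩ else y

/-- increments -/
def inc {k : ℕ} (x y : P2) (z : Fin k → P2) (j : Fin (k+1)) : P2 :=
  ZZ x y z (j + 1) - ZZ x y z j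

/-- path with given increments -/
def path {k : ℕ} (x : P2) (d : Fin (k+1) → P2) (i : Fin k) : P2 :=
  x + ∑ j ∈ Finset.range (i + 1), (if h : j < k + 1 then d ⟨j, h⟩ else 0)

lemma ZZ_zero {k : ℕ} (x y : P2) (z : Fin k → P2) : ZZ x y z 0 = x := by simp [ZZ]
lemma ZZ_succ {k : ℕ} (x y : P2) (z : Fin k → P2) (i : Fin k) : ZZ x y z (i+1) = z i := by
  simp [ZZ]
lemma ZZ_last {k : ℕ} (x y : P2) (z : Fin k → P2) : ZZ x y z (k+1) = y := by
  simp [ZZ]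

lemma path_inc {k : ℕ} (x y : P2) (z : Fin k → P2) : path x (inc x y z) = z := by
  funext i
  have : ∑ j ∈ Finset.range (i + 1), (if h : j < k + 1 then inc x y z ⟨j, h⟩ else 0)
      = ∑ j ∈ Finset.range ((i:ℕ) + 1), (ZZ x y z (j+1) - ZZ x y z j) := by
    apply Finset.sum_congr rfl
    intro j hj
    have := i.2
    rw [Finset.mem_range] at hj
    rw [dif_pos (by omega)]; rfl
  rw [path, this, Finset.sum_range_sub, ZZ_zero, ZZ_succ]; abel

lemma sum_inc {k : ℕ} (x y : P2) (z : Fin k → P2) : ∑ j, inc x y z j = y - x := by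
  have := Finset.sum_range_sub (ZZ x y z) (k+1)
  rw [ZZ_zero, ZZ_last, Finset.sum_range] at this
  exact this

lemma ZZ_path {k : ℕ} (x y : P2) (d : Fin (k+1) → P2) (hd : ∑ j, d j = y - x) (n : ℕ) (hn : n ≤ k + 1) :
    ZZ x y (path x d) n = x + ∑ j ∈ Finset.range n, (if h : j < k + 1 then d ⟨j, h⟩ else 0) := by
  rcases n with _ | n
  · simp [ZZ]
  · by_cases h : n < k
    · rw [ZZ_succ x y (path x d) ⟨n, h⟩]; rfl
    · obtain rfl : n = k := by omega
      rw [ZZ_last, Finset.sum_range]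
      have : ∑ i : Fin (n+1), (if h : (i:ℕ) < n + 1 then d ⟨i, h⟩ else 0) = ∑ i, d i := by
        apply Finset.sum_congr rfl; intro i _; rw [dif_pos i.2]
      rw [this, hd]; abel

lemma inc_path {k : ℕ} (x y : P2) (d : Fin (k+1) → P2) (hd : ∑ j, d j = y - x) :
    inc x y (path x d) = d := by
  funext j
  have := j.2
  rw [inc, ZZ_path x y d hd _ (by omega), ZZ_path x y d hd _ (by omega), Finset.sum_range_succ, dif_pos j.2]
  simp

/-- permutation action on increments -/
def pact {k : ℕ} (x y : P2) (σ : Equiv.Perm (Fin (k+1))) (z : Fin k → P2) : Fin k → P2 :=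
  path x (inc x y z ∘ σ)

lemma inc_pact {k : ℕ} (x y : P2) (σ : Equiv.Perm (Fin (k+1))) (z : Fin k → P2) :
    inc x y (pact x y σ z) = inc x y z ∘ σ := by
  apply inc_path
  rw [← sum_inc x y z]
  exact Equiv.sum_comp σ _

lemma pact_pact {k : ℕ} (x y : P2) (σ τ : Equiv.Perm (Fin (k+1))) (z : Fin k → P2) :
    pact x y σ (pact x y τ z) = pact x y (τ * σ) z := by
  rw [pact, inc_pact, pact]; rfl

lemma pact_one {k : ℕ} (x y : P2) (z : Fin k → P2) : pact x y 1 z = z := path_inc x y z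

lemma ZZ_add {k : ℕ} (x y x' y' : P2) (z z' : Fin k → P2) (n : ℕ) :
    ZZ (x + x') (y + y') (z + z') n = ZZ x y z n + ZZ x' y' z' n := by
  unfold ZZ; split_ifs <;> simp

lemma ZZ_smul {k : ℕ} (c : ℝ) (x y : P2) (z : Fin k → P2) (n : ℕ) :
    ZZ (c • x) (c • y) (c • z) n = c • ZZ x y z n := by
  unfold ZZ; split_ifs <;> simp

lemma pact_add {k : ℕ} (x y x' y' : P2) (σ : Equiv.Perm (Fin (k+1))) (z z' : Fin k → P2) :
    pact (x + x') (y + y') σ (z + z') = pact x y σ z + pact x' y' σ z' := by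
  funext i
  simp only [pact, path, Pi.add_apply]
  have : ∀ j : ℕ, (if h : j < k + 1 then (inc (x + x') (y + y') (z + z') ∘ σ) ⟨j, h⟩ else 0)
     = (if h : j < k + 1 then (inc x y z ∘ σ) ⟨j, h⟩ else 0) + (if h : j < k + 1 then (inc x' y' z' ∘ σ) ⟨j, h⟩ else 0) := by
    intro j
    split_ifs
    · simp only [Function.comp, inc, ZZ_add]; abel
    · simp
  simp only [this, Finset.sum_add_distrib]; abel

lemma pact_smul {k : ℕ} (c : ℝ) (x y : P2) (σ : Equiv.Perm (Fin (k+1))) (z : Fin k → P2) :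
    pact (c • x) (c • y) σ (c • z) = c • pact x y σ z := by
  funext i
  simp only [pact, path, Pi.smul_apply, smul_add, Finset.smul_sum]
  congr 1
  apply Finset.sum_congr rfl; intro j _
  split_ifs
  · simp only [Function.comp, inc, ZZ_smul, smul_sub]
  · simp

/-- linear part of the action -/
def plin {k : ℕ} (σ : Equiv.Perm (Fin (k+1))) : (Fin k → P2) →ₗ[ℝ] (Fin k → P2) where
  toFun z := pact 0 0 σ z
  map_add' z z' := by have := pact_add 0 0 0 0 σ z z'; simpa using this
  map_smul' c z := by have := pact_smul c 0 0 σ z; simpa using this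

lemma plin_mul {k : ℕ} (σ τ : Equiv.Perm (Fin (k+1))) : plin σ * plin τ = plin (τ * σ) := by
  refine LinearMap.ext fun z => ?_; exact pact_pact 0 0 σ τ z

lemma plin_pow {k : ℕ} (σ : Equiv.Perm (Fin (k+1))) (n : ℕ) : plin σ ^ n = plin (σ ^ n) := by
  induction n with
  | zero => refine LinearMap.ext fun z => ?_; exact (pact_one 0 0 z).symm
  | succ n ih => rw [pow_succ, ih, plin_mul, pow_succ', ]

lemma abs_det_plin {k : ℕ} (σ : Equiv.Perm (Fin (k+1))) : |LinearMap.det (plin σ)| = 1 := by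
  have h : plin σ ^ orderOf σ = 1 := by
    rw [plin_pow, pow_orderOf_eq_one]; refine LinearMap.ext fun z => ?_; exact pact_one 0 0 z
  have h2 := congrArg LinearMap.det h
  rw [map_pow, map_one] at h2
  have h3 : |LinearMap.det (plin σ)| ^ orderOf σ = 1 := by rw [← abs_pow, h2, abs_one]
  exact (pow_eq_one_iff_of_nonneg (abs_nonneg _) (orderOf_pos σ).ne').1 h3

lemma pact_mp {k : ℕ} (x y : P2) (σ : Equiv.Perm (Fin (k+1))) :
    MeasurePreserving (pact x y σ) (volume : Measure (Fin k → P2)) volume := by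
  have h1 : pact x y σ = (fun z => z + pact x y σ 0) ∘ plin σ := by
    funext z
    have := pact_add 0 0 x y σ z 0
    simp only [zero_add, add_zero] at this
    exact this
  rw [h1]
  refine (measurePreserving_add_right volume _).comp ⟨(plin σ).continuous_of_finiteDimensional.measurable, ?_⟩
  have hd : LinearMap.det (plin σ) ≠ 0 := by
    intro h; have := abs_det_plin σ; rw [h] at this; simp at this
  rw [Measure.map_linearMap_addHaar_eq_smul_addHaar _ hd, abs_inv, abs_det_plin]
  simp

/-- slope -/
def slp (w : P2) : ℝ := w.2 / w.1

/-- monotone chains -/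
def QQ (k : ℕ) (x y : P2) : Set (Fin k → P2) :=
  {z | ∀ j, 0 < (inc x y z j).1 ∧ 0 < (inc x y z j).2}

/-- convex chains -/
def CC (k : ℕ) (x y : P2) : Set (Fin k → P2) :=
  {z | (∀ j, 0 < (inc x y z j).1 ∧ 0 < (inc x y z j).2) ∧ StrictMono (fun j => slp (inc x y z j))}

lemma measurable_inc {k : ℕ} (x y : P2) (j : Fin (k+1)) : Measurable (fun z : Fin k → P2 => inc x y z j) := by
  have : ∀ n, Measurable (fun z : Fin k → P2 => ZZ x y z n) := by
    intro n; unfold ZZ; split_ifs <;> fun_prop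
  exact (this _).sub (this _)

lemma measurableSet_QQ (k : ℕ) (x y : P2) : MeasurableSet (QQ k x y) := by
  have : QQ k x y = ⋂ j, ({z | 0 < (inc x y z j).1} ∩ {z | 0 < (inc x y z j).2}) := by
    ext z; simp [QQ]
  rw [this]
  exact MeasurableSet.iInter fun j => ((measurableSet_lt measurable_const (measurable_inc x y j).fst).inter
    (measurableSet_lt measurable_const (measurable_inc x y j).snd))

lemma measurableSet_CC (k : ℕ) (x y : P2) : MeasurableSet (CC k x y) := by
  have : CC k x y = QQ k x y ∩ ⋂ i, ⋂ j, ⋂ (_ : i < j), {z | slp (inc x y z i) < slp (inc x y z j)} := by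
    ext z; simp [CC, QQ, StrictMono]
  rw [this]
  refine (measurableSet_QQ k x y).inter ?_
  refine MeasurableSet.iInter fun i => MeasurableSet.iInter fun j => MeasurableSet.iInter fun _ => ?_
  exact measurableSet_lt ((measurable_inc x y i).snd.div (measurable_inc x y i).fst) ((measurable_inc x y j).snd.div (measurable_inc x y j).fst)

lemma lt_of_QQ {k : ℕ} {x y : P2} {z : Fin k → P2} (h : z ∈ QQ k x y) : x.1 < y.1 ∧ x.2 < y.2 := by
  have h1 := congrArg Prod.fst (sum_inc x y z)
  have h2 := congrArg Prod.snd (sum_inc x y z)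
  rw [Prod.fst_sum] at h1
  rw [Prod.snd_sum] at h2
  have h3 : 0 < ∑ j, (inc x y z j).1 := Finset.sum_pos (fun j _ => (h j).1) ⟨0, Finset.mem_univ _⟩
  have h4 : 0 < ∑ j, (inc x y z j).2 := Finset.sum_pos (fun j _ => (h j).2) ⟨0, Finset.mem_univ _⟩
  simp at h1 h2
  constructor <;> linarith

/-- strict monotone along the chain, real version -/
lemma chain_iff {k : ℕ} (x y : P2) (z : Fin k → P2) (π : P2 → ℝ) (hxy : π x < π y) :
    (∀ j : Fin (k+1), π (ZZ x y z j) < π (ZZ x y z (j+1))) ↔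
      (StrictMono (fun i => π (z i)) ∧ ∀ i, π (z i) ∈ Ioo (π x) (π y)) := by
  constructor
  · intro h
    have hm : ∀ m n : ℕ, m < n → n ≤ k + 1 → π (ZZ x y z m) < π (ZZ x y z n) := by
      intro m n hmn
      induction n, hmn using Nat.le_induction with
      | base => intro hm; exact h ⟨m, by omega⟩
      | succ n hmn ih => intro hn; exact (ih (by omega)).trans (h ⟨n, by omega⟩)
    refine ⟨fun i j hij => ?_, fun i => ⟨?_, ?_⟩⟩
    · have := hm (i+1) (j+1) (by simpa using hij) (by omega)
      rwa [ZZ_succ, ZZ_succ] at this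
    · have := hm 0 (i+1) (by omega) (by omega)
      rwa [ZZ_succ, ZZ_zero] at this
    · have := hm (i+1) (k+1) (by omega) (by omega)
      rwa [ZZ_succ, ZZ_last] at this
  · rintro ⟨h1, h2⟩ ⟨j, hj⟩
    rcases j with _ | j
    · rw [ZZ_zero]
      by_cases hk : 0 < k
      · have := ZZ_succ x y z ⟨0, hk⟩
        simp only at this ⊢
        rw [this]; exact (h2 _).1
      · obtain rfl : k = 0 := by omega
        have := ZZ_last x y z
        simp only at this ⊢
        rw [this]; exact hxy
    · have e := ZZ_succ x y z ⟨j, by omega⟩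
      simp only at e ⊢
      rw [e]
      by_cases hk : j + 1 < k
      · have e2 := ZZ_succ x y z ⟨j+1, hk⟩
        simp only at e2
        rw [e2]; exact h1 (by simp)
      · obtain rfl : k = j + 1 := by omega
        rw [ZZ_last]; exact (h2 _).2

lemma vol_QQ (k : ℕ) (x y : P2) (h1 : x.1 < y.1) (h2 : x.2 < y.2) :
    volume (QQ k x y) = ENNReal.ofReal (((y.1 - x.1) * (y.2 - x.2)) ^ k / (k.factorial : ℝ) ^ 2) := by
  have e : QQ k x y = (MeasurableEquiv.arrowProdEquivProdArrow ℝ ℝ (Fin k)) ⁻¹'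
      ({z : Fin k → ℝ | StrictMono z ∧ ∀ i, z i ∈ Ioo x.1 y.1} ×ˢ {z : Fin k → ℝ | StrictMono z ∧ ∀ i, z i ∈ Ioo x.2 y.2}) := by
    ext z
    have a1 := chain_iff x y z Prod.fst h1
    have a2 := chain_iff x y z Prod.snd h2
    simp only [QQ, mem_setOf_eq, forall_and, inc, Prod.fst_sub, Prod.snd_sub, sub_pos]
    rw [a1, a2]
    rfl
  rw [e, (volume_measurePreserving_arrowProdEquivProdArrow ℝ ℝ (Fin k)).measure_preimage_equiv,
    Measure.volume_eq_prod, Measure.prod_prod, vol_incr k _ _ h1.le, vol_incr k _ _ h2.le, ← ENNReal.ofReal_mul]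
  · congr 1; rw [mul_pow]; field_simp
  · have := sub_pos.2 h1; positivity

lemma perm_mul_CC {k : ℕ} {x y : P2} {z : Fin k → P2} {σ τ : Equiv.Perm (Fin (k+1))}
    (h1 : pact x y σ z ∈ CC k x y) (h2 : pact x y τ z ∈ CC k x y) : σ = τ := by
  have a1 := h1.2
  have a2 := h2.2
  simp only [inc_pact] at a1 a2
  have : τ⁻¹ * σ = 1 := by
    refine perm_eq_one_of_strictMono _ _ a2 ?_
    have e : (fun j => slp ((inc x y z ∘ τ) j)) ∘ ⇑(τ⁻¹ * σ) = fun j => slp ((inc x y z ∘ σ) j) := by funext i; simp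
    rw [e]; exact a1
  rw [inv_mul_eq_one] at this; exact this.symm

lemma pact_QQ {k : ℕ} {x y : P2} {z : Fin k → P2} {σ : Equiv.Perm (Fin (k+1))} :
    pact x y σ z ∈ QQ k x y ↔ z ∈ QQ k x y := by
  simp only [QQ, mem_setOf_eq, inc_pact, Function.comp]
  exact ⟨fun h j => by simpa using h (σ⁻¹ j), fun h j => h _⟩

end partP1b

section partP1c

/-- shift vector -/
def shv (k : ℕ) (i j : ℕ) : Fin k → P2 := fun m => if i ≤ m ∧ (m:ℕ) < j then (1, 0) else 0

lemma ZZ_shv {k i j : ℕ} (hj : j ≤ k) (n : ℕ) :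
    ZZ 0 0 (shv k i j) n = if i < n ∧ n ≤ j then ((1:ℝ), (0:ℝ)) else 0 := by
  unfold ZZ shv
  rcases n with _ | n
  · simp
  · simp only [Nat.add_one_sub_one]
    split_ifs <;> first | rfl | omega | (exfalso; omega)

lemma null_slopes {k : ℕ} (x y : P2) (i j : Fin (k+1)) (hij : i < j) :
    volume {z : Fin k → P2 | z ∈ QQ k x y ∧ slp (inc x y z i) = slp (inc x y z j)} = 0 := by
  have hij' : (i:ℕ) < j := hij
  have hj := j.2
  have key : ∀ (z : Fin k → P2) (t : ℝ), inc x y (z + t • shv k i j) i = inc x y z i + (t, 0) ∧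
      inc x y (z + t • shv k i j) j = inc x y z j - (t, 0) := by
    intro z t
    have e : ∀ n, ZZ x y (z + t • shv k i j) n = ZZ x y z n + t • (if (i:ℕ) < n ∧ n ≤ j then ((1:ℝ), (0:ℝ)) else 0) := by
      intro n
      rw [← ZZ_shv (k := k) (i := i) (j := j) (by omega), ← ZZ_smul, ← ZZ_add]; simp
    simp only [inc, e]
    rw [if_pos (by omega), if_neg (by omega), if_neg (by omega), if_pos (by omega)]
    constructor <;> ext <;> simp <;> ring
  apply Measure.addHaar_eq_zero_of_disjoint_translates volume (fun n : ℕ => ((1:ℝ)/((n:ℝ)+1)) • shv k i j)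
  · rw [isBounded_iff_forall_norm_le]
    refine ⟨‖shv k i j‖, ?_⟩
    rintro _ ⟨n, rfl⟩
    rw [norm_smul]
    refine mul_le_of_le_one_left (norm_nonneg _) ?_
    have : (0:ℝ) < (n:ℝ) + 1 := by positivity
    rw [Real.norm_of_nonneg (by positivity), div_le_one this]; simp
  · intro m n hmn
    rw [Function.onFun, Set.disjoint_left]
    rintro w ⟨a, ha, z, ⟨hz, hz2⟩, rfl⟩ ⟨b, hb, z', ⟨hz', hz2'⟩, h⟩
    rw [mem_singleton_iff] at ha hb
    subst ha hb
    set t : ℝ := 1/((m:ℝ)+1) - 1/((n:ℝ)+1) with ht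
    have ht0 : t ≠ 0 := by
      intro h0
      rw [ht, sub_eq_zero] at h0
      have : (m:ℝ) = n := by
        have h1 : (0:ℝ) < (n:ℝ) + 1 := by positivity
        have h2 : (0:ℝ) < (m:ℝ) + 1 := by positivity
        field_simp at h0
        linarith
      exact hmn (by exact_mod_cast this)
    have hzz : z' = z + t • shv k i j := by
      simp only [ht, sub_smul]
      simp only at h
      rw [eq_sub_of_add_eq' h]; abel
    obtain ⟨k1, k2⟩ := key z t
    have p1 := hz i
    have p2 := hz j
    have p3 := hz' i
    have p4 := hz' j
    rw [hzz] at hz2' p3 p4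
    rw [k1] at p3
    rw [k2] at p4
    rw [k1, k2] at hz2'
    set a := inc x y z i
    set b := inc x y z j
    simp only [slp, Prod.fst_add, Prod.snd_add, Prod.fst_sub, Prod.snd_sub] at *
    rw [div_eq_div_iff p1.1.ne' p2.1.ne'] at hz2
    rw [div_eq_div_iff p3.1.ne' p4.1.ne'] at hz2'
    have : t * (a.2 + b.2) = 0 := by nlinarith
    rcases mul_eq_zero.1 this with h | h
    · exact ht0 h
    · linarith [p1.2, p2.2]
  · exact (measurableSet_QQ k x y).inter (measurableSet_eq_fun ((measurable_inc x y i).snd.div (measurable_inc x y i).fst) ((measurable_inc x y j).snd.div (measurable_inc x y j).fst))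

lemma CC_sub_QQ (k : ℕ) (x y : P2) : CC k x y ⊆ QQ k x y := fun _ h => h.1

lemma vol_CC (k : ℕ) (x y : P2) (h1 : x.1 < y.1) (h2 : x.2 < y.2) :
    volume (CC k x y) = ENNReal.ofReal (((y.1 - x.1) * (y.2 - x.2)) ^ k / ((k.factorial : ℝ) ^ 2 * (k+1).factorial)) := by
  have u1 := grp_le (pact x y) (pact_mp x y) (F := CC k x y) (Ω := QQ k x y) (measurableSet_CC k x y)
    (fun g h z hg hh => perm_mul_CC hg hh) (fun g z hg => pact_QQ.1 (CC_sub_QQ _ _ _ hg))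
  have u2 := le_grp (pact x y) (pact_mp x y) (F := CC k x y) (Ω := QQ k x y) (measurableSet_CC k x y)
    (by
      have hinj : ∀ᵐ z : Fin k → P2, ∀ i j, i < j → ¬ (z ∈ QQ k x y ∧ slp (inc x y z i) = slp (inc x y z j)) := by
        rw [ae_all_iff]; intro i; rw [ae_all_iff]; intro j
        by_cases hij : i < j
        · simp only [hij, forall_const]
          rw [ae_iff]
          simpa only [not_not] using null_slopes x y i j hij
        · simp [hij]
      filter_upwards [hinj] with z hz hzQ
      set f := fun j => slp (inc x y z j)
      refine ⟨Tuple.sort f, pact_QQ.2 hzQ, ?_⟩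
      simp only [inc_pact]
      refine (Tuple.monotone_sort f).strictMono_of_injective ?_
      have hf : Function.Injective f := by
        intro i j hij
        rcases lt_trichotomy i j with h | h | h
        · exact absurd ⟨hzQ, hij⟩ (hz i j h)
        · exact h
        · exact absurd ⟨hzQ, hij.symm⟩ (hz j i h)
      exact hf.comp (Tuple.sort f).injective)
  have h3 := le_antisymm u1 u2
  rw [vol_QQ k x y h1 h2, Fintype.card_perm, Fintype.card_fin] at h3
  have hk : ((k+1).factorial : ENNReal) ≠ 0 := by exact_mod_cast (k+1).factorial_ne_zero
  have hk' : ((k+1).factorial : ENNReal) ≠ ⊤ := ENNReal.natCast_ne_top _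
  have hkp : (0:ℝ) < (k+1).factorial := by exact_mod_cast (k+1).factorial_pos
  rw [← div_div, ENNReal.ofReal_div_of_pos hkp, ENNReal.ofReal_natCast, ENNReal.eq_div_iff hk hk', h3]

/-- upper bound valid always -/
lemma vol_CC_le (k : ℕ) (x y : P2) :
    volume (CC k x y) ≤ ENNReal.ofReal (((y.1 - x.1) * (y.2 - x.2)) ^ k / ((k.factorial : ℝ) ^ 2 * (k+1).factorial)) := by
  by_cases hne : (CC k x y).Nonempty
  · obtain ⟨z, hz⟩ := hne
    obtain ⟨h1, h2⟩ := lt_of_QQ (CC_sub_QQ _ _ _ hz)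
    exact (vol_CC k x y h1 h2).le
  · rw [Set.not_nonempty_iff_eq_empty] at hne
    simp [hne]

end partP1c

section partP2a

/-- support line at each chain point -/
lemma CC_support {k : ℕ} {x y : P2} {z : Fin k → P2} (hz : z ∈ CC k x y) (i : Fin k) :
    ∃ s : ℝ, 0 < s ∧ ∀ n ≤ k + 1, n ≠ i + 1 →
      (z i).2 - s * (z i).1 < (ZZ x y z n).2 - s * (ZZ x y z n).1 := by
  obtain ⟨hQ, hS⟩ := hz
  set d := fun j => inc x y z j with hd
  have hi := i.2
  let i0 : Fin (k+1) := ⟨i, by omega⟩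
  let i1 : Fin (k+1) := ⟨i+1, by omega⟩
  have h01 : slp (inc x y z i0) < slp (inc x y z i1) := hS (by simp [i0, i1, Fin.lt_def])
  have hpos : 0 < slp (inc x y z i0) := div_pos (hQ _).2 (hQ _).1
  set s := (slp (inc x y z i0) + slp (inc x y z i1)) / 2 with hs
  refine ⟨s, by linarith, ?_⟩
  have hlo : ∀ j : ℕ, j ≤ i → (ZZ x y z (j+1)).2 - s * (ZZ x y z (j+1)).1 < (ZZ x y z j).2 - s * (ZZ x y z j).1 := by
    intro j hj
    let j0 : Fin (k+1) := ⟨j, by omega⟩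
    have h1 : slp (inc x y z j0) < s := lt_of_le_of_lt (hS.monotone (show j0 ≤ i0 from hj)) (by linarith)
    rw [slp, div_lt_iff₀ (hQ _).1] at h1
    simp only [inc, j0, Prod.fst_sub, Prod.snd_sub] at h1
    linarith
  have hhi : ∀ j : ℕ, (i:ℕ) + 1 ≤ j → j ≤ k → (ZZ x y z j).2 - s * (ZZ x y z j).1 < (ZZ x y z (j+1)).2 - s * (ZZ x y z (j+1)).1 := by
    intro j hj hjk
    let j0 : Fin (k+1) := ⟨j, by omega⟩
    have h1 : s < slp (inc x y z j0) := lt_of_lt_of_le (by linarith) (hS.monotone (show i1 ≤ j0 from hj))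
    rw [slp, lt_div_iff₀ (hQ _).1] at h1
    simp only [inc, j0, Prod.fst_sub, Prod.snd_sub] at h1
    linarith
  have hlo2 : ∀ m : ℕ, m ≤ i → (ZZ x y z (i+1)).2 - s * (ZZ x y z (i+1)).1 < (ZZ x y z ((i:ℕ) - m)).2 - s * (ZZ x y z ((i:ℕ)-m)).1 := by
    intro m
    induction m with
    | zero => intro _; exact hlo i le_rfl
    | succ m ih =>
      intro hm
      have := hlo ((i:ℕ) - (m+1)) (by omega)
      rw [show (i:ℕ) - (m+1) + 1 = (i:ℕ) - m by omega] at this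
      exact (ih (by omega)).trans this
  have hhi2 : ∀ n : ℕ, (i:ℕ) + 1 < n → n ≤ k + 1 → (ZZ x y z (i+1)).2 - s * (ZZ x y z (i+1)).1 < (ZZ x y z n).2 - s * (ZZ x y z n).1 := by
    intro n hn
    induction n, hn using Nat.le_induction with
    | base => intro hm; exact hhi _ le_rfl (by omega)
    | succ n hmn ih => intro hn; exact (ih (by omega)).trans (hhi n (by omega) (by omega))
  intro n hn hne
  rw [← ZZ_succ x y z i]
  rcases Nat.lt_or_ge ((i:ℕ)+1) n with h | h
  · exact hhi2 n h hn
  · have := hlo2 (i - n) (by omega)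
    rwa [show (i:ℕ) - (i - n) = n by omega] at this

lemma CC_mono1 {k : ℕ} {x y : P2} {z : Fin k → P2} (hz : z ∈ CC k x y) :
    StrictMono (fun i => (z i).1) ∧ ∀ i, (z i).1 ∈ Ioo x.1 y.1 :=
  (chain_iff x y z Prod.fst (lt_of_QQ hz.1).1).1 (fun j => by
    have := (hz.1 j).1; simp only [inc, Prod.fst_sub] at this; linarith)

lemma CC_mono2 {k : ℕ} {x y : P2} {z : Fin k → P2} (hz : z ∈ CC k x y) :
    StrictMono (fun i => (z i).2) ∧ ∀ i, (z i).2 ∈ Ioo x.2 y.2 :=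
  (chain_iff x y z Prod.snd (lt_of_QQ hz.1).2).1 (fun j => by
    have := (hz.1 j).2; simp only [inc, Prod.snd_sub] at this; linarith)

/-- barycentric cone opposite to the vertex `v` -/
def coneC (x v y : P2) : Set P2 :=
  {w | 0 ≤ det2 (v-x) (w-x) ∧ 0 ≤ det2 (v-w) (y-v) ∧
    det2 (v-x) (y-v) ≤ det2 (v-x) (w-x) + det2 (v-w) (y-v)}

/-- valid family of triangles -/
structure VFam {ι : Type} (x v y : ι → P2) : Prop where
  pos : ∀ i, 0 < det2 (v i - x i) (y i - v i)
  sep : ∀ i j, i ≠ j → x j ∈ coneC (x i) (v i) (y i) ∧ v j ∈ coneC (x i) (v i) (y i) ∧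
    y j ∈ coneC (x i) (v i) (y i)

/-- linear coordinates of a triangle -/
def AA (x v y : P2) : P2 →ₗ[ℝ] P2 where
  toFun w := (det2 w (y - v), det2 (v - x) w)
  map_add' a b := by ext <;> simp [det2] <;> ring
  map_smul' c a := by ext <;> simp [det2] <;> ring

/-- chains in a triangle -/
def DD (k : ℕ) (x v y : P2) : Set (Fin k → P2) :=
  {z | (fun j => AA x v y (z j)) ∈ CC k (AA x v y x) (AA x v y y)}

lemma convex_coneC (x v y : P2) : Convex ℝ (coneC x v y) := by
  rintro a ⟨h1, h2, h3⟩ b ⟨k1, k2, k3⟩ s t hs ht hst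
  have hs' : s = 1 - t := by linarith
  subst hs'
  simp only [coneC, mem_ofPred_eq, det2, Prod.fst_sub, Prod.snd_sub, Prod.fst_add, Prod.snd_add, Prod.smul_fst, Prod.smul_snd, smul_eq_mul] at *
  refine ⟨?_, ?_, ?_⟩
  · nlinarith [mul_nonneg hs h1, mul_nonneg ht k1]
  · nlinarith [mul_nonneg hs h2, mul_nonneg ht k2]
  · nlinarith [mul_nonneg hs (sub_nonneg.2 h3), mul_nonneg ht (sub_nonneg.2 k3)]

/-- coordinates of chain points -/
lemma DD_coords {k : ℕ} {x v y : P2} (hΔ : 0 < det2 (v-x) (y-v)) {z : Fin k → P2} (hz : z ∈ DD k x v y) (i : Fin k) :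
    0 < det2 (v-x) (z i - x) ∧ det2 (v-x) (z i - x) < det2 (z i - x) (y - v) ∧
      det2 (z i - x) (y - v) < det2 (v-x) (y-v) := by
  obtain ⟨s, hs, hs2⟩ := CC_support hz i
  have m1 := (CC_mono1 hz).2 i
  have m2 := (CC_mono2 hz).2 i
  have e1 := hs2 0 (by omega) (by omega)
  have e2 := hs2 (k+1) le_rfl (by have := i.2; omega)
  rw [ZZ_zero] at e1
  rw [ZZ_last] at e2
  simp only [AA, LinearMap.coe_mk, AddHom.coe_mk, mem_Ioo] at *
  simp only [det2, Prod.fst_sub, Prod.snd_sub] at *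
  refine ⟨by linarith, ?_, by linarith⟩
  rcases le_total s 1 with h | h <;> nlinarith

lemma DD_mem_hull {k : ℕ} {x v y : P2} (hΔ : 0 < det2 (v-x) (y-v)) {z : Fin k → P2} (hz : z ∈ DD k x v y) (i : Fin k)
    {K : Set P2} (hK : Convex ℝ K) (hx : x ∈ K) (hv : v ∈ K) (hy : y ∈ K) : z i ∈ K := by
  obtain ⟨h1, h2, h3⟩ := DD_coords hΔ hz i
  set D := det2 (v-x) (y-v) with hD
  set a := det2 (z i - x) (y - v) with ha
  set b := det2 (v-x) (z i - x) with hb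
  have e : z i = ((D - a)/D) • x + ((a - b)/D) • v + (b/D) • y := by
    ext
    · simp only [Prod.fst_add, Prod.smul_fst, smul_eq_mul]
      field_simp
      rw [ha, hb, hD]; simp only [det2, Prod.fst_sub, Prod.snd_sub]; ring
    · simp only [Prod.snd_add, Prod.smul_snd, smul_eq_mul]
      field_simp
      rw [ha, hb, hD]; simp only [det2, Prod.fst_sub, Prod.snd_sub]; ring
  rw [e]
  have := hK.sum_mem (t := Finset.univ) (w := ![(D-a)/D, (a-b)/D, b/D]) (z := ![x, v, y])
    (by intro j _; fin_cases j <;> simp <;> apply div_nonneg <;> linarith)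
    (by simp [Fin.sum_univ_three]; field_simp; ring)
    (by intro j _; fin_cases j <;> simpa)
  simpa [Fin.sum_univ_three] using this

/-- support functional -/
lemma DD_support {k : ℕ} {x v y : P2} (hΔ : 0 < det2 (v-x) (y-v)) {z : Fin k → P2} (hz : z ∈ DD k x v y) (i : Fin k) :
    ∃ f : P2 →ₗ[ℝ] ℝ, (∀ j, j ≠ i → f (z i) < f (z j)) ∧ ∀ w ∈ coneC x v y, f (z i) < f w := by
  obtain ⟨s, hs, hs2⟩ := CC_support hz i
  have hi := i.2
  have e1 := hs2 0 (by omega) (by omega)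
  have e2 := hs2 (k+1) le_rfl (by omega)
  have hc := DD_coords hΔ hz i
  let f : P2 →ₗ[ℝ] ℝ := (LinearMap.snd ℝ ℝ ℝ - s • LinearMap.fst ℝ ℝ ℝ) ∘ₗ AA x v y
  refine ⟨f, ?_, ?_⟩
  · intro j hj
    have := hs2 (j+1) (by have := j.2; omega) (by intro h; exact hj (Fin.ext (by omega)))
    rw [ZZ_succ] at this
    exact this
  · rintro w ⟨h1, h2, h3⟩
    rw [ZZ_zero] at e1
    rw [ZZ_last] at e2
    have hf : ∀ w, f w = det2 (v-x) w - s * det2 w (y - v) := fun w => rfl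
    rw [hf, hf]
    simp only [AA, LinearMap.coe_mk, AddHom.coe_mk] at e1 e2
    obtain ⟨c1, c2, c3⟩ := hc
    set D := det2 (v-x) (y-v) with hD
    set P := f x - f (z i) with hP
    set Q := f y - f (z i) with hQ
    have hP0 : 0 < P := by rw [hP, hf, hf]; linarith
    have hQ0 : 0 < Q := by rw [hQ, hf, hf]; linarith
    set V := f v - f (z i) with hV
    have hV0 : V < 0 := by
      have e : V = -(det2 (v-x) (z i - x)) - s * (D - det2 (z i - x) (y - v)) := by
        rw [hV, hf, hf, hD]; simp only [det2, Prod.fst_sub, Prod.snd_sub]; ring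
      rw [e]; nlinarith
    have key : D * (f w - f (z i)) = det2 (v-w) (y-v) * P + det2 (v-x) (w-x) * Q + (D - det2 (v-x) (w-x) - det2 (v-w) (y-v)) * V := by
      rw [hP, hQ, hV]; simp only [hf, hD]; simp only [det2, Prod.fst_sub, Prod.snd_sub]; ring
    have : 0 < D * (f w - f (z i)) := by
      rw [key]
      have t3 : 0 ≤ (D - det2 (v-x) (w-x) - det2 (v-w) (y-v)) * V := mul_nonneg_of_nonpos_of_nonpos (by linarith) hV0.le
      have t1 := mul_nonneg h2 hP0.le
      have t2 := mul_nonneg h1 hQ0.le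
      rcases h2.lt_or_eq with h | h
      · have := mul_pos h hP0; linarith
      · have : 0 < det2 (v-x) (w-x) := by linarith
        have := mul_pos this hQ0; linarith
    have := (pos_iff_pos_of_mul_pos this).1 hΔ
    rw [hf, hf] at this; linarith

end partP2a

section partP2b

/-- convex position for families -/
def CP {I : Type*} (z : I → P2) : Prop := ∀ i, z i ∉ convexHull ℝ (range z \ {z i})

lemma CP_of_support {I : Type*} (z : I → P2) (h : ∀ i, ∃ f : P2 →ₗ[ℝ] ℝ, ∀ j, j ≠ i → f (z i) < f (z j)) : CP z := by
  intro i hi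
  obtain ⟨f, hf⟩ := h i
  have : convexHull ℝ (range z \ {z i}) ⊆ {w | f (z i) < f w} := by
    apply convexHull_min
    · rintro _ ⟨⟨j, rfl⟩, hj⟩
      exact hf j (fun h => hj (by rw [h]; rfl))
    · exact convex_halfSpace_gt f.isLinear _
  exact lt_irrefl (f (z i)) (show f (z i) < f (z i) from this hi)

section fam
variable {ι : Type} [Fintype ι] {x v y : ι → P2} (κ : ι → ℕ)

/-- family of chains -/
def FF (x v y : ι → P2) : Set ((Σ i, Fin (κ i)) → P2) :=
  {z | ∀ i, (fun j => z ⟨i, j⟩) ∈ DD (κ i) (x i) (v i) (y i)}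

lemma FF_cone (hF : VFam x v y) {z : (Σ i, Fin (κ i)) → P2} (hz : z ∈ FF κ x v y) {i j : ι} (hij : i ≠ j) (l : Fin (κ j)) :
    z ⟨j, l⟩ ∈ coneC (x i) (v i) (y i) :=
  DD_mem_hull (hF.pos j) (hz j) l (convex_coneC _ _ _) (hF.sep i j hij).1 (hF.sep i j hij).2.1 (hF.sep i j hij).2.2

lemma FF_CP (hF : VFam x v y) {z : (Σ i, Fin (κ i)) → P2} (hz : z ∈ FF κ x v y) : CP z := by
  apply CP_of_support
  rintro ⟨i, l⟩
  obtain ⟨f, h1, h2⟩ := DD_support (hF.pos i) (hz i) l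
  refine ⟨f, ?_⟩
  rintro ⟨j, m⟩ hne
  by_cases hij : i = j
  · subst hij
    exact h1 m (fun h => hne (by rw [h]))
  · exact h2 _ (FF_cone κ hF hz hij m)

lemma FF_perm (hF : VFam x v y) {z : (Σ i, Fin (κ i)) → P2} (ρ : Equiv.Perm (Σ i, Fin (κ i)))
    (hz : z ∈ FF κ x v y) (hz' : z ∘ ρ ∈ FF κ x v y) : ρ = 1 := by
  have hfib : ∀ i l, (ρ ⟨i, l⟩).1 = i := by
    intro i l
    by_contra hne
    have h1 := FF_cone κ hF hz (i := i) (j := (ρ ⟨i, l⟩).1) (Ne.symm hne) (ρ ⟨i,l⟩).2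
    have h2 := DD_coords (hF.pos i) (hz' i) l
    simp only [Function.comp] at h2
    change z (ρ ⟨i, l⟩) ∈ _ at h1
    obtain ⟨a1, a2, a3⟩ := h1
    have e : det2 (v i - z (ρ ⟨i,l⟩)) (y i - v i) = det2 (v i - x i) (y i - v i) - det2 (z (ρ ⟨i,l⟩) - x i) (y i - v i) := by
      simp only [det2, Prod.fst_sub, Prod.snd_sub]; ring
    rw [e] at a3
    linarith [h2.1, h2.2.1, h2.2.2]
  have hex : ∀ i l, ∃ m, ρ ⟨i, l⟩ = ⟨i, m⟩ := by
    intro i l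
    have := hfib i l
    generalize ρ ⟨i, l⟩ = q at this
    obtain ⟨a, b⟩ := q
    simp only at this
    subst this
    exact ⟨b, rfl⟩
  choose f hf using hex
  have hfm : ∀ i, StrictMono (f i) := by
    intro i a b hab
    have m1 := (CC_mono1 (hz i)).1
    have m2 := (CC_mono1 (hz' i)).1 hab
    simp only [Function.comp, hf] at m2
    exact m1.lt_iff_lt.1 m2
  refine Equiv.ext ?_
  rintro ⟨i, l⟩
  have hb : Function.Bijective (f i) := Finite.injective_iff_bijective.1 (hfm i).injective
  have h4 : ((hfm i).orderIsoOfSurjective (f i) hb.2) = OrderIso.refl (Fin (κ i)) := Subsingleton.elim _ _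
  have := congrArg (fun e : Fin (κ i) ≃o Fin (κ i) => e l) h4
  have h5 : f i l = l := by simpa using this
  rw [hf, h5]; rfl

lemma sigma_curry_mp (κ : ι → ℕ) : MeasurePreserving
    (fun (z : ∀ i, Fin (κ i) → P2) (q : Σ i, Fin (κ i)) => z q.1 q.2) volume volume := by
  refine ⟨by fun_prop, ?_⟩
  symm
  rw [volume_pi (ι := Σ i, Fin (κ i))]
  refine Measure.pi_eq fun s hs => ?_
  rw [Measure.map_apply (by fun_prop) (MeasurableSet.univ_pi hs)]
  have : (fun (z : ∀ i, Fin (κ i) → P2) (q : Σ i, Fin (κ i)) => z q.1 q.2) ⁻¹' univ.pi s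
      = univ.pi (fun i => univ.pi fun j => s ⟨i, j⟩) := by
    ext z; simp [Sigma.forall]
  rw [this, volume_pi_pi, Fintype.prod_sigma]
  simp only [volume_pi_pi]

lemma measurableSet_DD (k : ℕ) (x v y : P2) : MeasurableSet (DD k x v y) := by
  have h : Measurable (AA x v y) := (AA x v y).continuous_of_finiteDimensional.measurable
  have : Measurable (fun z : Fin k → P2 => fun j => AA x v y (z j)) :=
    measurable_pi_lambda _ fun j => h.comp (measurable_pi_apply j)
  exact this (measurableSet_CC _ _ _)

lemma vol_FF : volume (FF κ x v y) = ∏ i, volume (DD (κ i) (x i) (v i) (y i)) := by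
  have hm : MeasurableSet (FF κ x v y) := by
    have : FF κ x v y = ⋂ i, (fun z : (Σ i, Fin (κ i)) → P2 => fun j => z ⟨i, j⟩) ⁻¹' (DD (κ i) (x i) (v i) (y i)) := by
      ext z; simp [FF]
    rw [this]
    exact MeasurableSet.iInter fun i => (by fun_prop : Measurable (fun z : (Σ i, Fin (κ i)) → P2 => fun j => z ⟨i, j⟩)) (measurableSet_DD _ _ _ _)
  rw [← (sigma_curry_mp κ).measure_preimage hm.nullMeasurableSet, ← volume_pi_pi]
  congr 1
  ext z; simp [FF]

/-- volume scaling for coordinatewise linear maps -/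
lemma vol_pi_linear (k : ℕ) (A : P2 →ₗ[ℝ] P2) (c : ℝ) (hc : LinearMap.det A = c) (hc0 : c ≠ 0) (s : Set (Fin k → P2)) :
    volume {z : Fin k → P2 | (fun j => A (z j)) ∈ s} = ENNReal.ofReal (|c|⁻¹ ^ k) * volume s := by
  have hd : LinearMap.det (LinearMap.pi fun j : Fin k => A ∘ₗ LinearMap.proj j) = c ^ k := by
    rw [LinearMap.det_pi]; simp [hc]
  have := Measure.addHaar_preimage_linearMap (volume : Measure (Fin k → P2)) (f := LinearMap.pi fun j : Fin k => A ∘ₗ LinearMap.proj j) (by rw [hd]; positivity) s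
  rw [hd] at this
  rw [abs_inv, abs_pow, ← inv_pow] at this
  exact this

lemma det_P2 (A : P2 →ₗ[ℝ] P2) : LinearMap.det A = det2 (A (1,0)) (A (0,1)) := by
  rw [← LinearMap.det_toMatrix (Module.Basis.finTwoProd ℝ), Matrix.det_fin_two]
  simp [LinearMap.toMatrix_apply, det2]
  ring

lemma det_AA (x v y : P2) : LinearMap.det (AA x v y) = det2 (v-x) (y-v) := by
  rw [det_P2]
  simp [AA, det2]; ring

lemma vol_DD (k : ℕ) {x v y : P2} (hΔ : 0 < det2 (v-x) (y-v)) :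
    volume (DD k x v y) = ENNReal.ofReal (det2 (v-x) (y-v) ^ k / ((k.factorial : ℝ) ^ 2 * (k+1).factorial)) := by
  have e1 : (AA x v y y).1 - (AA x v y x).1 = det2 (v-x) (y-v) := by
    simp [AA, det2]; ring
  have e2 : (AA x v y y).2 - (AA x v y x).2 = det2 (v-x) (y-v) := by
    simp [AA, det2]; ring
  rw [DD, vol_pi_linear k _ _ (det_AA x v y) hΔ.ne', vol_CC k _ _ (by linarith) (by linarith), e1, e2, ← ENNReal.ofReal_mul (by positivity)]
  congr 1
  rw [abs_of_pos hΔ]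
  have : (det2 (v-x) (y-v))⁻¹ ^ k * (det2 (v-x) (y-v) * det2 (v-x) (y-v)) ^ k = det2 (v-x) (y-v) ^ k := by
    rw [← mul_pow]; congr 1; field_simp
  rw [← this]; ring

/-- basic lower bound -/
lemma lower_fam (hF : VFam x v y) {K : Set P2} (hK : Convex ℝ K) (hx : ∀ i, x i ∈ K) (hv : ∀ i, v i ∈ K)
    (hy : ∀ i, y i ∈ K) (n : ℕ) (hn : ∑ i, κ i = n) :
    ENNReal.ofReal (n.factorial * ∏ i, (det2 (v i - x i) (y i - v i) ^ κ i / (((κ i).factorial : ℝ) ^ 2 * (κ i+1).factorial)))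
      ≤ volume {z : Fin n → P2 | (∀ i, z i ∈ K) ∧ CP z} := by
  classical
  have hcard : Fintype.card (Σ i, Fin (κ i)) = n := by simp [hn]
  let e : (Σ i, Fin (κ i)) ≃ Fin n := Fintype.equivFinOfCardEq hcard
  have mp (τ : (Σ i, Fin (κ i)) ≃ Fin n) : MeasurePreserving (fun (z : Fin n → P2) => z ∘ τ) volume volume := by
    have := volume_measurePreserving_piCongrLeft (fun _ : (Σ i, Fin (κ i)) => P2) τ.symm
    convert this using 1
    ext z i <;> simp [MeasurableEquiv.piCongrLeft, Equiv.piCongrLeft, Equiv.piCongrLeft']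
  have mp' (τ : Equiv.Perm (Σ i, Fin (κ i))) : MeasurePreserving (fun (z : (Σ i, Fin (κ i)) → P2) => z ∘ τ) volume volume := by
    have := volume_measurePreserving_piCongrLeft (fun _ : (Σ i, Fin (κ i)) => P2) τ.symm
    convert this using 1
    ext z i <;> simp [MeasurableEquiv.piCongrLeft, Equiv.piCongrLeft, Equiv.piCongrLeft']
  have hm : MeasurableSet (FF κ x v y) := by
    have : FF κ x v y = ⋂ i, (fun z : (Σ i, Fin (κ i)) → P2 => fun j => z ⟨i, j⟩) ⁻¹' (DD (κ i) (x i) (v i) (y i)) := by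
      ext z; simp [FF]
    rw [this]
    exact MeasurableSet.iInter fun i => (by fun_prop : Measurable (fun z : (Σ i, Fin (κ i)) → P2 => fun j => z ⟨i, j⟩)) (measurableSet_DD _ _ _ _)
  have h1 : ((n.factorial : ℕ) : ENNReal) * volume (FF κ x v y) ≤ volume (⋃ τ : Equiv.Perm (Σ i, Fin (κ i)), (fun (z : (Σ i, Fin (κ i)) → P2) => z ∘ τ) ⁻¹' FF κ x v y) := by
    have := grp_le (G := Equiv.Perm (Σ i, Fin (κ i))) (fun τ (z : (Σ i, Fin (κ i)) → P2) => z ∘ τ) mp' (F := FF κ x v y)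
      (Ω := ⋃ τ : Equiv.Perm (Σ i, Fin (κ i)), (fun (z : (Σ i, Fin (κ i)) → P2) => z ∘ τ) ⁻¹' FF κ x v y) hm ?_ ?_
    · rwa [Fintype.card_perm, hcard] at this
    · intro σ τ z h1 h2
      have : τ⁻¹ * σ = 1 := by
        refine FF_perm κ hF _ h2 ?_
        have e : (z ∘ τ) ∘ ⇑(τ⁻¹ * σ) = z ∘ σ := by funext i; simp
        rw [e]; exact h1
      rw [inv_mul_eq_one] at this; exact this.symm
    · intro σ z h
      exact mem_iUnion.2 ⟨σ, h⟩
  have h2 : ENNReal.ofReal (n.factorial * ∏ i, (det2 (v i - x i) (y i - v i) ^ κ i / (((κ i).factorial : ℝ) ^ 2 * (κ i+1).factorial)))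
      = ((n.factorial : ℕ) : ENNReal) * volume (FF κ x v y) := by
    rw [vol_FF, ENNReal.ofReal_mul (by positivity), ENNReal.ofReal_natCast, ENNReal.ofReal_prod_of_nonneg]
    · simp only [vol_DD _ (hF.pos _)]
    · intro i _
      have := hF.pos i
      positivity
  rw [h2]
  refine h1.trans ?_
  have hmU : MeasurableSet (⋃ τ : Equiv.Perm (Σ i, Fin (κ i)), (fun (z : (Σ i, Fin (κ i)) → P2) => z ∘ τ) ⁻¹' FF κ x v y) :=
    MeasurableSet.iUnion fun τ => (mp' τ).measurable hm
  rw [← (mp e).measure_preimage hmU.nullMeasurableSet]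
  apply measure_mono
  intro z hz
  obtain ⟨τ, hτ⟩ := mem_iUnion.1 hz
  let π : (Σ i, Fin (κ i)) ≃ Fin n := τ.trans e
  have hτ' : z ∘ π ∈ FF κ x v y := hτ
  refine ⟨fun i => ?_, ?_⟩
  · obtain ⟨⟨a, b⟩, rfl⟩ := π.surjective i
    exact DD_mem_hull (hF.pos a) (hτ' a) b hK (hx a) (hv a) (hy a)
  · have h := FF_CP κ hF hτ'
    intro i
    obtain ⟨q, rfl⟩ := π.surjective i
    have := h q
    rwa [π.surjective.range_comp] at this
end fam

end partP2b

section partP2c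

lemma piAntidiag_card_le {ι : Type} [Fintype ι] [DecidableEq ι] (n : ℕ) :
    (Finset.piAntidiag (Finset.univ : Finset ι) n).card ≤ (n+1) ^ Fintype.card ι := by
  have h : Finset.piAntidiag (Finset.univ : Finset ι) n ⊆ Fintype.piFinset (fun _ : ι => Finset.range (n+1)) := by
    intro κ hκ
    rw [Finset.mem_piAntidiag] at hκ
    rw [Fintype.mem_piFinset]
    intro i
    rw [Finset.mem_range, Nat.lt_succ_iff, ← hκ.1]
    exact Finset.single_le_sum (f := κ) (fun _ _ => Nat.zero_le _) (Finset.mem_univ i)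
  refine (Finset.card_le_card h).trans ?_
  rw [Fintype.card_piFinset]; simp

/-- pigeonhole for the multinomial theorem -/
lemma pigeon {ι : Type} [Fintype ι] [Nonempty ι] (t : ι → ℝ) (ht : ∀ i, 0 ≤ t i) (n : ℕ) :
    ∃ κ : ι → ℕ, ∑ i, κ i = n ∧
      (∑ i, t i) ^ n ≤ (n+1 : ℝ) ^ Fintype.card ι * (n.factorial * ∏ i, (t i ^ κ i / (κ i).factorial)) := by
  classical
  by_contra hcon
  push Not at hcon
  have h := Finset.sum_pow_eq_sum_piAntidiag Finset.univ t n
  have hterm : ∀ κ ∈ Finset.piAntidiag (Finset.univ : Finset ι) n,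
      ((Nat.multinomial Finset.univ κ : ℕ) : ℝ) * ∏ i, t i ^ κ i = n.factorial * ∏ i, (t i ^ κ i / (κ i).factorial) := by
    intro κ hκ
    rw [Finset.mem_piAntidiag] at hκ
    have h1 := Nat.multinomial_spec Finset.univ κ
    rw [hκ.1] at h1
    rw [← h1, Finset.prod_div_distrib]
    push_cast
    have : (∏ i, ((κ i).factorial : ℝ)) ≠ 0 := by positivity
    field_simp
  rw [Finset.sum_congr rfl hterm] at h
  have hpos : (0:ℝ) < (n+1 : ℝ) ^ Fintype.card ι := by positivity
  have hne : (Finset.piAntidiag (Finset.univ : Finset ι) n).Nonempty := by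
    obtain ⟨i0⟩ := ‹Nonempty ι›
    refine ⟨Pi.single i0 n, ?_⟩
    rw [Finset.mem_piAntidiag]
    exact ⟨by simp, fun i _ => Finset.mem_univ i⟩
  have hlt : ∑ κ ∈ Finset.piAntidiag (Finset.univ : Finset ι) n, (n.factorial * ∏ i, (t i ^ κ i / (κ i).factorial) : ℝ)
        < ∑ κ ∈ Finset.piAntidiag (Finset.univ : Finset ι) n, (∑ i, t i) ^ n / (n+1 : ℝ) ^ Fintype.card ι := by
      apply Finset.sum_lt_sum_of_nonempty hne
      intro κ hκ
      rw [Finset.mem_piAntidiag] at hκ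
      rw [lt_div_iff₀ hpos, mul_comm]
      exact hcon κ hκ.1
  rw [← h, Finset.sum_const, nsmul_eq_mul] at hlt
  have hc : ((Finset.piAntidiag (Finset.univ : Finset ι) n).card : ℝ) ≤ (n+1 : ℝ) ^ Fintype.card ι := by
      exact_mod_cast piAntidiag_card_le n
  have hT : 0 ≤ (∑ i, t i) ^ n / (n+1 : ℝ) ^ Fintype.card ι := div_nonneg (pow_nonneg (Finset.sum_nonneg fun i _ => ht i) _) hpos.le
  have := mul_le_mul_of_nonneg_right hc hT
  rw [mul_div_cancel₀ _ hpos.ne'] at this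
  linarith

lemma lower_main {ι : Type} [Fintype ι] [Nonempty ι] {x v y : ι → P2} (hF : VFam x v y) {K : Set P2} (hK : Convex ℝ K)
    (hx : ∀ i, x i ∈ K) (hv : ∀ i, v i ∈ K) (hy : ∀ i, y i ∈ K) (t : ι → ℝ) (ht0 : ∀ i, 0 ≤ t i)
    (ht : ∀ i, 2 * t i ^ 3 = det2 (v i - x i) (y i - v i)) (n : ℕ) :
    ENNReal.ofReal (2 ^ n * (∑ i, t i) ^ (3 * n) / ((n.factorial : ℝ) ^ 2 * (n + 1) ^ (4 * Fintype.card ι)))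
      ≤ volume {z : Fin n → P2 | (∀ i, z i ∈ K) ∧ CP z} := by
  obtain ⟨κ, hκ, hle⟩ := pigeon t ht0 n
  refine le_trans (ENNReal.ofReal_le_ofReal ?_) (lower_fam κ hF hK hx hv hy n hκ)
  set m := Fintype.card ι
  set P := ∏ i, (t i ^ κ i / ((κ i).factorial : ℝ)) with hP
  have hP0 : 0 ≤ P := Finset.prod_nonneg fun i _ => div_nonneg (pow_nonneg (ht0 i) _) (by positivity)
  have hκn : ∀ i, κ i ≤ n := fun i => by
    rw [← hκ]; exact Finset.single_le_sum (f := κ) (fun _ _ => Nat.zero_le _) (Finset.mem_univ i)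
  have h1 : 2 ^ n * P ^ 3 / (n+1 : ℝ) ^ m ≤ ∏ i, (det2 (v i - x i) (y i - v i) ^ κ i / (((κ i).factorial : ℝ) ^ 2 * (κ i+1).factorial)) := by
    have e : 2 ^ n * P ^ 3 / (n+1 : ℝ) ^ m = ∏ i, (2 ^ κ i * (t i ^ κ i / ((κ i).factorial : ℝ)) ^ 3 / (n+1 : ℝ)) := by
      rw [Finset.prod_div_distrib, Finset.prod_mul_distrib, Finset.prod_pow, ← hP, Finset.prod_pow_eq_pow_sum, hκ]
      simp [m]
    rw [e]
    apply Finset.prod_le_prod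
    · intro i _; have := ht0 i; positivity
    · intro i _
      rw [← ht i, Nat.factorial_succ]
      have hk : ((κ i : ℝ) + 1) ≤ n + 1 := by have := hκn i; have : (κ i : ℝ) ≤ n := by exact_mod_cast this
                                              linarith
      have hf : (0:ℝ) < (κ i).factorial := by positivity
      have hk0 : (0:ℝ) < (κ i : ℝ) + 1 := by positivity
      have e2 : (2 * t i ^ 3) ^ κ i / (((κ i).factorial : ℝ) ^ 2 * (((κ i + 1) * (κ i).factorial : ℕ) : ℝ))
        = 2 ^ κ i * (t i ^ κ i / ((κ i).factorial : ℝ)) ^ 3 / ((κ i : ℝ) + 1) := by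
        push_cast; rw [mul_pow, ← pow_mul, mul_comm 3, pow_mul, div_pow]; field_simp
      rw [e2]
      have := ht0 i
      apply div_le_div_of_nonneg_left _ hk0 hk
      positivity
  have hn : (0:ℝ) < n.factorial := by positivity
  refine le_trans ?_ (mul_le_mul_of_nonneg_left h1 hn.le)
  have hT0 : 0 ≤ (∑ i, t i) ^ n := pow_nonneg (Finset.sum_nonneg fun i _ => ht0 i) _
  have h3 : (∑ i, t i) ^ (3 * n) ≤ ((n+1 : ℝ) ^ m * (n.factorial * P)) ^ 3 := by
    rw [mul_comm, pow_mul]; exact pow_le_pow_left₀ hT0 hle 3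
  have hn1 : (0:ℝ) < (n + 1 : ℝ) := by positivity
  calc _ ≤ 2 ^ n * ((n+1 : ℝ) ^ m * (n.factorial * P)) ^ 3 / ((n.factorial : ℝ) ^ 2 * (n + 1) ^ (4 * m)) := by gcongr
    _ = _ := by
      rw [show 4 * m = m * 3 + m by ring, pow_add, pow_mul]
      field_simp

end partP2c

section partP3a

/-- dot product -/
def dot2 (u w : P2) : ℝ := u.1 * w.1 + u.2 * w.2

/-- a cyclic family of directions -/
structure Dirs (ι : Type) where
  u : ι → P2
  nxt : ι → ι
  hdet : ∀ i, 0 < det2 (u i) (u (nxt i))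
  cover : ∀ w : P2, ∃ i, ∃ s r : ℝ, 0 ≤ s ∧ 0 ≤ r ∧ w = s • u i + r • u (nxt i)
  sep : ∀ j k, det2 (u j) (u k) ≤ 0 ∨ 0 ≤ det2 (u (nxt j)) (u k)
  dotn : ∀ i, 0 ≤ dot2 (u i) (u (nxt i))
  nrm : ∀ i, dot2 (u i) (u i) = 1

variable {ι : Type}

/-- adapted coordinates -/
def LL (D : Dirs ι) (i : ι) : P2 →ₗ[ℝ] P2 where
  toFun w := (dot2 (D.u (D.nxt i)) w, - dot2 (D.u i) w)
  map_add' a b := by ext <;> simp [dot2] <;> ring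
  map_smul' c a := by ext <;> simp [dot2] <;> ring

lemma det_LL (D : Dirs ι) (i : ι) : LinearMap.det (LL D i) = det2 (D.u i) (D.u (D.nxt i)) := by
  rw [det_P2]
  simp [LL, det2, dot2]; ring

/-- chains, with no condition for the empty chain -/
def CCu (k : ℕ) (x y : P2) : Set (Fin k → P2) := if k = 0 then univ else CC k x y

lemma exists_sort {α : Type*} [Fintype α] (f : α → ℝ) (hf : Function.Injective f) :
    ∃ e : Fin (Fintype.card α) ≃ α, StrictMono (f ∘ e) := by
  let e0 := (Fintype.equivFin α).symm
  refine ⟨(Tuple.sort (f ∘ e0)).trans e0, ?_⟩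
  refine (Tuple.monotone_sort (f ∘ e0)).strictMono_of_injective ?_
  exact (hf.comp e0.injective).comp (Tuple.sort (f ∘ e0)).injective

/-- triangle-type hull membership -/
lemma mem_hull_of_between {S : Set P2} (p a b c d : P2) (ha : a ∈ S) (hb : b ∈ S) (hc : c ∈ S) (hd : d ∈ S)
    (h1 : a.1 < p.1) (h2 : p.1 < b.1) (h3 : (p.2 - a.2) * (b.1 - a.1) ≥ (b.2 - a.2) * (p.1 - a.1))
    (h4 : c.1 < p.1) (h5 : p.1 ≤ d.1) (h6 : (p.2 - c.2) * (d.1 - c.1) ≤ (d.2 - c.2) * (p.1 - c.1)) :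
    p ∈ convexHull ℝ S := by
  set H := convexHull ℝ S
  have cH : Convex ℝ H := convex_convexHull ℝ S
  have sub : S ⊆ H := subset_convexHull ℝ S
  have hab : 0 < b.1 - a.1 := by linarith
  have hcd : 0 < d.1 - c.1 := by linarith
  set q1 : ℝ := a.2 + (b.2 - a.2) * ((p.1 - a.1) / (b.1 - a.1)) with hq1
  set q2 : ℝ := c.2 + (d.2 - c.2) * ((p.1 - c.1) / (d.1 - c.1)) with hq2
  have m1 : ((p.1, q1) : P2) ∈ H := by
    have := cH.add_smul_sub_mem (sub ha) (sub hb) (t := (p.1 - a.1) / (b.1 - a.1)) ⟨div_nonneg (by linarith) hab.le, by rw [div_le_one hab]; linarith⟩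
    convert this using 1
    ext
    · simp; field_simp; ring
    · simp [hq1]; ring
  have m2 : ((p.1, q2) : P2) ∈ H := by
    have := cH.add_smul_sub_mem (sub hc) (sub hd) (t := (p.1 - c.1) / (d.1 - c.1)) ⟨div_nonneg (by linarith) hcd.le, by rw [div_le_one hcd]; linarith⟩
    convert this using 1
    ext
    · simp; field_simp; ring
    · simp [hq2]; ring
  have l1 : q1 ≤ p.2 := by
    have : (b.2 - a.2) * ((p.1 - a.1) / (b.1 - a.1)) ≤ p.2 - a.2 := by
      rw [← mul_div_assoc, div_le_iff₀ hab]; exact h3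
    linarith
  have l2 : p.2 ≤ q2 := by
    have : p.2 - c.2 ≤ (d.2 - c.2) * ((p.1 - c.1) / (d.1 - c.1)) := by
      rw [← mul_div_assoc, le_div_iff₀ hcd]; exact h6
    linarith
  rcases (l1.trans l2).eq_or_lt with he | hlt
  · have : p = (p.1, q1) := by ext; rfl; simp only; linarith
    rw [this]; exact m1
  · have := cH.add_smul_sub_mem m1 m2 (t := (p.2 - q1) / (q2 - q1)) ⟨div_nonneg (by linarith) (by linarith), by rw [div_le_one (by linarith)]; linarith⟩
    convert this using 1
    have : q2 - q1 ≠ 0 := by linarith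
    ext
    · simp
    · simp; field_simp; ring

/-- an ordered group below a chord in convex position is a convex chain -/
lemma group_chain {k : ℕ} (hk : k ≠ 0) (x y : P2) (z : Fin k → P2) (hmono : StrictMono fun i => (z i).1)
    (hx : ∀ i, x.1 < (z i).1 ∧ (z i).1 < y.1) (hy : ∀ i, x.2 < (z i).2)
    (hchord : ∀ i, ((z i).2 - x.2) * (y.1 - x.1) ≤ (y.2 - x.2) * ((z i).1 - x.1))
    (hcp : ∀ i, z i ∉ convexHull ℝ ({x, y} ∪ z '' {i}ᶜ)) : z ∈ CC k x y := by
  have hxy : x.1 < y.1 := (hx ⟨0, by omega⟩).1.trans (hx ⟨0, by omega⟩).2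
  have h1 : ∀ j : Fin (k+1), 0 < (inc x y z j).1 := by
    have := (chain_iff x y z Prod.fst hxy).2 ⟨hmono, hx⟩
    intro j
    simp only [inc, Prod.fst_sub]; linarith [this j]
  have hmem : ∀ (n : ℕ) (i : Fin k), n ≠ i + 1 → ZZ x y z n ∈ ({x, y} ∪ z '' {i}ᶜ : Set P2) := by
    intro n i hn
    unfold ZZ
    split_ifs with h h'
    · simp
    · right
      exact ⟨_, fun h2 => hn (by rw [mem_singleton_iff, Fin.ext_iff] at h2; simp only at h2; omega), rfl⟩
    · simp
  have hS : StrictMono (fun j => slp (inc x y z j)) := by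
    rw [Fin.strictMono_iff_lt_succ]
    intro i
    by_contra hcon
    push Not at hcon
    apply hcp i
    have e1 := h1 i.castSucc
    have e2 := h1 i.succ
    simp only [slp] at hcon
    rw [div_le_div_iff₀ e2 e1] at hcon
    simp only [inc, Fin.val_castSucc, Fin.val_succ, ZZ_succ, Prod.fst_sub, Prod.snd_sub] at hcon e1 e2
    refine mem_hull_of_between (z i) (ZZ x y z i) (ZZ x y z (i+1+1)) x y (hmem _ _ (by omega)) (hmem _ _ (by omega)) (by simp) (by simp)
      (by linarith) (by linarith) (by nlinarith) (hx i).1 (hx i).2.le (hchord i)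
  refine ⟨?_, hS⟩
  have hp0 : 0 < (inc x y z 0).2 := by
    have := ZZ_succ x y z ⟨0, by omega⟩
    have h := hy ⟨0, by omega⟩
    simp only [inc, Fin.val_zero, ZZ_zero, Prod.snd_sub]
    simp only at this
    rw [this]; linarith
  intro j
  refine ⟨h1 j, ?_⟩
  have h0 : 0 < slp (inc x y z j) := lt_of_lt_of_le (div_pos hp0 (h1 0)) (hS.monotone (Fin.zero_le j))
  have : (inc x y z j).2 = slp (inc x y z j) * (inc x y z j).1 := by
    rw [slp, div_mul_cancel₀ _ (h1 j).ne']
  rw [this]; exact mul_pos h0 (h1 j)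

end partP3a

section partP3b

variable {ι : Type}

lemma LL_inj (D : Dirs ι) (i : ι) : Function.Injective (LL D i) := by
  have h : LinearMap.det (LL D i) ≠ 0 := by rw [det_LL]; exact (D.hdet i).ne'
  exact ((LL D i).equivOfDetNeZero h).injective

lemma exists_sep {ι' : Type*} [Finite ι'] (a : ι' → P2) (p : P2) (hp : p ∉ convexHull ℝ (range a)) :
    ∃ w : P2, ∀ i, dot2 w (a i) < dot2 w p := by
  have hc : IsClosed (convexHull ℝ (range a)) := (Set.finite_range a).isClosed_convexHull ℝ
  obtain ⟨f, c, h1, h2⟩ := geometric_hahn_banach_closed_point (convex_convexHull ℝ _) hc hp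
  have hf : ∀ w, f w = dot2 (f (1,0), f (0,1)) w := by
    intro w
    have : w = w.1 • ((1:ℝ),(0:ℝ)) + w.2 • ((0:ℝ),(1:ℝ)) := by ext <;> simp
    conv_lhs => rw [this]
    rw [map_add, map_smul, map_smul]; simp [dot2]; ring
  refine ⟨(f (1,0), f (0,1)), fun i => ?_⟩
  rw [← hf, ← hf]
  exact (h1 _ (subset_convexHull ℝ _ ⟨i, rfl⟩)).trans h2

lemma cover_ex [Fintype ι] (D : Dirs ι) {n : ℕ} (hn : 0 < n) (z : Fin n → P2) (hCP : CP z)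
    (hgen : ∀ i k l, k ≠ l → dot2 (D.u i) (z k) ≠ dot2 (D.u i) (z l)) :
    ∃ s : ι → Fin n, ∃ κ : ι → ℕ, ∃ π : (Σ i, Fin (κ i)) ≃ {k // k ∉ range s},
      (∀ i k, dot2 (D.u i) (z k) ≤ dot2 (D.u i) (z (s i))) ∧
      ∀ i, (fun j => LL D i (z (π ⟨i, j⟩))) ∈ CCu (κ i) (LL D i (z (s i))) (LL D i (z (s (D.nxt i)))) := by
  classical
  haveI : Nonempty (Fin n) := ⟨⟨0, hn⟩⟩
  have hmax : ∀ i, ∃ k, ∀ l, dot2 (D.u i) (z l) ≤ dot2 (D.u i) (z k) := fun i => Finite.exists_max _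
  choose s hs using hmax
  haveI : Nonempty ι := ⟨(D.cover 0).choose⟩
  have hinj : Function.Injective z := by
    intro k l hkl
    by_contra hne
    exact hgen (Classical.arbitrary ι) k l hne (by rw [hkl])
  have hgrp : ∀ k : {k // k ∉ range s}, ∃ i, ∃ σ ρ : ℝ, 0 ≤ σ ∧ 0 ≤ ρ ∧
      ∀ l, dot2 (σ • D.u i + ρ • D.u (D.nxt i)) (z (s l)) < dot2 (σ • D.u i + ρ • D.u (D.nxt i)) (z k) := by
    rintro ⟨k, hk⟩
    have : z k ∉ convexHull ℝ (range (z ∘ s)) := by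
      intro h
      apply hCP k
      refine convexHull_mono ?_ h
      rintro _ ⟨l, rfl⟩
      exact ⟨⟨s l, rfl⟩, fun h => hk ⟨l, hinj h⟩⟩
    obtain ⟨w, hw⟩ := exists_sep _ _ this
    obtain ⟨i, σ, ρ, h1, h2, rfl⟩ := D.cover w
    exact ⟨i, σ, ρ, h1, h2, hw⟩
  choose g σ ρ hσ hρ hsep using hgrp
  have hsort : ∀ i, ∃ e : Fin (Fintype.card {k // g k = i}) ≃ {k // g k = i}, StrictMono ((fun k : {k // g k = i} => dot2 (D.u (D.nxt i)) (z k.1)) ∘ e) := by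
    intro i
    apply exists_sort
    intro k l hkl
    by_contra hne
    exact hgen (D.nxt i) k.1 l.1 (fun h => hne (Subtype.ext (Subtype.ext h))) hkl
  choose e he using hsort
  refine ⟨s, fun i => Fintype.card {k // g k = i}, (Equiv.sigmaCongrRight e).trans (Equiv.sigmaFiberEquiv g), hs, ?_⟩
  intro i
  have hval : ∀ j, ((Equiv.sigmaCongrRight e).trans (Equiv.sigmaFiberEquiv g)) ⟨i, j⟩ = (e i j).1 := fun j => rfl
  simp only [hval]
  rw [CCu]
  split_ifs with h0
  · trivial
  -- strict inequalities for the group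
  have key : ∀ k : {k // k ∉ range s}, g k = i → 
      dot2 (D.u (D.nxt i)) (z (s i)) < dot2 (D.u (D.nxt i)) (z k) ∧ dot2 (D.u (D.nxt i)) (z k) < dot2 (D.u (D.nxt i)) (z (s (D.nxt i))) ∧
      dot2 (D.u i) (z k) < dot2 (D.u i) (z (s i)) ∧ 
      (dot2 (D.u i) (z (s i)) - dot2 (D.u i) (z k)) * (dot2 (D.u (D.nxt i)) (z (s (D.nxt i))) - dot2 (D.u (D.nxt i)) (z (s i))) ≤
      (dot2 (D.u i) (z (s i)) - dot2 (D.u i) (z (s (D.nxt i)))) * (dot2 (D.u (D.nxt i)) (z k) - dot2 (D.u (D.nxt i)) (z (s i))) := by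
    rintro k rfl
    have hne : ∀ l, (k:Fin n) ≠ s l := fun l h => k.2 ⟨l, h.symm⟩
    have a1 := lt_of_le_of_ne (hs (g k) k) (hgen (g k) _ _ (hne _))
    have a2 := lt_of_le_of_ne (hs (D.nxt (g k)) k) (hgen (D.nxt (g k)) _ _ (hne _))
    have s1 := hsep k (g k)
    have s2 := hsep k (D.nxt (g k))
    have hdd : ∀ w, dot2 (σ k • D.u (g k) + ρ k • D.u (D.nxt (g k))) w = σ k * dot2 (D.u (g k)) w + ρ k * dot2 (D.u (D.nxt (g k))) w := by
      intro w; simp [dot2]; ring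
    rw [hdd, hdd] at s1 s2
    have p1 := hσ k
    have p2 := hρ k
    have b1 : 0 < dot2 (D.u (D.nxt (g k))) (z k) - dot2 (D.u (D.nxt (g k))) (z (s (g k))) := by
      by_contra hc; push Not at hc
      nlinarith
    refine ⟨by linarith, a2, a1, ?_⟩
    have r0 : 0 < ρ k := by
      rcases p2.eq_or_lt with h | h
      · rw [← h] at s1; nlinarith
      · exact h
    have b2 : 0 < σ k := by
      rcases p1.eq_or_lt with h | h
      · rw [← h] at s2; nlinarith
      · exact h
    -- separation: ρ X - σ Y larger at k
    set X := dot2 (D.u (D.nxt (g k))) (z k) - dot2 (D.u (D.nxt (g k))) (z (s (g k)))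
    set Y := dot2 (D.u (g k)) (z (s (g k))) - dot2 (D.u (g k)) (z k)
    set X1 := dot2 (D.u (D.nxt (g k))) (z (s (D.nxt (g k)))) - dot2 (D.u (D.nxt (g k))) (z (s (g k)))
    set Y1 := dot2 (D.u (g k)) (z (s (g k))) - dot2 (D.u (g k)) (z (s (D.nxt (g k))))
    have t1 : σ k * Y < ρ k * X := by simp only [X, Y]; linarith
    have t2 : σ k * Y + ρ k * X1 < ρ k * X + σ k * Y1 := by simp only [X, Y, X1, Y1]; linarith
    have t3 : X < X1 := by simp only [X, X1]; linarith
    have t4 : 0 < Y := by simp only [Y]; linarith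
    by_contra hc; push Not at hc
    -- Y1 X < Y X1; from t2: ρ (X1 - X) < σ (Y1 - Y)
    have t5 : ρ k * (X1 - X) * X < σ k * (Y1 - Y) * X := by
      apply mul_lt_mul_of_pos_right _ b1; linarith
    have t6 : σ k * (Y1 * X - Y * X) < σ k * (Y * X1 - Y * X) := by
      apply mul_lt_mul_of_pos_left _ b2; linarith
    have t7 : σ k * Y * (X1 - X) < ρ k * X * (X1 - X) := by
      apply mul_lt_mul_of_pos_right t1; linarith
    nlinarith
  refine group_chain h0 _ _ _ ?_ ?_ ?_ ?_ ?_
  · exact he i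
  · intro j
    have := key (e i j).1 (e i j).2
    exact ⟨this.1, this.2.1⟩
  · intro j
    have := (key (e i j).1 (e i j).2).2.2.1
    simp only [LL, LinearMap.coe_mk, AddHom.coe_mk]
    linarith
  · intro j
    have := (key (e i j).1 (e i j).2).2.2.2
    simp only [LL, LinearMap.coe_mk, AddHom.coe_mk]
    linarith
  · intro j hmem
    have hsub : ({LL D i (z (s i)), LL D i (z (s (D.nxt i)))} ∪ (fun j => LL D i (z (e i j).1)) '' {j}ᶜ : Set P2) ⊆ LL D i '' (range z \ {z (e i j).1}) := by
      have hne : ∀ l, s l ≠ ((e i j).1 : Fin n) := fun l h => (e i j).1.2 ⟨l, h⟩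
      rintro w ((rfl | rfl) | ⟨l, hl, rfl⟩)
      · exact ⟨_, ⟨⟨_, rfl⟩, fun h => hne _ (hinj h)⟩, rfl⟩
      · exact ⟨_, ⟨⟨_, rfl⟩, fun h => hne _ (hinj h)⟩, rfl⟩
      · refine ⟨_, ⟨⟨_, rfl⟩, fun h => hl ?_⟩, rfl⟩
        exact (e i).injective (Subtype.ext (Subtype.ext (hinj h)))
    have h2 := convexHull_mono hsub hmem
    rw [← LinearMap.image_convexHull] at h2
    obtain ⟨w, hw, hw2⟩ := h2
    rw [LL_inj D i hw2] at hw
    exact hCP _ hw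

end partP3b

section partP3c

variable {ι : Type}

/-- `Δ_i(a)` -/
def dl (D : Dirs ι) (a : ι → P2) (i : ι) : ℝ :=
  dot2 (D.u i) (a i - a (D.nxt i)) * dot2 (D.u (D.nxt i)) (a (D.nxt i) - a i) / det2 (D.u i) (D.u (D.nxt i))

/-- support condition -/
def SupC (D : Dirs ι) (a : ι → P2) : Prop := ∀ i k, dot2 (D.u i) (a k) ≤ dot2 (D.u i) (a i)

lemma dot2_sub (u a b : P2) : dot2 u (a - b) = dot2 u a - dot2 u b := by simp [dot2]; ring

lemma dl_nonneg (D : Dirs ι) {a : ι → P2} (ha : SupC D a) (i : ι) : 0 ≤ dl D a i := by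
  unfold dl
  rw [dot2_sub, dot2_sub]
  exact div_nonneg (mul_nonneg (by linarith [ha i (D.nxt i)]) (by linarith [ha (D.nxt i) i])) (D.hdet i).le

/-- `t_i(a)` -/
def tl (D : Dirs ι) (a : ι → P2) (i : ι) : ℝ := (dl D a i / 2) ^ ((1:ℝ)/3)

lemma tl_nonneg (D : Dirs ι) {a : ι → P2} (ha : SupC D a) (i : ι) : 0 ≤ tl D a i :=
  Real.rpow_nonneg (div_nonneg (dl_nonneg D ha i) (by norm_num)) _

lemma tl_cube (D : Dirs ι) {a : ι → P2} (ha : SupC D a) (i : ι) : 2 * tl D a i ^ 3 = dl D a i := by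
  unfold tl
  rw [← Real.rpow_natCast, ← Real.rpow_mul (div_nonneg (dl_nonneg D ha i) (by norm_num))]
  norm_num; ring

lemma measurable_inc' {α : Type*} [MeasurableSpace α] {k : ℕ} {x y : α → P2} {z : α → Fin k → P2}
    (hx : Measurable x) (hy : Measurable y) (hz : Measurable z) (j : Fin (k+1)) :
    Measurable (fun w => inc (x w) (y w) (z w) j) := by
  have : ∀ n, Measurable (fun w => ZZ (x w) (y w) (z w) n) := by
    intro n; unfold ZZ; split_ifs <;> fun_prop
  exact (this _).sub (this _)

lemma measurableSet_CCu' {α : Type*} [MeasurableSpace α] {k : ℕ} {x y : α → P2} {z : α → Fin k → P2}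
    (hx : Measurable x) (hy : Measurable y) (hz : Measurable z) :
    MeasurableSet {w | z w ∈ CCu k (x w) (y w)} := by
  unfold CCu
  split_ifs with h
  · simp
  · have hi := measurable_inc' hx hy hz
    have : {w | z w ∈ CC k (x w) (y w)} = (⋂ j, ({w | 0 < (inc (x w) (y w) (z w) j).1} ∩ {w | 0 < (inc (x w) (y w) (z w) j).2})) ∩
        ⋂ i, ⋂ j, ⋂ (_ : i < j), {w | slp (inc (x w) (y w) (z w) i) < slp (inc (x w) (y w) (z w) j)} := by
      ext w; simp [CC, StrictMono]
    rw [this]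
    refine (MeasurableSet.iInter fun j => ((measurableSet_lt measurable_const (hi j).fst).inter
      (measurableSet_lt measurable_const (hi j).snd))).inter ?_
    refine MeasurableSet.iInter fun i => MeasurableSet.iInter fun j => MeasurableSet.iInter fun _ => ?_
    exact measurableSet_lt ((hi i).snd.div (hi i).fst) ((hi j).snd.div (hi j).fst)

lemma vol_CCu_le (k : ℕ) (x y : P2) :
    volume (CCu k x y) ≤ ENNReal.ofReal (((y.1 - x.1) * (y.2 - x.2)) ^ k / ((k.factorial : ℝ) ^ 2 * (k+1).factorial)) := by
  unfold CCu
  split_ifs with h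
  · subst h; simp [volume_pi]
  · exact vol_CC_le k x y

lemma vol_grp_le (D : Dirs ι) (a : ι → P2) (i : ι) (k : ℕ) :
    volume {w : Fin k → P2 | (fun j => LL D i (w j)) ∈ CCu k (LL D i (a i)) (LL D i (a (D.nxt i)))} ≤
      ENNReal.ofReal (dl D a i ^ k / ((k.factorial : ℝ) ^ 2 * (k+1).factorial)) := by
  rw [vol_pi_linear k _ _ (det_LL D i) (D.hdet i).ne']
  refine (mul_le_mul_right (vol_CCu_le _ _ _) _).trans (le_of_eq ?_)
  rw [← ENNReal.ofReal_mul (by positivity)]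
  congr 1
  rw [abs_of_pos (D.hdet i)]
  have : dl D a i = (det2 (D.u i) (D.u (D.nxt i)))⁻¹ * (((LL D i (a (D.nxt i))).1 - (LL D i (a i)).1) * ((LL D i (a (D.nxt i))).2 - (LL D i (a i)).2)) := by
    simp only [dl, LL, LinearMap.coe_mk, AddHom.coe_mk, dot2_sub]; ring
  rw [this, mul_pow (det2 (D.u i) (D.u (D.nxt i)))⁻¹ _ k, mul_div_assoc]

lemma multinomial_le [Fintype ι] (t : ι → ℝ) (ht : ∀ i, 0 ≤ t i) (κ : ι → ℕ) :
    ∏ i, (t i ^ κ i / ((κ i).factorial : ℝ)) ≤ (∑ i, t i) ^ (∑ i, κ i) / ((∑ i, κ i).factorial : ℝ) := by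
  classical
  set n := ∑ i, κ i with hn
  have h := Finset.sum_pow_eq_sum_piAntidiag Finset.univ t n
  have h1 := Nat.multinomial_spec Finset.univ κ
  rw [← hn] at h1
  have hmem : κ ∈ Finset.piAntidiag (Finset.univ : Finset ι) n := by
    rw [Finset.mem_piAntidiag]; exact ⟨hn.symm, fun i _ => Finset.mem_univ i⟩
  have h2 := Finset.single_le_sum (f := fun κ : ι → ℕ => ((Nat.multinomial Finset.univ κ : ℕ) : ℝ) * ∏ i, t i ^ κ i)
    (fun κ _ => mul_nonneg (by positivity) (Finset.prod_nonneg fun i _ => pow_nonneg (ht i) _)) hmem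
  rw [← h] at h2
  have hf : (0:ℝ) < n.factorial := by positivity
  rw [le_div_iff₀ hf, Finset.prod_div_distrib, ← h1]
  push_cast
  have : (∏ i, ((κ i).factorial : ℝ)) ≠ 0 := by positivity
  refine le_trans (le_of_eq ?_) h2
  field_simp

lemma prod_dl_le [Fintype ι] (D : Dirs ι) {a : ι → P2} (ha : SupC D a) (κ : ι → ℕ) {T : ℝ} (hT : ∑ i, tl D a i ≤ T) :
    ∏ i, (dl D a i ^ κ i / (((κ i).factorial : ℝ) ^ 2 * (κ i+1).factorial)) ≤
      2 ^ (∑ i, κ i) * T ^ (3 * ∑ i, κ i) / ((∑ i, κ i).factorial : ℝ) ^ 3 := by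
  have h0 := tl_nonneg D ha
  have hs : 0 ≤ ∑ i, tl D a i := Finset.sum_nonneg fun i _ => h0 i
  calc _ ≤ ∏ i, (2 ^ κ i * (tl D a i ^ κ i / ((κ i).factorial : ℝ)) ^ 3) := by
        apply Finset.prod_le_prod
        · intro i _; have := dl_nonneg D ha i; positivity
        · intro i _
          rw [← tl_cube D ha i, mul_pow, div_pow, ← mul_div_assoc, ← pow_mul, ← pow_mul, mul_comm 3]
          have := h0 i
          apply div_le_div_of_nonneg_left (by positivity) (by positivity)
          rw [pow_succ]
          gcongr
          omega
    _ = 2 ^ (∑ i, κ i) * (∏ i, (tl D a i ^ κ i / ((κ i).factorial : ℝ))) ^ 3 := by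
        rw [Finset.prod_mul_distrib, Finset.prod_pow_eq_pow_sum, Finset.prod_pow]
    _ ≤ 2 ^ (∑ i, κ i) * (T ^ (∑ i, κ i) / ((∑ i, κ i).factorial : ℝ)) ^ 3 := by
        have p0 : 0 ≤ ∏ i, (tl D a i ^ κ i / ((κ i).factorial : ℝ)) := Finset.prod_nonneg fun i _ => div_nonneg (pow_nonneg (h0 i) _) (by positivity)
        gcongr
        refine (multinomial_le _ h0 κ).trans ?_
        gcongr
    _ = _ := by rw [div_pow, ← pow_mul, mul_comm 3, mul_div_assoc]

/-- a piece of the covering -/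
def piece [Fintype ι] (D : Dirs ι) (K : Set P2) {n : ℕ} (s : ι → Fin n) (κ : ι → ℕ) (π : (Σ i, Fin (κ i)) ≃ {k // k ∉ range s}) :
    Set (Fin n → P2) :=
  {z | (∀ i, z (s i) ∈ K) ∧ SupC D (fun i => z (s i)) ∧
    ∀ i, (fun j => LL D i (z (π ⟨i, j⟩))) ∈ CCu (κ i) (LL D i (z (s i))) (LL D i (z (s (D.nxt i))))}

lemma piece_le [Fintype ι] (D : Dirs ι) {K : Set P2} (hK : MeasurableSet K) (hK1 : volume K ≤ 1) {n : ℕ} (s : ι → Fin n) (κ : ι → ℕ)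
    (π : (Σ i, Fin (κ i)) ≃ {k // k ∉ range s}) {T : ℝ} (hT : ∀ a : ι → P2, (∀ i, a i ∈ K) → SupC D a → ∑ i, tl D a i ≤ T) :
    volume (piece D K s κ π) ≤ ENNReal.ofReal (2 ^ (∑ i, κ i) * T ^ (3 * ∑ i, κ i) / ((∑ i, κ i).factorial : ℝ) ^ 3) := by
  classical
  set M := ENNReal.ofReal (2 ^ (∑ i, κ i) * T ^ (3 * ∑ i, κ i) / ((∑ i, κ i).factorial : ℝ) ^ 3)
  let B' : Set (({k // k ∈ range s} → P2) × ({k // k ∉ range s} → P2)) :=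
    {w | (∀ i, w.1 ⟨s i, i, rfl⟩ ∈ K) ∧ SupC D (fun i => w.1 ⟨s i, i, rfl⟩) ∧
      ∀ i, (fun j => LL D i (w.2 (π ⟨i, j⟩))) ∈ CCu (κ i) (LL D i (w.1 ⟨s i, i, rfl⟩)) (LL D i (w.1 ⟨s (D.nxt i), _, rfl⟩))}
  have hLm : ∀ i, Measurable (LL D i) := fun i => (LL D i).continuous_of_finiteDimensional.measurable
  have hB' : MeasurableSet B' := by
    have e : B' = (⋂ i, {w | w.1 ⟨s i, i, rfl⟩ ∈ K}) ∩ ((⋂ i, ⋂ k, {w | dot2 (D.u i) (w.1 ⟨s k, k, rfl⟩) ≤ dot2 (D.u i) (w.1 ⟨s i, i, rfl⟩)}) ∩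
        ⋂ i, {w | (fun j => LL D i (w.2 (π ⟨i, j⟩))) ∈ CCu (κ i) (LL D i (w.1 ⟨s i, i, rfl⟩)) (LL D i (w.1 ⟨s (D.nxt i), _, rfl⟩))}) := by
      ext w; simp [B', SupC]
    rw [e]
    refine (MeasurableSet.iInter fun i => ?_).inter ((MeasurableSet.iInter fun i => MeasurableSet.iInter fun k => ?_).inter (MeasurableSet.iInter fun i => ?_))
    · exact (by fun_prop : Measurable fun w : (({k // k ∈ range s} → P2) × ({k // k ∉ range s} → P2)) => w.1 ⟨s i, i, rfl⟩) hK
    · unfold dot2; exact measurableSet_le (by fun_prop) (by fun_prop)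
    · apply measurableSet_CCu'
      · exact (hLm i).comp (by fun_prop)
      · exact (hLm i).comp (by fun_prop)
      · exact measurable_pi_lambda _ fun j => (hLm i).comp (by fun_prop)
  have hp : piece D K s κ π = (MeasurableEquiv.piEquivPiSubtypeProd (fun _ : Fin n => P2) (· ∈ range s)) ⁻¹' B' := rfl
  have mpπ : MeasurePreserving (fun (b : {k // k ∉ range s} → P2) => b ∘ π) volume volume := by
    have := volume_measurePreserving_piCongrLeft (fun _ : (Σ i, Fin (κ i)) => P2) π.symm
    convert this using 1
    ext z i <;> simp [MeasurableEquiv.piCongrLeft, Equiv.piCongrLeft, Equiv.piCongrLeft']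
  rw [hp, (volume_preserving_piEquivPiSubtypeProd (fun _ : Fin n => P2) (· ∈ range s)).measure_preimage_equiv, Measure.volume_eq_prod, Measure.prod_apply hB']
  have hslice : ∀ a : {k // k ∈ range s} → P2, volume (Prod.mk a ⁻¹' B') ≤ (univ.pi fun _ => K).indicator (fun _ => M) a := by
    intro a
    by_cases hcond : (∀ i, a ⟨s i, i, rfl⟩ ∈ K) ∧ SupC D (fun i => a ⟨s i, i, rfl⟩)
    · have haK : a ∈ univ.pi fun _ => K := by
        rintro ⟨_, ⟨i, rfl⟩⟩ -
        exact hcond.1 i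
      rw [indicator_of_mem haK]
      have hset : Prod.mk a ⁻¹' B' ⊆ (fun (b : {k // k ∉ range s} → P2) => b ∘ π) ⁻¹' 
          {z | ∀ i, (fun j => z ⟨i, j⟩) ∈ {w : Fin (κ i) → P2 | (fun j => LL D i (w j)) ∈ CCu (κ i) (LL D i (a ⟨s i, i, rfl⟩)) (LL D i (a ⟨s (D.nxt i), _, rfl⟩))}} := by
        rintro b ⟨_, _, h⟩ i
        exact h i
      refine (measure_mono hset).trans ?_
      have hmi : ∀ i, MeasurableSet {w : Fin (κ i) → P2 | (fun j => LL D i (w j)) ∈ CCu (κ i) (LL D i (a ⟨s i, i, rfl⟩)) (LL D i (a ⟨s (D.nxt i), _, rfl⟩))} := by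
        intro i
        apply measurableSet_CCu' measurable_const measurable_const
        exact measurable_pi_lambda _ fun j => (hLm i).comp (by fun_prop)
      have hms : MeasurableSet {z : (Σ i, Fin (κ i)) → P2 | ∀ i, (fun j => z ⟨i, j⟩) ∈ {w : Fin (κ i) → P2 | (fun j => LL D i (w j)) ∈ CCu (κ i) (LL D i (a ⟨s i, i, rfl⟩)) (LL D i (a ⟨s (D.nxt i), _, rfl⟩))}} := by
        rw [show {z : (Σ i, Fin (κ i)) → P2 | ∀ i, (fun j => z ⟨i, j⟩) ∈ {w : Fin (κ i) → P2 | (fun j => LL D i (w j)) ∈ CCu (κ i) (LL D i (a ⟨s i, i, rfl⟩)) (LL D i (a ⟨s (D.nxt i), _, rfl⟩))}} =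
          ⋂ i, (fun z : (Σ i, Fin (κ i)) → P2 => fun j => z ⟨i, j⟩) ⁻¹' {w : Fin (κ i) → P2 | (fun j => LL D i (w j)) ∈ CCu (κ i) (LL D i (a ⟨s i, i, rfl⟩)) (LL D i (a ⟨s (D.nxt i), _, rfl⟩))} by ext z; simp]
        exact MeasurableSet.iInter fun i => (by fun_prop : Measurable (fun z : (Σ i, Fin (κ i)) → P2 => fun j => z ⟨i, j⟩)) (hmi i)
      rw [mpπ.measure_preimage hms.nullMeasurableSet, ← (sigma_curry_mp κ).measure_preimage hms.nullMeasurableSet]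
      have hpi : (fun (z : ∀ i, Fin (κ i) → P2) (q : Σ i, Fin (κ i)) => z q.1 q.2) ⁻¹' {z : (Σ i, Fin (κ i)) → P2 | ∀ i, (fun j => z ⟨i, j⟩) ∈ {w : Fin (κ i) → P2 | (fun j => LL D i (w j)) ∈ CCu (κ i) (LL D i (a ⟨s i, i, rfl⟩)) (LL D i (a ⟨s (D.nxt i), _, rfl⟩))}} =
          univ.pi fun i => {w : Fin (κ i) → P2 | (fun j => LL D i (w j)) ∈ CCu (κ i) (LL D i (a ⟨s i, i, rfl⟩)) (LL D i (a ⟨s (D.nxt i), _, rfl⟩))} := by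
        ext z; simp
      rw [hpi, volume_pi_pi]
      refine (Finset.prod_le_prod' fun i _ => vol_grp_le D (fun i => a ⟨s i, i, rfl⟩) i (κ i)).trans ?_
      rw [← ENNReal.ofReal_prod_of_nonneg]
      · exact ENNReal.ofReal_le_ofReal (prod_dl_le D hcond.2 κ (hT _ hcond.1 hcond.2))
      · intro i _
        have := dl_nonneg D hcond.2 i
        positivity
    · have : Prod.mk a ⁻¹' B' = ∅ := by
        ext b; simp only [mem_preimage, mem_empty_iff_false, iff_false]
        exact fun h => hcond ⟨h.1, h.2.1⟩
      rw [this]; simp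
  refine (lintegral_mono hslice).trans ?_
  rw [lintegral_indicator (MeasurableSet.univ_pi fun _ => hK), setLIntegral_const]
  have hv : volume (univ.pi fun _ : {k // k ∈ range s} => K) ≤ 1 := by
    rw [volume_pi_pi]
    exact Finset.prod_le_one' fun _ _ => hK1
  have hv' := mul_le_mul_right hv M
  rw [mul_one] at hv'
  refine le_trans (le_of_eq ?_) hv'
  congr!

end partP3c

section partP3d

variable {ι : Type}

lemma ae_generic [Fintype ι] (D : Dirs ι) (n : ℕ) :
    ∀ᵐ z : Fin n → P2, ∀ i k l, k ≠ l → dot2 (D.u i) (z k) ≠ dot2 (D.u i) (z l) := by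
  rw [ae_all_iff]; intro i; rw [ae_all_iff]; intro k; rw [ae_all_iff]; intro l
  by_cases hkl : k = l
  · simp [hkl]
  · simp only [ne_eq, hkl, not_false_eq_true, forall_const]
    let φ : (Fin n → P2) →ₗ[ℝ] ℝ :=
      { toFun := fun z => dot2 (D.u i) (z k) - dot2 (D.u i) (z l)
        map_add' := fun a b => by simp [dot2]; ring
        map_smul' := fun c a => by simp [dot2]; ring }
    have hW : volume ((LinearMap.ker φ : Submodule ℝ (Fin n → P2)) : Set (Fin n → P2)) = 0 := by
      apply Measure.addHaar_submodule
      intro h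
      have h2 : Pi.single k (D.u i) ∈ LinearMap.ker φ := by rw [h]; trivial
      rw [LinearMap.mem_ker] at h2
      change dot2 (D.u i) ((Pi.single k (D.u i) : Fin n → P2) k) - dot2 (D.u i) ((Pi.single k (D.u i) : Fin n → P2) l) = 0 at h2
      rw [Pi.single_eq_same, Pi.single_eq_of_ne (Ne.symm hkl), D.nrm] at h2
      simp [dot2] at h2
    rw [ae_iff]
    refine measure_mono_null ?_ hW
    intro z hz
    simp only [not_not, mem_ofPred_eq] at hz
    change φ z = 0
    exact sub_eq_zero.2 hz

lemma fact_bound {Θ : ℝ} (hΘ : 0 < Θ) {n N j m : ℕ} (h : N + j = n) (hj : j ≤ m) :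
    Θ ^ N / (N.factorial : ℝ) ^ 2 ≤ (max 1 Θ⁻¹) ^ m * (n+1 : ℝ) ^ (2 * m) * Θ ^ n / (n.factorial : ℝ) ^ 2 := by
  have h1 : (n.factorial : ℝ) ≤ N.factorial * (n+1 : ℝ) ^ m := by
    have e1 := Nat.factorial_mul_descFactorial (show j ≤ n by omega)
    have e2 := Nat.descFactorial_le_pow n j
    rw [show n - j = N by omega] at e1
    have e3 : ((n.descFactorial j : ℕ) : ℝ) ≤ (n+1 : ℝ) ^ m := by
      calc ((n.descFactorial j : ℕ) : ℝ) ≤ (n:ℝ) ^ j := by exact_mod_cast e2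
        _ ≤ (n+1 : ℝ) ^ j := by gcongr; linarith
        _ ≤ (n+1 : ℝ) ^ m := pow_le_pow_right₀ (by linarith [(Nat.cast_nonneg n : (0:ℝ) ≤ n)]) hj
    rw [← e1]; push_cast
    gcongr
  have h2 : Θ ^ N ≤ (max 1 Θ⁻¹) ^ m * Θ ^ n := by
    rw [← h, pow_add]
    have a1 : (1:ℝ) ≤ max 1 Θ⁻¹ := le_max_left _ _
    have a2 : Θ⁻¹ ≤ max 1 Θ⁻¹ := le_max_right _ _
    have a3 : (Θ⁻¹) ^ j ≤ (max 1 Θ⁻¹) ^ m := (pow_le_pow_left₀ (by positivity) a2 j).trans (pow_le_pow_right₀ a1 hj)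
    calc Θ ^ N = (Θ⁻¹) ^ j * (Θ ^ N * Θ ^ j) := by rw [inv_pow]; field_simp
      _ ≤ _ := by gcongr
  have hN : (0:ℝ) < N.factorial := by positivity
  have hn : (0:ℝ) < n.factorial := by positivity
  have hn1 : (0:ℝ) < (n:ℝ) + 1 := by positivity
  rw [div_le_div_iff₀ (by positivity) (by positivity)]
  calc Θ ^ N * (n.factorial : ℝ) ^ 2 ≤ ((max 1 Θ⁻¹) ^ m * Θ ^ n) * (N.factorial * (n+1 : ℝ) ^ m) ^ 2 := by gcongr
    _ = _ := by rw [mul_pow, ← pow_mul, mul_comm m 2]; ring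

lemma upper_main [Fintype ι] (D : Dirs ι) {K : Set P2} (hK : MeasurableSet K) (hK1 : volume K ≤ 1) {T : ℝ} (hT0 : 0 < T)
    (hT : ∀ a : ι → P2, (∀ i, a i ∈ K) → SupC D a → ∑ i, tl D a i ≤ T) (n : ℕ) (hn : 0 < n) :
    volume {z : Fin n → P2 | (∀ i, z i ∈ K) ∧ CP z} ≤
      ENNReal.ofReal ((max 1 (2 * T ^ 3)⁻¹) ^ Fintype.card ι * (n+1 : ℝ) ^ (4 * Fintype.card ι) * (2 * T ^ 3) ^ n / (n.factorial : ℝ) ^ 2) := by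
  classical
  set m := Fintype.card ι with hm
  set Θ := 2 * T ^ 3 with hΘ
  have hΘ0 : 0 < Θ := by positivity
  set X : ℝ := (max 1 Θ⁻¹) ^ m * (n+1 : ℝ) ^ (2 * m) * Θ ^ n / (n.factorial : ℝ) ^ 2 with hX
  have hX0 : 0 ≤ X := by
    have : (0:ℝ) < max 1 Θ⁻¹ := lt_max_of_lt_left one_pos
    positivity
  have step1 : volume {z : Fin n → P2 | (∀ i, z i ∈ K) ∧ CP z} ≤
      volume (⋃ s : ι → Fin n, ⋃ κ : ι → Fin (n+1), ⋃ π : (Σ i, Fin (κ i : ℕ)) ≃ {k // k ∉ range s}, piece D K s (fun i => (κ i : ℕ)) π) := by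
    apply measure_mono_ae
    filter_upwards [ae_generic D n] with z hgen hz
    obtain ⟨s, κ, π, h1, h2⟩ := cover_ex D hn z hz.2 hgen
    have hκ : ∀ i, κ i < n + 1 := by
      intro i
      have h3 : Fintype.card (Fin (κ i)) ≤ Fintype.card (Fin n) := by
        apply Fintype.card_le_of_injective (fun j : Fin (κ i) => (π ⟨i, j⟩ : Fin n))
        intro a b hab
        have := π.injective (Subtype.ext hab)
        simpa using this
      simp at h3; omega
    refine mem_iUnion.2 ⟨s, mem_iUnion.2 ⟨fun i => ⟨κ i, hκ i⟩, mem_iUnion.2 ⟨π, ?_⟩⟩⟩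
    exact ⟨fun i => hz.1 _, fun i k => h1 i _, h2⟩
  have step2 : ∀ (s : ι → Fin n) (κ : ι → Fin (n+1)),
      volume (⋃ π : (Σ i, Fin (κ i : ℕ)) ≃ {k // k ∉ range s}, piece D K s (fun i => (κ i : ℕ)) π) ≤ ENNReal.ofReal X := by
    intro s κ
    by_cases hne : Nonempty ((Σ i, Fin (κ i : ℕ)) ≃ {k // k ∉ range s})
    · obtain ⟨π0⟩ := hne
      set N := ∑ i, (κ i : ℕ) with hN
      have hcard : Fintype.card {k // k ∉ range s} = N := by
        rw [← Fintype.card_congr π0]; simp [hN]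
      have hj : N + Fintype.card {k // k ∈ range s} = n := by
        rw [← hcard, Fintype.card_subtype_compl, Fintype.card_fin]
        have : Fintype.card {k // k ∈ range s} ≤ Fintype.card (Fin n) := Fintype.card_subtype_le _
        rw [Fintype.card_fin] at this; omega
      have hj2 : Fintype.card {k // k ∈ range s} ≤ m := by
        have := Fintype.card_range_le s
        refine le_trans (le_of_eq ?_) this
        exact Fintype.card_congr (Equiv.refl _)
      refine (measure_iUnion_fintype_le volume _).trans ?_
      refine (Finset.sum_le_sum fun π _ => piece_le D hK hK1 s (fun i => (κ i : ℕ)) π hT).trans ?_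
      rw [Finset.sum_const, Finset.card_univ, Fintype.card_equiv π0, nsmul_eq_mul]
      simp only [Fintype.card_sigma, Fintype.card_fin]
      rw [← hN, ← ENNReal.ofReal_natCast, ← ENNReal.ofReal_mul (by positivity)]
      apply ENNReal.ofReal_le_ofReal
      refine le_trans (le_of_eq ?_) (fact_bound hΘ0 hj hj2)
      rw [hΘ, mul_pow, ← pow_mul]
      have : (0:ℝ) < N.factorial := by positivity
      field_simp
    · rw [not_nonempty_iff] at hne
      simp
  refine step1.trans ?_
  refine (measure_iUnion_fintype_le volume _).trans ?_
  refine (Finset.sum_le_sum fun s _ => (measure_iUnion_fintype_le volume _).trans (Finset.sum_le_sum fun κ _ => step2 s κ)).trans ?_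
  simp only [Finset.sum_const, Finset.card_univ, Fintype.card_fun, Fintype.card_fin, nsmul_eq_mul]
  rw [← ENNReal.ofReal_natCast, ← ENNReal.ofReal_natCast, ← ENNReal.ofReal_mul (by positivity), ← ENNReal.ofReal_mul (by positivity)]
  apply ENNReal.ofReal_le_ofReal
  push_cast
  rw [← hm]
  have h1 : (n:ℝ) ^ m ≤ (n+1:ℝ) ^ m := by gcongr; linarith
  calc (n:ℝ) ^ m * ((n+1:ℝ) ^ m * X) ≤ (n+1:ℝ) ^ m * ((n+1:ℝ) ^ m * X) := by gcongr
    _ = _ := by rw [hX, show 4 * m = m + m + 2 * m by ring, pow_add, pow_add]; ring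

end partP3d

section partP4

open Topology in
lemma log_div_nat : Tendsto (fun n : ℕ => Real.log n / n) atTop (𝓝 0) := by
  have h := Real.isLittleO_log_id_atTop.tendsto_div_nhds_zero
  exact h.comp tendsto_natCast_atTop_atTop

open Topology in
lemma log_succ_div_nat : Tendsto (fun n : ℕ => Real.log (n+1) / n) atTop (𝓝 0) := by
  have h1 : Tendsto (fun n : ℕ => 2 * (Real.log n / n)) atTop (𝓝 0) := by
    simpa using log_div_nat.const_mul 2
  refine tendsto_of_tendsto_of_tendsto_of_le_of_le' tendsto_const_nhds h1 ?_ ?_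
  · exact Eventually.of_forall fun n => div_nonneg (Real.log_nonneg (by linarith [Nat.cast_nonneg (α := ℝ) n])) (Nat.cast_nonneg _)
  · filter_upwards [eventually_ge_atTop 2] with n hn
    have hn' : (2:ℝ) ≤ n := by exact_mod_cast hn
    rw [← mul_div_assoc]
    gcongr
    rw [show 2 * Real.log n = Real.log (n^2) by rw [Real.log_pow]; norm_num]
    exact Real.log_le_log (by linarith) (by nlinarith)

open Topology in
lemma log_fact_asymp : Tendsto (fun n : ℕ => Real.log n - Real.log (n.factorial) / n) atTop (𝓝 1) := by
  have h0 : Tendsto (fun n : ℕ => Real.log (Stirling.stirlingSeq n) / n) atTop (𝓝 0) := by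
    refine Tendsto.div_atTop (a := Real.log (√Real.pi)) ?_ tendsto_natCast_atTop_atTop
    exact (Real.continuousAt_log (by positivity)).tendsto.comp Stirling.tendsto_stirlingSeq_sqrt_pi
  have h1 : Tendsto (fun n : ℕ => Real.log 2 / n) atTop (𝓝 0) :=
    Tendsto.div_atTop tendsto_const_nhds tendsto_natCast_atTop_atTop
  have h2 := ((h0.neg.sub ((h1.add log_div_nat).const_mul (1/2))).add_const 1)
  simp only [neg_zero, add_zero, mul_zero, sub_zero, zero_add] at h2
  refine h2.congr' ?_
  filter_upwards [eventually_ge_atTop 1] with n hn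
  have hn' : (0:ℝ) < n := by exact_mod_cast hn
  rw [Stirling.log_stirlingSeq_formula, Real.log_div hn'.ne' (Real.exp_pos _).ne', Real.log_exp, Real.log_mul (by norm_num) hn'.ne']
  field_simp
  ring

open Topology in
lemma core_asymp {C Θ : ℝ} (hC : 0 < C) (hΘ : 0 < Θ) (M : ℝ) :
    Tendsto (fun n : ℕ => (n:ℝ)^2 * (C * (n+1:ℝ)^M * Θ^n / (n.factorial : ℝ)^2) ^ ((1:ℝ)/n)) atTop (𝓝 (Real.exp 2 * Θ)) := by
  have h1 : Tendsto (fun n : ℕ => Real.log C / n) atTop (𝓝 0) :=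
    Tendsto.div_atTop tendsto_const_nhds tendsto_natCast_atTop_atTop
  have h2 := ((h1.add (log_succ_div_nat.const_mul M)).add_const (Real.log Θ)).add (log_fact_asymp.const_mul 2)
  have h3 := (Real.continuous_exp.tendsto _).comp h2
  have e : Real.exp (0 + M * 0 + Real.log Θ + 2 * 1) = Real.exp 2 * Θ := by
    rw [mul_zero, add_zero, zero_add, mul_one, Real.exp_add, Real.exp_log hΘ, mul_comm]
  rw [e] at h3
  refine h3.congr' ?_
  filter_upwards [eventually_ge_atTop 1] with n hn
  have hn' : (0:ℝ) < n := by exact_mod_cast hn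
  have hf : (0:ℝ) < n.factorial := by positivity
  have hp : (0:ℝ) < C * (n+1:ℝ)^M * Θ^n / (n.factorial : ℝ)^2 := by positivity
  simp only [Function.comp]
  symm
  rw [Real.rpow_def_of_pos hp, Real.log_div (by positivity) (by positivity), Real.log_mul (by positivity) (by positivity),
    Real.log_mul (by positivity) (by positivity), Real.log_pow, Real.log_pow, Real.log_rpow (by positivity)]
  conv_lhs => rw [show (n:ℝ)^2 = Real.exp (2 * Real.log n) by rw [mul_comm, Real.exp_mul, Real.exp_log hn']; norm_cast]
  rw [← Real.exp_add]
  congr 1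
  push_cast
  field_simp
  ring

lemma asymp_upper {q : ℕ → ℝ} (hq : ∀ n, 0 ≤ q n) {C Θ : ℝ} (hC : 0 < C) (hΘ : 0 < Θ) (M : ℕ)
    (h : ∀ n, 0 < n → q n ≤ C * (n+1:ℝ)^M * Θ^n / (n.factorial : ℝ)^2) {c : ℝ} (hc : Real.exp 2 * Θ < c) :
    ∀ᶠ n : ℕ in atTop, (n:ℝ)^2 * (q n) ^ ((1:ℝ)/n) < c := by
  have := (core_asymp hC hΘ M).eventually_lt_const hc
  filter_upwards [this, eventually_gt_atTop 0] with n hn h0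
  refine lt_of_le_of_lt ?_ hn
  have := h n h0
  rw [Real.rpow_natCast]
  have h1 := hq n
  gcongr

lemma asymp_lower {q : ℕ → ℝ} {Θ : ℝ} (hΘ : 0 < Θ) (M : ℕ)
    (h : ∀ n : ℕ, Θ^n / ((n.factorial : ℝ)^2 * (n+1:ℝ)^M) ≤ q n) {c : ℝ} (hc : c < Real.exp 2 * Θ) :
    ∀ᶠ n : ℕ in atTop, c < (n:ℝ)^2 * (q n) ^ ((1:ℝ)/n) := by
  have := (core_asymp one_pos hΘ (-(M:ℝ))).eventually_const_lt hc
  filter_upwards [this, eventually_gt_atTop 0] with n hn h0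
  refine lt_of_lt_of_le hn ?_
  have := h n
  have e : 1 * (n+1:ℝ)^(-(M:ℝ)) * Θ^n / (n.factorial : ℝ)^2 = Θ^n / ((n.factorial : ℝ)^2 * (n+1:ℝ)^M) := by
    rw [Real.rpow_neg (by positivity), Real.rpow_natCast]; field_simp
  rw [e]
  gcongr

end partP4

section partP5

/-- the angle step -/
def thm (m : ℕ) : ℝ := 2 * Real.pi / m

/-- shifted regular directions -/
def uz (m : ℕ) (k : ℤ) : P2 := (Real.cos ((k + 1/2) * thm m), Real.sin ((k + 1/2) * thm m))

lemma uz_add (m : ℕ) [NeZero m] (k c : ℤ) : uz m (k + m * c) = uz m k := by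
  have hm : (m:ℝ) ≠ 0 := by exact_mod_cast NeZero.ne m
  have e : (((k + m * c : ℤ) : ℝ) + 1/2) * thm m = (k + 1/2) * thm m + c * (2 * Real.pi) := by
    unfold thm; push_cast; field_simp; ring
  unfold uz
  rw [e, Real.cos_add_int_mul_two_pi, Real.sin_add_int_mul_two_pi]

lemma uz_emod (m : ℕ) [NeZero m] (k : ℤ) : uz m (k % m) = uz m k := by
  have := uz_add m (k % m) (k / m)
  rw [Int.emod_add_mul_ediv] at this
  exact this.symm

lemma det_uz (m : ℕ) (j k : ℤ) : det2 (uz m j) (uz m k) = Real.sin ((k - j) * thm m) := by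
  rw [show ((k:ℝ) - j) * thm m = (k + 1/2) * thm m - (j + 1/2) * thm m by ring, Real.sin_sub]
  simp [det2, uz]; ring

lemma dot_uz (m : ℕ) (j k : ℤ) : dot2 (uz m j) (uz m k) = Real.cos ((k - j) * thm m) := by
  rw [show ((k:ℝ) - j) * thm m = (k + 1/2) * thm m - (j + 1/2) * thm m by ring, Real.cos_sub]
  simp [dot2, uz]; ring

lemma thm_pos (m : ℕ) [NeZero m] : 0 < thm m := by
  have hm : (0:ℝ) < m := by exact_mod_cast NeZero.pos m
  unfold thm; positivity

lemma thm_mul (m : ℕ) [NeZero m] : m * thm m = 2 * Real.pi := by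
  have hm : (m:ℝ) ≠ 0 := by exact_mod_cast NeZero.ne m
  unfold thm; field_simp

lemma thm_le (m : ℕ) [NeZero m] (h4 : 4 ≤ m) : thm m ≤ Real.pi / 2 := by
  have := thm_mul m
  have h : (4:ℝ) ≤ m := by exact_mod_cast h4
  nlinarith [thm_pos m]

/-- next index -/
def fnx (m : ℕ) [NeZero m] (i : Fin m) : Fin m := ⟨(i.val + 1) % m, Nat.mod_lt _ (NeZero.pos m)⟩

lemma uz_fnx (m : ℕ) [NeZero m] (i : Fin m) : uz m ((fnx m i).val : ℤ) = uz m ((i.val : ℤ) + 1) := by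
  rw [← uz_emod m ((i.val : ℤ) + 1)]
  simp [fnx]

/-- the shifted regular directions as a `Dirs` -/
def DZ (m : ℕ) [NeZero m] (h4 : 4 ≤ m) : Dirs (Fin m) where
  u i := uz m (i.val : ℤ)
  nxt := fnx m
  hdet i := by
    rw [uz_fnx, det_uz]
    have h := thm_pos m
    have h2 := thm_le m h4
    apply Real.sin_pos_of_pos_of_lt_pi <;> push_cast <;> ring_nf <;> linarith [Real.pi_pos]
  cover w := by
    have hθ := thm_pos m
    have h2 := thm_le m h4
    obtain ⟨r, φ, hr, hw⟩ : ∃ r φ : ℝ, 0 ≤ r ∧ w = (r * Real.cos φ, r * Real.sin φ) := by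
      refine ⟨‖(⟨w.1, w.2⟩ : ℂ)‖, Complex.arg ⟨w.1, w.2⟩, norm_nonneg _, ?_⟩
      rw [Complex.norm_mul_cos_arg, Complex.norm_mul_sin_arg]
    set k : ℤ := ⌊(φ - thm m / 2) / thm m⌋ with hk
    have k1 : k * thm m ≤ φ - thm m / 2 := by
      have := Int.floor_le ((φ - thm m / 2) / thm m)
      rwa [le_div_iff₀ hθ] at this
    have k2 : φ - thm m / 2 < (k + 1) * thm m := by
      have := Int.lt_floor_add_one ((φ - thm m / 2) / thm m)
      rwa [div_lt_iff₀ hθ] at this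
    have hm0 : (0:ℤ) < m := by exact_mod_cast NeZero.pos m
    have i1 : 0 ≤ k % m := Int.emod_nonneg _ hm0.ne'
    have i2 : k % m < m := Int.emod_lt_of_pos _ hm0
    have s0 : 0 < Real.sin (thm m) := Real.sin_pos_of_pos_of_lt_pi hθ (by linarith [Real.pi_pos])
    have e1 : (((⟨(k % m).toNat, by omega⟩ : Fin m).val : ℕ) : ℤ) = k % m := by simp [i1]
    refine ⟨⟨(k % m).toNat, by omega⟩, r * Real.sin ((k + 1 + 1/2) * thm m - φ) / Real.sin (thm m),
      r * Real.sin (φ - (k + 1/2) * thm m) / Real.sin (thm m), ?_, ?_, ?_⟩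
    · refine div_nonneg (mul_nonneg hr (Real.sin_nonneg_of_nonneg_of_le_pi ?_ ?_)) s0.le <;> nlinarith [Real.pi_pos]
    · refine div_nonneg (mul_nonneg hr (Real.sin_nonneg_of_nonneg_of_le_pi ?_ ?_)) s0.le <;> nlinarith [Real.pi_pos]
    · rw [uz_fnx, e1, uz_emod]
      have e2 : uz m (k % m + 1) = uz m (k + 1) := by
        rw [← uz_emod m (k % m + 1), ← uz_emod m (k + 1), Int.emod_add_emod]
      rw [e2, hw]
      have c1 : (((k + 1 : ℤ) : ℝ) + 1/2) * thm m = (k + 1/2) * thm m + thm m := by push_cast; ring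
      have c2 : ((k:ℝ) + 1 + 1/2) * thm m - φ = (k + 1/2) * thm m + thm m - φ := by ring
      unfold uz
      rw [c1, c2]
      generalize ((k:ℝ) + 1/2) * thm m = A
      generalize thm m = B at *
      have p1 := Real.sin_sq_add_cos_sq A
      ext
      · simp only [Prod.fst_add, Prod.smul_fst, smul_eq_mul]
        rw [eq_comm, div_mul_eq_mul_div, div_mul_eq_mul_div, ← add_div, div_eq_iff s0.ne', Real.sin_sub, Real.sin_sub, Real.sin_add, Real.cos_add]
        linear_combination (r * Real.cos φ * Real.sin B) * p1
      · simp only [Prod.snd_add, Prod.smul_snd, smul_eq_mul]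
        rw [eq_comm, div_mul_eq_mul_div, div_mul_eq_mul_div, ← add_div, div_eq_iff s0.ne', Real.sin_sub, Real.sin_sub, Real.sin_add, Real.cos_add]
        linear_combination (r * Real.sin φ * Real.sin B) * p1
  sep j k := by
    have hθ := thm_pos m
    have h2 := thm_le m h4
    have h3 := thm_mul m
    rw [uz_fnx, det_uz, det_uz]
    have hj := j.2
    have hk := k.2
    have hj' : ((j.val : ℕ) : ℝ) + 1 ≤ m := by exact_mod_cast hj
    have hk' : ((k.val : ℕ) : ℝ) + 1 ≤ m := by exact_mod_cast hk
    by_cases h : j.val < k.val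
    · have h' : ((j.val : ℕ) : ℝ) + 1 ≤ k.val := by exact_mod_cast h
      by_cases hd : Real.pi ≤ ((k.val:ℝ) - j.val) * thm m
      · left
        push_cast
        rw [← Real.sin_sub_two_pi]
        apply Real.sin_nonpos_of_nonpos_of_neg_pi_le
        · have : ((k.val:ℝ) - j.val) * thm m ≤ m * thm m := by
            gcongr; linarith [Nat.cast_nonneg (α := ℝ) j.val]
          linarith
        · linarith
      · right
        push Not at hd
        push_cast
        apply Real.sin_nonneg_of_nonneg_of_le_pi
        · apply mul_nonneg _ hθ.le; linarith
        · nlinarith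
    · push Not at h
      have h' : ((k.val : ℕ) : ℝ) ≤ j.val := by exact_mod_cast h
      by_cases hd : ((j.val:ℝ) - k.val) * thm m ≤ Real.pi
      · left
        push_cast
        apply Real.sin_nonpos_of_nonpos_of_neg_pi_le
        · nlinarith
        · nlinarith
      · right
        push Not at hd
        push_cast
        rw [← Real.sin_add_two_pi]
        apply Real.sin_nonneg_of_nonneg_of_le_pi
        · have : ((j.val:ℝ) + 1 - k.val) * thm m ≤ m * thm m := by
            gcongr; linarith [Nat.cast_nonneg (α := ℝ) k.val]
          linarith
        · nlinarith
  dotn i := by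
    rw [uz_fnx, dot_uz]
    have h := thm_pos m
    have h2 := thm_le m h4
    apply Real.cos_nonneg_of_neg_pi_div_two_le_of_le <;> push_cast <;> ring_nf <;> linarith [Real.pi_pos]
  nrm i := by
    rw [dot_uz]; simp

end partP5

section partG1

section fam2
variable {ι : Type}

/-- the apex of the triangle -/
def vv (D : Dirs ι) (a : ι → P2) (i : ι) : P2 :=
  (a i).1 - dot2 (D.u (D.nxt i)) (a (D.nxt i) - a i) / det2 (D.u i) (D.u (D.nxt i)) * (D.u i).2 |> fun X =>
  (X, (a i).2 + dot2 (D.u (D.nxt i)) (a (D.nxt i) - a i) / det2 (D.u i) (D.u (D.nxt i)) * (D.u i).1)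

/-- alpha -/
def al (D : Dirs ι) (a : ι → P2) (i : ι) : ℝ := dot2 (D.u i) (a i - a (D.nxt i)) / det2 (D.u i) (D.u (D.nxt i))
/-- beta -/
def be (D : Dirs ι) (a : ι → P2) (i : ι) : ℝ := dot2 (D.u (D.nxt i)) (a (D.nxt i) - a i) / det2 (D.u i) (D.u (D.nxt i))

lemma al_nonneg (D : Dirs ι) {a : ι → P2} (ha : SupC D a) (i : ι) : 0 ≤ al D a i :=
  div_nonneg (by rw [dot2_sub]; linarith [ha i (D.nxt i)]) (D.hdet i).le
lemma be_nonneg (D : Dirs ι) {a : ι → P2} (ha : SupC D a) (i : ι) : 0 ≤ be D a i :=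
  div_nonneg (by rw [dot2_sub]; linarith [ha (D.nxt i) i]) (D.hdet i).le

lemma dl_eq (D : Dirs ι) (a : ι → P2) (i : ι) : dl D a i = al D a i * be D a i * det2 (D.u i) (D.u (D.nxt i)) := by
  have := (D.hdet i).ne'
  unfold dl al be; field_simp

lemma vv_x (D : Dirs ι) (a : ι → P2) (i : ι) (n : P2) :
    dot2 n (vv D a i) = dot2 n (a i) + be D a i * det2 (D.u i) n := by
  simp only [vv, dot2, det2, be]; ring

lemma vv1 (D : Dirs ι) (a : ι → P2) (i : ι) : vv D a i = ((a i).1 - be D a i * (D.u i).2, (a i).2 + be D a i * (D.u i).1) := rfl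

lemma al_mul (D : Dirs ι) (a : ι → P2) (i : ι) : al D a i * det2 (D.u i) (D.u (D.nxt i)) = dot2 (D.u i) (a i - a (D.nxt i)) :=
  div_mul_cancel₀ _ (D.hdet i).ne'
lemma be_mul (D : Dirs ι) (a : ι → P2) (i : ι) : be D a i * det2 (D.u i) (D.u (D.nxt i)) = dot2 (D.u (D.nxt i)) (a (D.nxt i) - a i) :=
  div_mul_cancel₀ _ (D.hdet i).ne'

lemma vv2 (D : Dirs ι) (a : ι → P2) (i : ι) : vv D a i = ((a (D.nxt i)).1 + al D a i * (D.u (D.nxt i)).2, (a (D.nxt i)).2 - al D a i * (D.u (D.nxt i)).1) := by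
  have h := (D.hdet i).ne'
  have h1 := al_mul D a i
  have h2 := be_mul D a i
  rw [vv1]
  ext
  · apply mul_left_cancel₀ h
    simp only [dot2, det2, Prod.fst_sub, Prod.snd_sub] at *; linear_combination -(D.u i).2 * h2 - (D.u (D.nxt i)).2 * h1
  · apply mul_left_cancel₀ h
    simp only [dot2, det2, Prod.fst_sub, Prod.snd_sub] at *; linear_combination (D.u i).1 * h2 + (D.u (D.nxt i)).1 * h1

lemma vv_y (D : Dirs ι) (a : ι → P2) (i : ι) (n : P2) :
    dot2 n (vv D a i) = dot2 n (a (D.nxt i)) - al D a i * det2 (D.u (D.nxt i)) n := by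
  rw [vv2]; simp only [dot2, det2]; ring

lemma vv_le (D : Dirs ι) {a : ι → P2} (ha : SupC D a) (j : ι) (n : P2) (M : ℝ) (h1 : dot2 n (a j) ≤ M) (h2 : dot2 n (a (D.nxt j)) ≤ M)
    (h : det2 (D.u j) n ≤ 0 ∨ 0 ≤ det2 (D.u (D.nxt j)) n) : dot2 n (vv D a j) ≤ M := by
  rcases h with h | h
  · rw [vv_x]; nlinarith [be_nonneg D ha j]
  · rw [vv_y]; nlinarith [al_nonneg D ha j]

lemma unit_par {u v : P2} (hu : dot2 u u = 1) (hv : dot2 v v = 1) (h : det2 u v = 0) : v = u ∨ v = -u := by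
  have h1 : v = (dot2 u v) • u := by
    unfold dot2 det2 at *
    ext
    · simp only [Prod.smul_fst, smul_eq_mul]; linear_combination -v.1 * hu - u.2 * h
    · simp only [Prod.smul_snd, smul_eq_mul]; linear_combination -v.2 * hu + u.1 * h
  have h2 : dot2 u v ^ 2 = 1 := by
    unfold dot2 det2 at *
    linear_combination hu * (v.1*v.1+v.2*v.2) + hv - h * (u.1*v.2-u.2*v.1)
  rcases sq_eq_sq_iff_eq_or_eq_neg.1 (h2.trans (one_pow 2).symm) with h3 | h3
  · left; rw [h1, h3]; simp
  · right; rw [h1, h3]; simp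

lemma bary (x v y w n : P2) : det2 (v-x) (y-v) * dot2 n w = det2 (v-w) (y-v) * dot2 n x + det2 (v-x) (w-x) * dot2 n y
    + (det2 (v-x) (y-v) - (det2 (v-x) (w-x) + det2 (v-w) (y-v))) * dot2 n v := by
  simp only [det2, dot2, Prod.fst_sub, Prod.snd_sub]; ring

lemma lamy (D : Dirs ι) (a : ι → P2) (i : ι) (w : P2) :
    det2 (vv D a i - a i) (w - a i) = be D a i * (dot2 (D.u i) (a i) - dot2 (D.u i) w) := by
  rw [vv1]; simp only [det2, dot2, Prod.fst_sub, Prod.snd_sub]; ring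

lemma lamx (D : Dirs ι) (a : ι → P2) (i : ι) (w : P2) :
    det2 (vv D a i - w) (a (D.nxt i) - vv D a i) = al D a i * (dot2 (D.u (D.nxt i)) (a (D.nxt i)) - dot2 (D.u (D.nxt i)) w) := by
  rw [vv2]; simp only [det2, dot2, Prod.fst_sub, Prod.snd_sub]; ring

lemma lamv (D : Dirs ι) (a : ι → P2) (i : ι) :
    det2 (vv D a i - a i) (a (D.nxt i) - vv D a i) = dl D a i := by
  rw [dl_eq, lamx, ← dot2_sub, ← be_mul]; ring

lemma fam_a (D : Dirs ι) (hinj : Function.Injective D.u) {a : ι → P2} (ha : SupC D a) (i k : ι) (hd : 0 < dl D a i) :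
    a k ∈ coneC (a i) (vv D a i) (a (D.nxt i)) := by
  have al0 := al_nonneg D ha i
  have be0 := be_nonneg D ha i
  have s0 := D.hdet i
  have hd' := hd
  rw [dl_eq] at hd'
  have alp : 0 < al D a i := by
    rcases al0.lt_or_eq with h | h
    · exact h
    · rw [← h] at hd'; simp at hd'
  have bep : 0 < be D a i := by
    rcases be0.lt_or_eq with h | h
    · exact h
    · rw [← h] at hd'; simp at hd'
  have l1 : 0 ≤ det2 (vv D a i - a i) (a k - a i) := by
    rw [lamy]; exact mul_nonneg be0 (by linarith [ha i k])
  have l2 : 0 ≤ det2 (vv D a i - a k) (a (D.nxt i) - vv D a i) := by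
    rw [lamx]; exact mul_nonneg al0 (by linarith [ha (D.nxt i) k])
  refine ⟨l1, l2, ?_⟩
  by_contra hcon
  push Not at hcon
  have hb := bary (a i) (vv D a i) (a (D.nxt i)) (a k) (D.u k)
  have e1 := ha k i
  have e2 := ha k (D.nxt i)
  rw [lamv] at hb hcon
  -- it suffices to have strict inequality at `v`
  have key : ¬ (dot2 (D.u k) (vv D a i) < dot2 (D.u k) (a k)) := by
    intro h
    have := mul_lt_mul_of_pos_left h (sub_pos.2 hcon)
    nlinarith [mul_le_mul_of_nonneg_left e1 l2, mul_le_mul_of_nonneg_left e2 l1]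
  rcases D.sep i k with h | h
  · rcases h.lt_or_eq with h | h
    · apply key; rw [vv_x]; nlinarith [mul_pos_of_neg_of_neg h (neg_lt_zero.2 bep)]
    · rcases unit_par (D.nrm i) (D.nrm k) h with h1 | h1
      · have := hinj h1
        subst this
        rw [lamx, ← dot2_sub, ← be_mul, sub_self, show det2 (vv D a k - a k) 0 = 0 by simp [det2], dl_eq] at hcon
        nlinarith
      · apply key
        rw [vv_x, h, mul_zero, add_zero]
        refine lt_of_lt_of_le ?_ e2
        have e3 : 0 < dot2 (D.u i) (a i - a (D.nxt i)) := by rw [← al_mul]; positivity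
        rw [dot2_sub] at e3
        rw [h1]
        have e4 : ∀ w, dot2 (-D.u i) w = - dot2 (D.u i) w := by intro w; simp [dot2]; ring
        rw [e4, e4]; linarith
  · rcases h.lt_or_eq with h | h
    · apply key; rw [vv_y]; nlinarith [mul_pos alp h]
    · rcases unit_par (D.nrm (D.nxt i)) (D.nrm k) h.symm with h1 | h1
      · have := hinj h1
        rw [this, lamy, ← dot2_sub, ← al_mul, lamx, sub_self, mul_zero, dl_eq] at hcon
        nlinarith
      · apply key
        rw [vv_y, ← h, mul_zero, sub_zero]
        refine lt_of_lt_of_le ?_ e1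
        have e3 : 0 < dot2 (D.u (D.nxt i)) (a (D.nxt i) - a i) := by rw [← be_mul]; positivity
        rw [dot2_sub] at e3
        rw [h1]
        have e4 : ∀ w, dot2 (-D.u (D.nxt i)) w = - dot2 (D.u (D.nxt i)) w := by intro w; simp [dot2]; ring
        rw [e4, e4]; linarith

lemma fam_v (D : Dirs ι) (hinj : Function.Injective D.u) {a : ι → P2} (ha : SupC D a) (i j : ι) (hij : i ≠ j) (hd : 0 < dl D a i) :
    vv D a j ∈ coneC (a i) (vv D a i) (a (D.nxt i)) := by
  have al0 := al_nonneg D ha i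
  have be0 := be_nonneg D ha i
  refine ⟨?_, ?_, ?_⟩
  · rw [lamy]; refine mul_nonneg be0 (sub_nonneg.2 (vv_le D ha j _ _ (ha i _) (ha i _) (D.sep j i)))
  · rw [lamx]; refine mul_nonneg al0 (sub_nonneg.2 (vv_le D ha j _ _ (ha _ _) (ha _ _) (D.sep j _)))
  · set n : P2 := be D a i • D.u i + al D a i • D.u (D.nxt i) with hn
    have en : ∀ w, dot2 n w = be D a i * dot2 (D.u i) w + al D a i * dot2 (D.u (D.nxt i)) w := by
      intro w; simp [hn, dot2]; ring
    have ed : ∀ w, det2 w n = be D a i * det2 w (D.u i) + al D a i * det2 w (D.u (D.nxt i)) := by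
      intro w; simp [hn, det2]; ring
    have h1 := (fam_a D hinj ha i j hd).2.2
    have h2 := (fam_a D hinj ha i (D.nxt j) hd).2.2
    rw [lamv, lamx, lamy] at h1 h2 ⊢
    have := vv_le D ha j n (be D a i * dot2 (D.u i) (a i) + al D a i * dot2 (D.u (D.nxt i)) (a (D.nxt i)) - dl D a i)
      (by rw [en]; linarith) (by rw [en]; linarith) ?_
    · rw [en] at this; linarith
    · rw [ed, ed]
      rcases D.sep j i with p | p
      · rcases D.sep j (D.nxt i) with q | q
        · left; nlinarith
        · by_cases q' : det2 (D.u j) (D.u (D.nxt i)) ≤ 0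
          · left; nlinarith
          push Not at q'
          exfalso
          have c : det2 (D.u i) (D.u j) = 0 := by
            have c1 : det2 (D.u i) (D.u j) = - det2 (D.u j) (D.u i) := by simp only [det2]; ring
            have c2 : det2 (D.u (D.nxt i)) (D.u j) = - det2 (D.u j) (D.u (D.nxt i)) := by simp only [det2]; ring
            rcases D.sep i j with r | r <;> linarith
          rcases unit_par (D.nrm i) (D.nrm j) c with r | r
          · exact hij (hinj r).symm
          · rw [r] at q'
            have := D.hdet i
            have e : det2 (-D.u i) (D.u (D.nxt i)) = - det2 (D.u i) (D.u (D.nxt i)) := by simp [det2]; ring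
            linarith
      · rcases D.sep j (D.nxt i) with q | q
        · by_cases p' : det2 (D.u j) (D.u i) ≤ 0
          · left; nlinarith
          push Not at p'
          rw [← ed, ← ed]
          by_contra hc
          push Not at hc
          have f1 : det2 (D.u j) (D.u (D.nxt j)) * det2 (D.u i) n =
            -(- det2 (D.u (D.nxt j)) n * det2 (D.u j) (D.u i) + det2 (D.u j) n * det2 (D.u (D.nxt j)) (D.u i)) := by
            simp only [det2]; ring
          have f2 : det2 (D.u i) n = al D a i * det2 (D.u i) (D.u (D.nxt i)) := by rw [ed]; simp only [det2]; ring
          have f3 : 0 ≤ det2 (D.u i) n := by rw [f2]; exact mul_nonneg al0 (D.hdet i).le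
          have f4 := mul_nonneg (D.hdet j).le f3
          have f5 := mul_pos (neg_pos.2 hc.2) p'
          have f6 := mul_nonneg hc.1.le p
          linarith
        · right; nlinarith

lemma fam_VFam (D : Dirs ι) (hinj : Function.Injective D.u) {a : ι → P2} (ha : SupC D a) :
    VFam (fun i : {i // 0 < dl D a i} => a i) (fun i => vv D a i) (fun i => a (D.nxt i)) where
  pos i := by rw [lamv]; exact i.2
  sep i j h := ⟨fam_a D hinj ha i j i.2, fam_v D hinj ha i j (fun h' => h (Subtype.ext h')) i.2, fam_a D hinj ha i _ i.2⟩
end fam2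

end partG1

section partG2

lemma DZ_inj (m : ℕ) [NeZero m] (h4 : 4 ≤ m) : Function.Injective (DZ m h4).u := by
  intro i j h
  have h1 : dot2 (uz m (i.val : ℤ)) (uz m (j.val : ℤ)) = 1 := by
    have h' : uz m (i.val : ℤ) = uz m (j.val : ℤ) := h
    rw [h', dot_uz]; simp
  rw [dot_uz] at h1
  have hθ := thm_pos m
  have h3 := thm_mul m
  have hi : ((i.val : ℕ) : ℝ) + 1 ≤ m := by exact_mod_cast i.2
  have hj : ((j.val : ℕ) : ℝ) + 1 ≤ m := by exact_mod_cast j.2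
  have hi0 := Nat.cast_nonneg (α := ℝ) i.val
  have hj0 := Nat.cast_nonneg (α := ℝ) j.val
  push_cast at h1
  have h2 := (Real.cos_eq_one_iff_of_lt_of_lt (by nlinarith) (by nlinarith)).1 h1
  have h5 : (j.val : ℝ) = i.val := by
    rcases mul_eq_zero.1 h2 with h | h <;> linarith
  exact Fin.ext (by exact_mod_cast h5.symm)

/-- homothety -/
def hom (o : P2) (c : ℝ) (x : P2) : P2 := o + c • (x - o)

lemma hom_det (o : P2) (c : ℝ) (p q r s : P2) :
    det2 (hom o c p - hom o c q) (hom o c r - hom o c s) = c^2 * det2 (p - q) (r - s) := by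
  simp [hom, det2]; ring

lemma VFam_hom {ι : Type} {x v y : ι → P2} (h : VFam x v y) (o : P2) {c : ℝ} (hc : 0 < c) :
    VFam (fun i => hom o c (x i)) (fun i => hom o c (v i)) (fun i => hom o c (y i)) := by
  have key : ∀ i w, w ∈ coneC (x i) (v i) (y i) → hom o c w ∈ coneC (hom o c (x i)) (hom o c (v i)) (hom o c (y i)) := by
    intro i w ⟨h1, h2, h3⟩
    refine ⟨?_, ?_, ?_⟩
    · rw [hom_det]; positivity
    · rw [hom_det]; positivity
    · rw [hom_det, hom_det, hom_det, ← mul_add]; gcongr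
  refine ⟨fun i => ?_, fun i j hij => ⟨key i _ (h.sep i j hij).1, key i _ (h.sep i j hij).2.1, key i _ (h.sep i j hij).2.2⟩⟩
  rw [hom_det]; have := h.pos i; positivity

lemma hom_mem {K : Set P2} (hK : Convex ℝ K) {o x : P2} (ho : o ∈ K) (hx : x ∈ K) {c : ℝ} (h0 : 0 ≤ c) (h1 : c ≤ 1) : hom o c x ∈ K := by
  have := hK ho hx (sub_nonneg.2 h1) h0 (by ring)
  convert this using 1
  simp only [hom]; module

section poke
variable {ι : Type}
lemma poke (D : Dirs ι) {K : Set P2} (hK : Convex ℝ K) {o : P2} {ρ R θ ε : ℝ} (hρ : 0 ≤ ρ)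
    (ho : ∀ w : P2, |w.1| ≤ ρ → |w.2| ≤ ρ → o + w ∈ K)
    (hR : ∀ x ∈ K, ∀ y ∈ K, dot2 (x - y) (x - y) ≤ R^2) (hR0 : 0 ≤ R) {a : ι → P2} (ha : SupC D a) (haK : ∀ i, a i ∈ K)
    (hθ : ∀ i, |(D.u i).1 - (D.u (D.nxt i)).1| ≤ θ ∧ |(D.u i).2 - (D.u (D.nxt i)).2| ≤ θ)
    (hε : 0 < ε) (hs : R * θ ≤ ε * ρ) (i : ι) (hd : 0 < dl D a i) : hom o (1+ε)⁻¹ (vv D a i) ∈ K := by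
  set p := be D a i with hp
  set r := al D a i with hr
  have p0 : 0 ≤ p := be_nonneg D ha i
  have r0 : 0 ≤ r := al_nonneg D ha i
  have hd' := hd
  rw [dl_eq] at hd'
  have s0 := D.hdet i
  have pp : 0 < p := by
    rcases p0.lt_or_eq with h | h
    · exact h
    · rw [← hp, ← h] at hd'; simp at hd'
  have rp : 0 < r := by
    rcases r0.lt_or_eq with h | h
    · exact h
    · rw [← hr, ← h] at hd'; simp at hd'
  have v1 := vv1 D a i
  have v2 := vv2 D a i
  rw [← hp] at v1
  rw [← hr] at v2
  have pR : p ≤ R := by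
    have e : dot2 (a (D.nxt i) - a i) (a (D.nxt i) - a i) = p^2 + r^2 + 2 * p * r * dot2 (D.u i) (D.u (D.nxt i)) := by
      have n1 := D.nrm i
      have n2 := D.nrm (D.nxt i)
      have q := v1.symm.trans v2
      have q1 := congrArg Prod.fst q
      have q2 := congrArg Prod.snd q
      simp only at q1 q2
      have w1 : (a (D.nxt i)).1 - (a i).1 = - p * (D.u i).2 - r * (D.u (D.nxt i)).2 := by linarith
      have w2 : (a (D.nxt i)).2 - (a i).2 = p * (D.u i).1 + r * (D.u (D.nxt i)).1 := by linarith
      simp only [dot2, Prod.fst_sub, Prod.snd_sub] at n1 n2 ⊢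
      rw [w1, w2]
      linear_combination p^2 * n1 + r^2 * n2
    have := hR _ (haK (D.nxt i)) _ (haK i)
    rw [e] at this
    have := D.dotn i
    have : 0 ≤ 2 * p * r * dot2 (D.u i) (D.u (D.nxt i)) := by positivity
    nlinarith
  set k : P2 := (r/(p+r)) • a i + (p/(p+r)) • a (D.nxt i) with hk
  have kK : k ∈ K := hK (haK _) (haK _) (by positivity) (by positivity) (by field_simp; ring)
  set c := p * r / (p + r) with hc
  have c0 : 0 ≤ c := by positivity
  have cR : c ≤ R := by
    refine le_trans ?_ pR
    rw [hc, div_le_iff₀ (by positivity)]; nlinarith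
  have f1 : (vv D a i).1 - k.1 = - c * ((D.u i).2 - (D.u (D.nxt i)).2) := by
    have q1 := congrArg Prod.fst v1
    have q2 := congrArg Prod.fst v2
    simp only at q1 q2
    have : (vv D a i).1 = (r/(p+r)) * (vv D a i).1 + (p/(p+r)) * (vv D a i).1 := by field_simp; ring
    rw [this]
    nth_rewrite 1 [q1]
    rw [q2]
    simp only [hk, hc, Prod.fst_add, Prod.smul_fst, smul_eq_mul]
    field_simp; ring
  have f2 : (vv D a i).2 - k.2 = c * ((D.u i).1 - (D.u (D.nxt i)).1) := by
    have q1 := congrArg Prod.snd v1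
    have q2 := congrArg Prod.snd v2
    simp only at q1 q2
    have : (vv D a i).2 = (r/(p+r)) * (vv D a i).2 + (p/(p+r)) * (vv D a i).2 := by field_simp; ring
    rw [this]
    nth_rewrite 1 [q1]
    rw [q2]
    simp only [hk, hc, Prod.snd_add, Prod.smul_snd, smul_eq_mul]
    field_simp; ring
  have bK : o + ε⁻¹ • (vv D a i - k) ∈ K := by
    apply ho
    · rw [Prod.smul_fst, Prod.fst_sub, f1, smul_eq_mul, abs_mul, abs_mul, abs_neg, abs_of_nonneg c0, abs_of_pos (inv_pos.2 hε), inv_mul_le_iff₀ hε]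
      refine le_trans ?_ hs
      exact mul_le_mul cR (hθ i).2 (abs_nonneg _) hR0
    · rw [Prod.smul_snd, Prod.snd_sub, f2, smul_eq_mul, abs_mul, abs_mul, abs_of_nonneg c0, abs_of_pos (inv_pos.2 hε), inv_mul_le_iff₀ hε]
      refine le_trans ?_ hs
      exact mul_le_mul cR (hθ i).1 (abs_nonneg _) hR0
  have := hK kK bK (a := (1+ε)⁻¹) (b := ε * (1+ε)⁻¹) (by positivity) (by positivity) (by field_simp)
  clear_value k
  convert this using 1
  simp only [hom]
  rw [smul_add, smul_smul, show ε * (1+ε)⁻¹ * ε⁻¹ = (1+ε)⁻¹ by field_simp]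
  have e : ε * (1+ε)⁻¹ = 1 - (1+ε)⁻¹ := by field_simp; ring
  rw [e]; module
end poke

lemma DZ_theta (m : ℕ) [NeZero m] (h4 : 4 ≤ m) (i : Fin m) :
    |((DZ m h4).u i).1 - ((DZ m h4).u ((DZ m h4).nxt i)).1| ≤ thm m ∧
    |((DZ m h4).u i).2 - ((DZ m h4).u ((DZ m h4).nxt i)).2| ≤ thm m := by
  change |(uz m (i.val : ℤ)).1 - (uz m ((fnx m i).val : ℤ)).1| ≤ thm m ∧ |(uz m (i.val : ℤ)).2 - (uz m ((fnx m i).val : ℤ)).2| ≤ thm m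
  rw [uz_fnx]
  have h : |((i.val:ℝ) + 1/2) * thm m - ((i.val:ℝ) + 1 + 1/2) * thm m| = thm m := by
    rw [show ((i.val:ℝ) + 1/2) * thm m - ((i.val:ℝ) + 1 + 1/2) * thm m = - thm m by ring, abs_neg, abs_of_pos (thm_pos m)]
  constructor
  · simp only [uz]; push_cast
    have := Real.abs_cos_sub_cos_le (((i.val:ℝ) + 1/2) * thm m) (((i.val:ℝ) + 1 + 1/2) * thm m)
    rwa [h] at this
  · simp only [uz]; push_cast
    have := Real.abs_sin_sub_sin_le (((i.val:ℝ) + 1/2) * thm m) (((i.val:ℝ) + 1 + 1/2) * thm m)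
    rwa [h] at this

/-- there is a valid family of triangles in `K` with total `T` -/
def FamIn (K : Set P2) (T : ℝ) : Prop :=
  ∃ (ι : Type) (_ : Fintype ι) (x v y : ι → P2) (t : ι → ℝ), VFam x v y ∧ (∀ i, x i ∈ K) ∧ (∀ i, v i ∈ K) ∧ (∀ i, y i ∈ K) ∧
    (∀ i, 0 ≤ t i) ∧ (∀ i, 2 * t i ^ 3 = det2 (v i - x i) (y i - v i)) ∧ ∑ i, t i = T

lemma famIn_of_sup {K : Set P2} (hK : Convex ℝ K) {o : P2} {ρ R ε : ℝ} (hρ : 0 ≤ ρ)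
    (ho : ∀ w : P2, |w.1| ≤ ρ → |w.2| ≤ ρ → o + w ∈ K)
    (hR : ∀ x ∈ K, ∀ y ∈ K, dot2 (x - y) (x - y) ≤ R^2) (hR0 : 0 ≤ R) (hε : 0 < ε)
    (m : ℕ) [NeZero m] (h4 : 4 ≤ m) (hs : R * thm m ≤ ε * ρ) {a : Fin m → P2} (ha : SupC (DZ m h4) a) (haK : ∀ i, a i ∈ K) :
    FamIn K ((1+ε)⁻¹ ^ ((2:ℝ)/3) * ∑ i, tl (DZ m h4) a i) := by
  classical
  set c := (1+ε)⁻¹ with hc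
  have c0 : 0 < c := by positivity
  have c1 : c ≤ 1 := inv_le_one_of_one_le₀ (by linarith)
  have oK : o ∈ K := by simpa using ho 0 (by simpa using hρ) (by simpa using hρ)
  have hF := VFam_hom (fam_VFam (DZ m h4) (DZ_inj m h4) ha) o c0
  refine ⟨{i // 0 < dl (DZ m h4) a i}, inferInstance, _, _, _, fun i => c ^ ((2:ℝ)/3) * tl (DZ m h4) a i, hF, fun i => hom_mem hK oK (haK _) c0.le c1,
    fun i => poke (DZ m h4) hK hρ ho hR hR0 ha haK (DZ_theta m h4) hε hs i i.2, fun i => hom_mem hK oK (haK _) c0.le c1,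
    fun i => mul_nonneg (by positivity) (tl_nonneg _ ha _), fun i => ?_, ?_⟩
  · rw [hom_det, lamv, ← tl_cube _ ha, mul_pow, ← Real.rpow_natCast (c ^ ((2:ℝ)/3)), ← Real.rpow_mul c0.le]
    norm_num; ring
  · rw [← Finset.mul_sum]
    congr 1
    rw [← Finset.sum_subtype (Finset.univ.filter fun i => 0 < dl (DZ m h4) a i) (by simp) (fun i => tl (DZ m h4) a i)]
    apply Finset.sum_filter_of_ne
    intro i _ hi
    by_contra h
    have h0 : dl (DZ m h4) a i = 0 := le_antisymm (not_lt.1 h) (dl_nonneg _ ha i)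
    apply hi
    simp [tl, h0]

end partG2

section partF1

/-- `p` is a subgradient selection of `g` on `(a,b)` -/
def SubG (a b : ℝ) (g p : ℝ → ℝ) : Prop := ∀ x ∈ Ioo a b, ∀ y ∈ Ioo a b, g x + p x * (y - x) ≤ g y

/-- right derivative -/
def rdv (g : ℝ → ℝ) (x : ℝ) : ℝ := derivWithin g (Ioi x) x

lemma SubG_of_convex {a b : ℝ} {g : ℝ → ℝ} (h : ConvexOn ℝ (Ioo a b) g) : SubG a b g (rdv g) := by
  intro x hx y hy
  have hx' : x ∈ interior (Ioo a b) := by rwa [isOpen_Ioo.interior_eq]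
  have hy' : y ∈ interior (Ioo a b) := by rwa [isOpen_Ioo.interior_eq]
  rcases lt_trichotomy x y with hxy | hxy | hxy
  · have := h.rightDeriv_le_slope_of_mem_interior hx' hy hxy
    rw [slope_def_field, le_div_iff₀ (by linarith)] at this
    unfold rdv; linarith
  · subst hxy; simp
  · have := h.slope_le_leftDeriv_of_mem_interior hy hx' hxy
    have h2 := h.leftDeriv_le_rightDeriv_of_mem_interior hx'
    have h3 := this.trans h2
    rw [slope_def_field, div_le_iff₀ (by linarith)] at h3
    unfold rdv; linarith

lemma SubG.mono {a b : ℝ} {g p : ℝ → ℝ} (h : SubG a b g p) : MonotoneOn p (Ioo a b) := by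
  intro x hx y hy hxy
  rcases hxy.lt_or_eq with hxy | hxy
  · have h1 := h x hx y hy
    have h2 := h y hy x hx
    by_contra hc
    push Not at hc
    nlinarith [mul_pos (sub_pos.2 hxy) (sub_pos.2 hc)]
  · rw [hxy]

lemma SubG.refl {a b : ℝ} {g p : ℝ → ℝ} (h : SubG a b g p) : SubG (-b) (-a) (fun x => g (-x)) (fun x => - p (-x)) := by
  intro x hx y hy
  have := h (-x) ⟨by linarith [hx.2], by linarith [hx.1]⟩ (-y) ⟨by linarith [hy.2], by linarith [hy.1]⟩
  simp only; linarith

/-- quadratic telescoping -/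
lemma quad_tel {ψ : ℝ → ℝ} {C σ : ℝ} (hσ : 0 ≤ σ) (h : ∀ s t, 0 ≤ s → s ≤ t → t ≤ σ → ψ t - ψ s ≤ C * (t - s)^2) : ψ σ ≤ ψ 0 := by
  have key : ∀ n : ℕ, 0 < n → ψ σ - ψ 0 ≤ C * σ^2 / n := by
    intro n hn
    have hn' : (0:ℝ) < n := by exact_mod_cast hn
    have e : ψ σ - ψ 0 = ∑ i ∈ Finset.range n, (ψ (((i+1 : ℕ) : ℝ) * σ / n) - ψ ((i : ℝ) * σ / n)) := by
      rw [Finset.sum_range_sub (fun i : ℕ => ψ ((i:ℝ) * σ / n))]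
      congr 2
      · field_simp
      · simp
    rw [e]
    have : ∀ i ∈ Finset.range n, (ψ (((i+1 : ℕ) : ℝ) * σ / n) - ψ ((i : ℝ) * σ / n)) ≤ C * σ^2 / n^2 := by
      intro i hi
      have hi' : ((i+1:ℕ):ℝ) ≤ n := by exact_mod_cast Finset.mem_range.1 hi
      have := h ((i : ℝ) * σ / n) (((i+1 : ℕ) : ℝ) * σ / n) (by positivity) (by gcongr; linarith) ?_
      · refine this.trans (le_of_eq ?_)
        push_cast; field_simp; ring
      · rw [div_le_iff₀ hn', mul_comm]; gcongr
    refine (Finset.sum_le_sum this).trans (le_of_eq ?_)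
    simp; field_simp
  have lim : Tendsto (fun n : ℕ => C * σ^2 / n) atTop (nhds 0) := tendsto_const_nhds.div_atTop tendsto_natCast_atTop_atTop
  have := ge_of_tendsto lim (eventually_atTop.2 ⟨1, fun n hn => key n (by omega)⟩)
  linarith

lemma SubG.up {a b : ℝ} {g p : ℝ → ℝ} (h : SubG a b g p) {x σ P Q : ℝ} (hx : x ∈ Ioo a b) (hσ : 0 ≤ σ) (hxs : x + σ ∈ Ioo a b)
    (hp : ∀ t, 0 ≤ t → t ≤ σ → p (x + t) ≤ P + Q * t) : g (x + σ) ≤ g x + P * σ + Q * σ^2 / 2 := by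
  have := quad_tel (ψ := fun t => g (x + t) - P * t - Q * t^2 / 2) (C := Q / 2) hσ ?_
  · simp only [add_zero, mul_zero] at this; linarith
  · intro s t hs hst ht
    have h1 := h (x + t) ⟨by linarith [hx.1], by linarith [hxs.2]⟩ (x + s) ⟨by linarith [hx.1], by linarith [hxs.2]⟩
    have h2 := hp t (by linarith) ht
    nlinarith [mul_le_mul_of_nonneg_right h2 (sub_nonneg.2 hst)]

lemma SubG.dn {a b : ℝ} {g p : ℝ → ℝ} (h : SubG a b g p) {x σ P Q : ℝ} (hx : x ∈ Ioo a b) (hσ : 0 ≤ σ) (hxs : x + σ ∈ Ioo a b)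
    (hp : ∀ t, 0 ≤ t → t ≤ σ → P + Q * t ≤ p (x + t)) : g x + P * σ + Q * σ^2 / 2 ≤ g (x + σ) := by
  have := quad_tel (ψ := fun t => -g (x + t) + P * t + Q * t^2 / 2) (C := Q / 2) hσ ?_
  · simp only [add_zero, mul_zero] at this; linarith
  · intro s t hs hst ht
    have h1 := h (x + s) ⟨by linarith [hx.1], by linarith [hxs.2]⟩ (x + t) ⟨by linarith [hx.1], by linarith [hxs.2]⟩
    have h2 := hp s hs (by linarith)
    nlinarith [mul_le_mul_of_nonneg_right h2 (sub_nonneg.2 hst)]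

lemma SubG.peano {a b : ℝ} {g p : ℝ → ℝ} (h : SubG a b g p) {x q : ℝ} (hx : x ∈ Ioo a b) (hq : HasDerivAt p q x) {ε : ℝ} (hε : 0 < ε) :
    ∃ s0 > 0, x - s0 ∈ Ioo a b ∧ x + s0 ∈ Ioo a b ∧ ∀ σ, |σ| ≤ s0 →
      g x + p x * σ + (q - ε) * σ^2 / 2 ≤ g (x + σ) ∧ g (x + σ) ≤ g x + p x * σ + (q + ε) * σ^2 / 2 := by
  have h1 : ∀ᶠ t in nhds (0:ℝ), |p (x + t) - p x - q * t| ≤ ε * |t| := by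
    have := (hasDerivAt_iff_isLittleO_nhds_zero.1 hq).def hε
    filter_upwards [this] with t ht
    simpa [mul_comm] using ht
  have h2 : ∀ᶠ t in nhds (0:ℝ), x + t ∈ Ioo a b := by
    have : ContinuousAt (fun t : ℝ => x + t) 0 := by fun_prop
    apply this.eventually_mem
    simpa using isOpen_Ioo.mem_nhds hx
  obtain ⟨r, hr, hball⟩ := Metric.eventually_nhds_iff.1 (h1.and h2)
  have hb : ∀ t, |t| ≤ r/2 → |p (x + t) - p x - q * t| ≤ ε * |t| ∧ x + t ∈ Ioo a b := by
    intro t ht; apply hball; rw [Real.dist_eq, sub_zero]; linarith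
  refine ⟨r/2, by positivity, ?_, (hb (r/2) (by rw [abs_of_pos (by positivity)])).2, ?_⟩
  · have := (hb (-(r/2)) (by rw [abs_neg, abs_of_pos (by positivity)])).2
    rwa [← sub_eq_add_neg] at this
  intro σ hσ
  rcases le_total 0 σ with h0 | h0
  · rw [abs_of_nonneg h0] at hσ
    have hm := (hb σ (by rwa [abs_of_nonneg h0])).2
    have hbt : ∀ t, 0 ≤ t → t ≤ σ → |p (x + t) - p x - q * t| ≤ ε * t := by
      intro t ht hts
      have := (hb t (by rw [abs_of_nonneg ht]; linarith)).1
      rwa [abs_of_nonneg ht] at this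
    constructor
    · apply h.dn hx h0 hm
      intro t ht hts
      linarith [(abs_le.1 (hbt t ht hts)).1]
    · apply h.up hx h0 hm
      intro t ht hts
      linarith [(abs_le.1 (hbt t ht hts)).2]
  · rw [abs_of_nonpos h0] at hσ
    have hm := (hb σ (by rwa [abs_of_nonpos h0])).2
    have hbt : ∀ t, 0 ≤ t → t ≤ -σ → |p (x - t) - p x + q * t| ≤ ε * t := by
      intro t ht hts
      have := (hb (-t) (by rw [abs_neg, abs_of_nonneg ht]; linarith)).1
      rw [abs_neg, abs_of_nonneg ht, ← sub_eq_add_neg] at this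
      convert this using 2; ring
    have hx' : -x ∈ Ioo (-b) (-a) := ⟨by linarith [hx.2], by linarith [hx.1]⟩
    have hm' : -x + -σ ∈ Ioo (-b) (-a) := ⟨by linarith [hm.2], by linarith [hm.1]⟩
    constructor
    · have := h.refl.dn (P := - p x) (Q := q - ε) hx' (σ := -σ) (by linarith) hm' ?_
      · simp only [neg_add_rev, neg_neg] at this
        rw [add_comm σ x] at this
        linarith
      · intro t ht hts
        have := (abs_le.1 (hbt t ht hts)).2
        rw [show -(-x + t) = x - t by ring]; linarith
    · have := h.refl.up (P := - p x) (Q := q + ε) hx' (σ := -σ) (by linarith) hm' ?_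
      · simp only [neg_add_rev, neg_neg] at this
        rw [add_comm σ x] at this
        linarith
      · intro t ht hts
        have := (abs_le.1 (hbt t ht hts)).1
        rw [show -(-x + t) = x - t by ring]; linarith

end partF1

section partF2

lemma weak_type {f : ℝ → ℝ} {a c A B l : ℝ} (hf : MonotoneOn f (Ioo a c)) (hA : ∀ x ∈ Ioo a c, A ≤ f x)
    (hB : ∀ x ∈ Ioo a c, f x ≤ B) (hl : 0 < l) :
    volume {x | ∃ s > 0, x - s ∈ Ioo a c ∧ x + s ∈ Ioo a c ∧ l * s < f (x+s) - f (x-s)} ≤ ENNReal.ofReal (10 * (B - A) / l) := by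
  set t : Set (ℝ × ℝ) := {z | 0 < z.2 ∧ z.1 - z.2 ∈ Ioo a c ∧ z.1 + z.2 ∈ Ioo a c ∧ l * z.2 < f (z.1+z.2) - f (z.1-z.2)} with ht
  obtain ⟨u, hut, hdis, hcov⟩ := Vitali.exists_disjoint_subfamily_covering_enlargement_closedBall t
    (fun z => z.1) (fun z => z.2) (c - a) (by rintro z ⟨h1, h2, h3, -⟩; linarith [h2.1, h3.2]) 5 (by norm_num)
  have hcnt : u.Countable := hdis.countable_of_nonempty_interior (by
    intro z hz
    have : 0 < z.2 := (hut hz).1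
    have h2 : (Metric.ball z.1 z.2).Nonempty := Metric.nonempty_ball.2 this
    exact h2.mono Metric.ball_subset_interior_closedBall)
  have := hcnt.to_subtype
  have hI : ∀ z : u, 0 < z.1.2 := fun z => (hut z.2).1
  have h1 : {x | ∃ s > 0, x - s ∈ Ioo a c ∧ x + s ∈ Ioo a c ∧ l * s < f (x+s) - f (x-s)} ⊆ ⋃ z ∈ u, Metric.closedBall z.1 (5 * z.2) := by
    rintro x ⟨s, hs, h1, h2, h3⟩
    obtain ⟨b, hb, hb2⟩ := hcov (x, s) ⟨hs, h1, h2, h3⟩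
    exact mem_biUnion hb (hb2 (Metric.mem_closedBall_self hs.le))
  have h2 : ∀ z : u, volume (Metric.closedBall z.1.1 (5 * z.1.2)) ≤ ENNReal.ofReal (10 / l) * volume (Ioo (f (z.1.1 - z.1.2)) (f (z.1.1 + z.1.2))) := by
    intro z
    obtain ⟨h1, h2, h3, h4⟩ := hut z.2
    rw [Real.volume_closedBall, Real.volume_Ioo, ← ENNReal.ofReal_mul (by positivity)]
    apply ENNReal.ofReal_le_ofReal
    rw [div_mul_eq_mul_div, le_div_iff₀ hl]; linarith
  have hd2 : Pairwise (Function.onFun Disjoint fun z : u => Ioo (f (z.1.1 - z.1.2)) (f (z.1.1 + z.1.2))) := by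
    have key : ∀ z w : u, z.1.1 + z.1.2 < w.1.1 - w.1.2 → Disjoint (Ioo (f (z.1.1 - z.1.2)) (f (z.1.1 + z.1.2))) (Ioo (f (w.1.1 - w.1.2)) (f (w.1.1 + w.1.2))) := by
      intro z w h
      rw [Set.disjoint_left]
      rintro v ⟨_, hv1⟩ ⟨hv2, _⟩
      have := hf (hut z.2).2.2.1 (hut w.2).2.1 h.le
      linarith
    intro z w hzw
    have hd := hdis z.2 w.2 (fun h => hzw (Subtype.ext h))
    have hz := hI z; have hw := hI w
    rcases lt_or_ge (z.1.1 + z.1.2) (w.1.1 - w.1.2) with h | h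
    · exact key z w h
    rcases lt_or_ge (w.1.1 + w.1.2) (z.1.1 - z.1.2) with h' | h'
    · exact (key w z h').symm
    exfalso
    simp only [Function.onFun, Real.closedBall_eq_Icc] at hd
    rw [Set.disjoint_left] at hd
    apply hd (a := max (z.1.1 - z.1.2) (w.1.1 - w.1.2))
    · exact ⟨le_max_left _ _, max_le (by linarith) h⟩
    · exact ⟨le_max_right _ _, max_le h' (by linarith)⟩
  calc _ ≤ _ := measure_mono h1
    _ ≤ ∑' z : u, volume (Metric.closedBall z.1.1 (5 * z.1.2)) := measure_biUnion_le _ hcnt _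
    _ ≤ ∑' z : u, ENNReal.ofReal (10 / l) * volume (Ioo (f (z.1.1 - z.1.2)) (f (z.1.1 + z.1.2))) := ENNReal.tsum_le_tsum h2
    _ = ENNReal.ofReal (10 / l) * ∑' z : u, volume (Ioo (f (z.1.1 - z.1.2)) (f (z.1.1 + z.1.2))) := ENNReal.tsum_mul_left
    _ ≤ ENNReal.ofReal (10 / l) * volume (Icc A B) := by
        gcongr
        refine (tsum_meas_le_meas_iUnion_of_disjoint volume (fun _ => measurableSet_Ioo) hd2).trans (measure_mono ?_)
        refine iUnion_subset fun z => ?_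
        rintro v ⟨h1, h2⟩
        exact ⟨(hA _ (hut z.2).2.1).trans h1.le, h2.le.trans (hB _ (hut z.2).2.2.1)⟩
    _ = _ := by
        rw [Real.volume_Icc, ← ENNReal.ofReal_mul (by positivity)]; congr 1; ring

/-- weak type to strong type -/
lemma max_fun {f : ℝ → ℝ} {a c A B : ℝ} (hac : a < c) (hf : MonotoneOn f (Ioo a c)) (hA : ∀ x ∈ Ioo a c, A ≤ f x)
    (hB : ∀ x ∈ Ioo a c, f x ≤ B) : ∃ F : ℝ → ENNReal, Measurable F ∧ ∫⁻ x in Ioo a c, F x ≠ ⊤ ∧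
      ∀ x s, 0 < s → x - s ∈ Ioo a c → x + s ∈ Ioo a c → ENNReal.ofReal (((f (x+s) - f (x-s))/s)^((2:ℝ)/3)) ≤ F x := by
  set T : ℕ → Set ℝ := fun k => {x | ∃ s > 0, x - s ∈ Ioo a c ∧ x + s ∈ Ioo a c ∧ (8:ℝ)^k * s < f (x+s) - f (x-s)} with hT
  refine ⟨fun x => 1 + ∑' k : ℕ, (toMeasurable volume (T k)).indicator (fun _ => (4:ENNReal)^(k+1)) x, ?_, ?_, ?_⟩
  · refine measurable_const.add (Measurable.ennreal_tsum fun k => ?_)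
    exact measurable_const.indicator (measurableSet_toMeasurable _ _)
  · rw [lintegral_add_left measurable_const]
    apply ENNReal.add_ne_top.2 ⟨by simp, ?_⟩
    rw [lintegral_tsum (fun k => (measurable_const.indicator (measurableSet_toMeasurable _ _)).aemeasurable)]
    have hb : ∀ k, ∫⁻ x in Ioo a c, (toMeasurable volume (T k)).indicator (fun _ => (4:ENNReal)^(k+1)) x ≤ ENNReal.ofReal (40 * (B - A) * (1/2)^k) := by
      intro k
      refine (setLIntegral_le_lintegral _ _).trans ?_
      rw [lintegral_indicator (measurableSet_toMeasurable _ _), setLIntegral_const, measure_toMeasurable]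
      refine (mul_le_mul_right (weak_type hf hA hB (by positivity)) _).trans ?_
      rw [show (4:ENNReal)^(k+1) = ENNReal.ofReal (4^(k+1)) by rw [ENNReal.ofReal_pow (by norm_num)]; simp, ← ENNReal.ofReal_mul (by positivity)]
      apply ENNReal.ofReal_le_ofReal
      apply le_of_eq
      rw [show (8:ℝ)^k = 4^k * 2^k by rw [← mul_pow]; norm_num, pow_succ, one_div, inv_pow]
      field_simp; ring
    refine ne_top_of_le_ne_top ?_ (ENNReal.tsum_le_tsum hb)
    have hBA : 0 ≤ B - A := by
      have := hA ((a+c)/2) ⟨by linarith, by linarith⟩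
      have := hB ((a+c)/2) ⟨by linarith, by linarith⟩
      linarith
    rw [← ENNReal.ofReal_tsum_of_nonneg (fun n => by positivity)]
    · exact ENNReal.ofReal_ne_top
    · exact (summable_geometric_of_lt_one (by norm_num) (by norm_num)).mul_left _
  · intro x s hs h1 h2
    set r := (f (x+s) - f (x-s))/s with hr
    have hr0 : 0 ≤ r := div_nonneg (by linarith [hf h1 h2 (by linarith)]) hs.le
    by_cases hle : r ≤ 1
    · refine le_trans ?_ (le_add_right le_rfl)
      rw [← ENNReal.ofReal_one]
      exact ENNReal.ofReal_le_ofReal (Real.rpow_le_one hr0 hle (by norm_num))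
    · push Not at hle
      obtain ⟨k, hk1, hk2⟩ := exists_nat_pow_near hle.le (by norm_num : (1:ℝ) < 8)
      by_cases hk0 : r = 8^k
      · have hk0' : k ≠ 0 := by rintro rfl; simp at hk0; linarith
        obtain ⟨j, rfl⟩ := Nat.exists_eq_succ_of_ne_zero hk0'
        have hxT : x ∈ T j := by
          refine ⟨s, hs, h1, h2, ?_⟩
          rw [← lt_div_iff₀ hs, ← hr, hk0]
          exact pow_lt_pow_right₀ (by norm_num) (by omega)
        refine le_trans ?_ (le_add_left (ENNReal.le_tsum j))
        rw [indicator_of_mem (subset_toMeasurable _ _ hxT), hk0, ← Real.rpow_natCast, ← Real.rpow_mul (by norm_num),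
          mul_comm, Real.rpow_mul (by norm_num), show (8:ℝ)^((2:ℝ)/3) = 4 by
            rw [show (8:ℝ) = 2^(3:ℝ) by norm_num, ← Real.rpow_mul (by norm_num)]; norm_num, Real.rpow_natCast, ENNReal.ofReal_pow (by norm_num)]
        simp
      · have hxT : x ∈ T k := by
          refine ⟨s, hs, h1, h2, ?_⟩
          rw [← lt_div_iff₀ hs, ← hr]
          exact lt_of_le_of_ne hk1 (Ne.symm hk0)
        refine le_trans ?_ (le_add_left (ENNReal.le_tsum k))
        rw [indicator_of_mem (subset_toMeasurable _ _ hxT)]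
        calc ENNReal.ofReal (r^((2:ℝ)/3)) ≤ ENNReal.ofReal (((8:ℝ)^(k+1))^((2:ℝ)/3)) := by
              apply ENNReal.ofReal_le_ofReal; gcongr
          _ = _ := by
            rw [← Real.rpow_natCast, ← Real.rpow_mul (by norm_num),
              mul_comm, Real.rpow_mul (by norm_num), show (8:ℝ)^((2:ℝ)/3) = 4 by
                rw [show (8:ℝ) = 2^(3:ℝ) by norm_num, ← Real.rpow_mul (by norm_num)]; norm_num, Real.rpow_natCast, ENNReal.ofReal_pow (by norm_num)]
            simp

lemma lint_rpow_left {a c : ℝ} (hac : a < c) : ∫⁻ x in Ioo a c, ENNReal.ofReal ((x - a)^(-(2:ℝ)/3)) ≠ ⊤ := by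
  have h : IntervalIntegrable (fun x : ℝ => (x - a)^(-(2:ℝ)/3)) volume a c := by
    have := (intervalIntegral.intervalIntegrable_rpow' (a := 0) (b := c - a) (r := -(2:ℝ)/3) (by norm_num)).comp_sub_right a
    simpa using this
  rw [intervalIntegrable_iff_integrableOn_Ioo_of_le hac.le] at h
  exact h.lintegral_lt_top.ne

/-- second difference -/
def sd (g : ℝ → ℝ) (x s : ℝ) : ℝ := g (x+s) + g (x-s) - 2 * g x

lemma dom_left {a b M : ℝ} {g p : ℝ → ℝ} (hab : a < b) (h : SubG a b g p) (hM : ∀ x ∈ Ioo a b, |g x| ≤ M) :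
    ∃ F : ℝ → ENNReal, Measurable F ∧ ∫⁻ x in Ioo a ((a+b)/2), F x ≠ ⊤ ∧
      ∀ x ∈ Ioo a ((a+b)/2), ENNReal.ofReal ((x-a)^(-(2:ℝ)/3)) ≤ F x ∧
        ∀ s, 0 < s → s ≤ (x-a)/4 → ENNReal.ofReal ((sd g x s / s^2)^((1:ℝ)/3)) ≤ F x := by
  set c := a + 3/4 * (b-a) with hc
  have hcI : c ∈ Ioo a b := ⟨by linarith, by linarith⟩
  set f : ℝ → ℝ := fun ξ => (ξ - a) * p ξ - g ξ with hf
  have key : ∀ x ∈ Ioo a b, ∀ y ∈ Ioo a b, x ≤ y → (x - a) * (p y - p x) ≤ f y - f x := by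
    intro x hx y hy hxy
    have := h y hy x hx
    simp only [hf]; linarith
  have hmono : MonotoneOn f (Ioo a b) := by
    intro x hx y hy hxy
    have h1 := key x hx y hy hxy
    have h2 := h.mono hx hy hxy
    nlinarith [mul_nonneg (sub_nonneg.2 hx.1.le) (sub_nonneg.2 h2)]
  have hlow : ∀ x ∈ Ioo a b, -M ≤ f x := by
    intro x hx
    have h1 : Tendsto (fun y => g x + p x * (y - x)) (nhdsWithin a (Ioi a)) (nhds (g x + p x * (a - x))) := by
      have : Continuous (fun y => g x + p x * (y - x)) := by fun_prop
      exact (this.tendsto a).mono_left nhdsWithin_le_nhds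
    have h2 := le_of_tendsto h1 (b := M) (by
      filter_upwards [Ioo_mem_nhdsGT hab] with y hy
      exact (h x hx y hy).trans (abs_le.1 (hM y hy)).2)
    simp only [hf]; linarith
  have hsub : Ioo a c ⊆ Ioo a b := Ioo_subset_Ioo_right hcI.2.le
  obtain ⟨F, hF1, hF2, hF3⟩ := max_fun hcI.1 (hmono.mono hsub) (fun x hx => hlow x (hsub hx))
    (fun x hx => hmono (hsub hx) hcI hx.2.le)
  refine ⟨fun x => F x + 2 * ENNReal.ofReal ((x-a)^(-(2:ℝ)/3)), by fun_prop, ?_, ?_⟩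
  · have hs2 : Ioo a ((a+b)/2) ⊆ Ioo a c := Ioo_subset_Ioo_right (by linarith)
    rw [lintegral_add_left hF1, lintegral_const_mul _ (by fun_prop)]
    refine ENNReal.add_ne_top.2 ⟨ne_top_of_le_ne_top hF2 (lintegral_mono_set hs2), ENNReal.mul_ne_top (by simp) (lint_rpow_left (by linarith))⟩
  · intro x hx
    constructor
    · refine le_add_left ?_
      rw [two_mul]; exact le_self_add
    intro s hs hsx
    have hxb : x < (a+b)/2 := hx.2
    have hxa : 0 < x - a := sub_pos.2 hx.1
    have h1 : x - s ∈ Ioo a c := ⟨by linarith, by linarith⟩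
    have h2 : x + s ∈ Ioo a c := ⟨by linarith, by linarith⟩
    have h0 : x ∈ Ioo a b := ⟨hx.1, by linarith⟩
    have hFx := hF3 x s hs h1 h2
    set r := (f (x+s) - f (x-s))/s with hr
    have hr0 : 0 ≤ r := div_nonneg (by linarith [hmono (hsub h1) (hsub h2) (by linarith)]) hs.le
    have hD : sd g x s / s^2 ≤ (2 / (x - a)) * r := by
      have e1 := h _ (hsub h2) x h0
      have e2 := h _ (hsub h1) x h0
      have e3 := key _ (hsub h1) _ (hsub h2) (by linarith)
      have e4 := h.mono (hsub h1) (hsub h2) (by linarith)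
      have e5 : (x - a) * (p (x+s) - p (x-s)) ≤ 2 * (f (x+s) - f (x-s)) := by
        nlinarith [mul_nonneg (sub_nonneg.2 e4) (show 0 ≤ 2 * (x - s - a) - (x - a) by linarith)]
      have e6 : sd g x s ≤ s * (p (x+s) - p (x-s)) := by unfold sd; linarith
      rw [hr, div_mul_div_comm, div_le_div_iff₀ (by positivity) (by positivity)]
      calc sd g x s * ((x-a)*s) ≤ (s * (p (x+s) - p (x-s))) * ((x-a)*s) := by gcongr
        _ = s^2 * ((x-a) * (p (x+s) - p (x-s))) := by ring
        _ ≤ s^2 * (2 * (f (x+s) - f (x-s))) := by gcongr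
        _ = _ := by ring
    have hsd : 0 ≤ sd g x s := by
      have e1 := h x h0 _ (hsub h1)
      have e2 := h x h0 _ (hsub h2)
      unfold sd; linarith
    have hfin : (sd g x s / s^2)^((1:ℝ)/3) ≤ r^((2:ℝ)/3) + 2 * (x-a)^(-(2:ℝ)/3) := by
      calc (sd g x s / s^2)^((1:ℝ)/3) ≤ ((2 / (x - a)) * r)^((1:ℝ)/3) := by gcongr
        _ = (2/(x-a))^((1:ℝ)/3) * r^((1:ℝ)/3) := Real.mul_rpow (by positivity) hr0
        _ ≤ ((2/(x-a))^((1:ℝ)/3))^2 + (r^((1:ℝ)/3))^2 := by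
            nlinarith [sq_nonneg ((2/(x-a))^((1:ℝ)/3) - r^((1:ℝ)/3)), sq_nonneg ((2/(x-a))^((1:ℝ)/3) + r^((1:ℝ)/3)), sq_nonneg ((2/(x-a))^((1:ℝ)/3)), sq_nonneg (r^((1:ℝ)/3))]
        _ = (2/(x-a))^((2:ℝ)/3) + r^((2:ℝ)/3) := by
            rw [← Real.rpow_natCast, ← Real.rpow_mul (by positivity), ← Real.rpow_natCast, ← Real.rpow_mul hr0]; norm_num
        _ ≤ _ := by
            rw [add_comm, Real.div_rpow (by norm_num) hxa.le, neg_div, Real.rpow_neg hxa.le, div_eq_mul_inv ((2:ℝ)^((2:ℝ)/3))]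
            gcongr
            calc (2:ℝ)^((2:ℝ)/3) ≤ 2^(1:ℝ) := Real.rpow_le_rpow_of_exponent_le (by norm_num) (by norm_num)
              _ = 2 := by simp
    refine (ENNReal.ofReal_le_ofReal hfin).trans ?_
    rw [ENNReal.ofReal_add (by positivity) (by positivity), ENNReal.ofReal_mul (by norm_num)]
    simpa using add_le_add hFx le_rfl

/-- domination on the whole interval -/
lemma dom_all {a b M : ℝ} {g p : ℝ → ℝ} (hab : a < b) (h : SubG a b g p) (hM : ∀ x ∈ Ioo a b, |g x| ≤ M) :
    ∃ F : ℝ → ENNReal, Measurable F ∧ ∫⁻ x in Ioo a b, F x ≠ ⊤ ∧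
      ∀ᵐ x ∂(volume.restrict (Ioo a b)), ENNReal.ofReal ((min (x-a) (b-x))^(-(2:ℝ)/3)) ≤ F x ∧
        ∀ s, 0 < s → s ≤ min (x-a) (b-x)/4 → ENNReal.ofReal ((sd g x s / s^2)^((1:ℝ)/3)) ≤ F x := by
  obtain ⟨F, hF1, hF2, hF3⟩ := dom_left hab h hM
  obtain ⟨G, hG1, hG2, hG3⟩ := dom_left (neg_lt_neg hab) h.refl (M := M) (by
    intro x hx; exact hM _ ⟨by linarith [hx.2], by linarith [hx.1]⟩)
  have hmid : (-b + -a)/2 = -((a+b)/2) := by ring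
  rw [hmid] at hG2 hG3
  refine ⟨fun x => (Ioo a ((a+b)/2)).indicator F x + (Ioo ((a+b)/2) b).indicator (fun x => G (-x)) x, ?_, ?_, ?_⟩
  · exact (hF1.indicator measurableSet_Ioo).add ((hG1.comp measurable_neg).indicator measurableSet_Ioo)
  · rw [lintegral_add_left (hF1.indicator measurableSet_Ioo)]
    refine ENNReal.add_ne_top.2 ⟨?_, ?_⟩
    · refine ne_top_of_le_ne_top hF2 ?_
      refine (setLIntegral_le_lintegral _ _).trans ?_
      rw [lintegral_indicator measurableSet_Ioo]
    · refine ne_top_of_le_ne_top hG2 ?_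
      refine (setLIntegral_le_lintegral _ _).trans ?_
      rw [← lintegral_indicator measurableSet_Ioo, ← lintegral_neg_eq_self]
      apply lintegral_mono
      intro x
      simp only [indicator, mem_Ioo]
      by_cases hx : (a+b)/2 < -x ∧ -x < b
      · rw [if_pos hx, if_pos ⟨by linarith [hx.2], by linarith [hx.1]⟩, neg_neg]
      · rw [if_neg hx]; exact zero_le
  · have hne : ∀ᵐ x ∂(volume.restrict (Ioo a b)), x ≠ (a+b)/2 := by
      apply ae_restrict_of_ae
      exact Measure.ae_ne volume _
    filter_upwards [hne, ae_restrict_mem measurableSet_Ioo] with x hx hxI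
    rcases lt_or_gt_of_ne hx with hx | hx
    · have hm : min (x-a) (b-x) = x - a := min_eq_left (by linarith)
      rw [hm, indicator_of_mem (show x ∈ Ioo a ((a+b)/2) from ⟨hxI.1, hx⟩)]
      have := hF3 x ⟨hxI.1, hx⟩
      exact ⟨this.1.trans le_self_add, fun s hs hs2 => (this.2 s hs hs2).trans le_self_add⟩
    · have hm : min (x-a) (b-x) = -x - -b := by rw [min_eq_right (by linarith)]; ring
      rw [hm, indicator_of_mem (show x ∈ Ioo ((a+b)/2) b from ⟨hx, hxI.2⟩)]
      have := hG3 (-x) ⟨by linarith [hxI.2], by linarith⟩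
      refine ⟨this.1.trans le_add_self, fun s hs hs2 => ?_⟩
      have h2 := this.2 s hs hs2
      refine le_trans (le_of_eq ?_) (h2.trans le_add_self)
      unfold sd
      congr 3
      simp only [neg_add_rev, neg_neg, neg_sub]
      rw [show -s + x = x - s by ring, show s - -x = x + s by ring]; ring

end partF2

section partF3

/-- the part of `S` cut off by halfplanes of small area -/
def wet (S : Set P2) (δ : ℝ) : Set P2 :=
  {z | z ∈ S ∧ ∃ (n : P2) (c : ℝ), volume {y | y ∈ S ∧ c < dot2 n y} ≤ ENNReal.ofReal δ ∧ c < dot2 n z}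

structure Body (S : Set P2) (a b : ℝ) (g h : ℝ → ℝ) : Prop where
  hab : a < b
  cg : ConvexOn ℝ (Ioo a b) g
  ch : ConcaveOn ℝ (Ioo a b) h
  lt : ∀ x ∈ Ioo a b, g x < h x
  mem : ∀ x ∈ Ioo a b, ∀ y, (x, y) ∈ S ↔ g x ≤ y ∧ y ≤ h x
  out : ∀ z ∈ S, z.1 ∈ Icc a b
  bdd : ∃ M, ∀ x ∈ Ioo a b, |g x| ≤ M ∧ |h x| ≤ M

lemma exists_body {S : Set P2} (hc : IsCompact S) (hconv : Convex ℝ S) (hnonem : (interior S).Nonempty) :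
    ∃ a b g h, Body S a b g h := by
  obtain ⟨z0, hz0⟩ := hnonem
  obtain ⟨r, hr, hball⟩ := Metric.isOpen_iff.1 isOpen_interior z0 hz0
  have hbox : ∀ u v : ℝ, |u| < r → |v| < r → (z0.1 + u, z0.2 + v) ∈ S := by
    intro u v hu hv
    apply interior_subset (hball _)
    rw [Metric.mem_ball, Prod.dist_eq, Real.dist_eq, Real.dist_eq]
    simp [hu, hv]
  have hz0S : z0 ∈ S := interior_subset hz0
  have hne : S.Nonempty := ⟨z0, hz0S⟩
  have hc1 : IsCompact (Prod.fst '' S) := hc.image continuous_fst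
  obtain ⟨za, hza, hamin⟩ := hc.exists_isMinOn hne continuous_fst.continuousOn
  obtain ⟨zb, hzb, hbmax⟩ := hc.exists_isMaxOn hne continuous_fst.continuousOn
  obtain ⟨M, hM⟩ := hc.isBounded.exists_norm_le
  have hM2 : ∀ z ∈ S, |z.2| ≤ M := fun z hz => by
    have := hM z hz
    rw [Prod.norm_def] at this
    exact (le_max_right _ _).trans this
  have ha : za.1 < z0.1 := by
    have := hamin (hbox (-(r/2)) 0 (by rw [abs_neg, abs_of_pos (by positivity)]; linarith) (by simpa using hr))
    simp only [mem_ofPred_eq] at this; linarith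
  have hb : z0.1 < zb.1 := by
    have := hbmax (hbox (r/2) 0 (by rw [abs_of_pos (by positivity)]; linarith) (by simpa using hr))
    simp only [mem_ofPred_eq] at this; linarith
  set Y : ℝ → Set ℝ := fun x => {y | (x, y) ∈ S} with hY
  have hYc : ∀ x, IsCompact (Y x) := by
    intro x
    refine Metric.isCompact_of_isClosed_isBounded (hc.isClosed.preimage (by fun_prop : Continuous fun y : ℝ => (x, y))) ?_
    refine (Metric.isBounded_Icc (-M) M).subset ?_
    intro y hy
    exact abs_le.1 (hM2 _ hy)
  -- two different points in each column
  have htwo : ∀ x ∈ Ioo za.1 zb.1, ∃ y1 ∈ Y x, ∃ y2 ∈ Y x, y1 < y2 := by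
    have aux : ∀ z ∈ S, ∀ t : ℝ, 0 ≤ t → t < 1 → ∃ y1 ∈ Y ((1-t) * z0.1 + t * z.1), ∃ y2 ∈ Y ((1-t) * z0.1 + t * z.1), y1 < y2 := by
      intro z hz t ht0 ht1
      have key : ∀ v : ℝ, |v| < r → (1-t) * (z0.2 + v) + t * z.2 ∈ Y ((1-t) * z0.1 + t * z.1) := by
        intro v hv
        have := hconv (hbox 0 v (by simpa using hr) hv) hz (show 0 ≤ 1 - t by linarith) ht0 (by ring)
        simp only [hY, mem_ofPred_eq]
        convert this using 1
        ext <;> simp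
      refine ⟨_, key 0 (by simpa using hr), _, key (r/2) (by rw [abs_of_pos (by positivity)]; linarith), ?_⟩
      have : 0 < (1-t) * (r/2) := mul_pos (by linarith) (by linarith)
      linarith
    intro x hx
    rcases le_total x z0.1 with h | h
    · have := aux za hza ((z0.1 - x)/(z0.1 - za.1)) (div_nonneg (by linarith) (by linarith)) (by
        rw [div_lt_one (by linarith)]; linarith [hx.1])
      rwa [show (1 - (z0.1 - x)/(z0.1 - za.1)) * z0.1 + (z0.1 - x)/(z0.1 - za.1) * za.1 = x by
        have : z0.1 - za.1 ≠ 0 := by linarith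
        field_simp; ring] at this
    · have := aux zb hzb ((x - z0.1)/(zb.1 - z0.1)) (div_nonneg (by linarith) (by linarith)) (by
        rw [div_lt_one (by linarith)]; linarith [hx.2])
      rwa [show (1 - (x - z0.1)/(zb.1 - z0.1)) * z0.1 + (x - z0.1)/(zb.1 - z0.1) * zb.1 = x by
        have : zb.1 - z0.1 ≠ 0 := by linarith
        field_simp; ring] at this
  have hYne : ∀ x ∈ Ioo za.1 zb.1, (Y x).Nonempty := fun x hx => by
    obtain ⟨y, hy, _⟩ := htwo x hx; exact ⟨y, hy⟩
  have hginf : ∀ x ∈ Ioo za.1 zb.1, (x, sInf (Y x)) ∈ S := fun x hx => (hYc x).sInf_mem (hYne x hx)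
  have hhsup : ∀ x ∈ Ioo za.1 zb.1, (x, sSup (Y x)) ∈ S := fun x hx => (hYc x).sSup_mem (hYne x hx)
  have hle : ∀ x y, (x, y) ∈ S → sInf (Y x) ≤ y := fun x y hy => csInf_le (hYc x).bddBelow hy
  have hge : ∀ x y, (x, y) ∈ S → y ≤ sSup (Y x) := fun x y hy => le_csSup (hYc x).bddAbove hy
  refine ⟨za.1, zb.1, fun x => sInf (Y x), fun x => sSup (Y x), by linarith, ?_, ?_, ?_, ?_, ?_, M, ?_⟩
  · refine ⟨convex_Ioo _ _, ?_⟩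
    intro x hx y hy s t hs ht hst
    have := hconv (hginf x hx) (hginf y hy) hs ht hst
    exact hle _ _ this
  · refine ⟨convex_Ioo _ _, ?_⟩
    intro x hx y hy s t hs ht hst
    have := hconv (hhsup x hx) (hhsup y hy) hs ht hst
    exact hge _ _ this
  · intro x hx
    obtain ⟨y1, h1, y2, h2, h12⟩ := htwo x hx
    have := hle _ _ h1; have := hge _ _ h2
    linarith
  · intro x hx y
    refine ⟨fun h => ⟨hle _ _ h, hge _ _ h⟩, fun h => ?_⟩
    have hseg := hconv.segment_subset (hginf x hx) (hhsup x hx)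
    apply hseg
    rw [← Prod.image_mk_segment_right, segment_eq_Icc (h.1.trans h.2)]
    exact ⟨y, h, rfl⟩
  · intro z hz
    exact ⟨hamin hz, hbmax hz⟩
  · intro x hx
    exact ⟨hM2 _ (hginf x hx), hM2 _ (hhsup x hx)⟩

lemma Body.neg {S : Set P2} {a b : ℝ} {g h : ℝ → ℝ} (B : Body S a b g h) :
    Body (-S) (-b) (-a) (fun x => - h (-x)) (fun x => - g (-x)) := by
  have hI : ∀ x, x ∈ Ioo (-b) (-a) → -x ∈ Ioo a b := fun x hx => ⟨by linarith [hx.2], by linarith [hx.1]⟩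
  obtain ⟨M, hM⟩ := B.bdd
  refine ⟨by linarith [B.hab], ⟨convex_Ioo _ _, ?_⟩, ⟨convex_Ioo _ _, ?_⟩, ?_, ?_, ?_, M, ?_⟩
  · intro x hx y hy s t hs ht hst
    have := B.ch.2 (hI x hx) (hI y hy) hs ht hst
    simp only [smul_eq_mul] at *
    rw [show -(s * x + t * y) = s * -x + t * -y by ring]; linarith
  · intro x hx y hy s t hs ht hst
    have := B.cg.2 (hI x hx) (hI y hy) hs ht hst
    simp only [smul_eq_mul] at *
    rw [show -(s * x + t * y) = s * -x + t * -y by ring]; linarith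
  · intro x hx
    have := B.lt _ (hI x hx)
    linarith
  · intro x hx y
    have := B.mem _ (hI x hx) (-y)
    rw [Set.mem_neg, show -((x, y) : P2) = (-x, -y) from rfl, this]
    constructor <;> rintro ⟨h1, h2⟩ <;> constructor <;> linarith
  · intro z hz
    have := B.out _ hz
    simp only [Prod.fst_neg] at this
    exact ⟨by linarith [this.2], by linarith [this.1]⟩
  · intro x hx
    have := hM _ (hI x hx)
    simpa only [abs_neg] using this.symm

lemma wet_neg (S : Set P2) (δ : ℝ) : wet (-S) δ = - wet S δ := by
  have aux : ∀ (S : Set P2) z, z ∈ wet S δ → -z ∈ wet (-S) δ := by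
    rintro S z ⟨hz, n, c, hv, hc⟩
    refine ⟨by simpa using hz, -n, c, ?_, by simp only [dot2, Prod.fst_neg, Prod.snd_neg] at *; linarith⟩
    refine le_trans (le_of_eq ?_) hv
    rw [← Measure.measure_neg volume {y | y ∈ S ∧ c < dot2 n y}]
    congr 1
    ext y
    simp [dot2]
  ext z
  constructor
  · intro hz
    have := aux _ _ hz
    rwa [neg_neg] at this
  · intro hz
    have := aux _ _ hz
    rwa [neg_neg] at this

/-- area between two graphs -/
lemma vol_reg {l r : ℝ} (hlr : l ≤ r) {f k : ℝ → ℝ} (hf : Continuous f) (hk : Continuous k) (hfk : ∀ x ∈ Icc l r, f x ≤ k x) :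
    MeasurableSet {z : P2 | z.1 ∈ Icc l r ∧ f z.1 ≤ z.2 ∧ z.2 ≤ k z.1} ∧
    volume {z : P2 | z.1 ∈ Icc l r ∧ f z.1 ≤ z.2 ∧ z.2 ≤ k z.1} = ENNReal.ofReal (∫ x in l..r, (k x - f x)) := by
  have hm : MeasurableSet {z : P2 | z.1 ∈ Icc l r ∧ f z.1 ≤ z.2 ∧ z.2 ≤ k z.1} := by
    apply IsClosed.measurableSet
    have c1 : IsClosed {z : P2 | f z.1 ≤ z.2} := isClosed_le (by fun_prop) (by fun_prop)
    have c2 : IsClosed {z : P2 | z.2 ≤ k z.1} := isClosed_le (by fun_prop) (by fun_prop)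
    exact (isClosed_Icc.preimage continuous_fst).inter (c1.inter c2)
  refine ⟨hm, ?_⟩
  rw [Measure.volume_eq_prod, Measure.prod_apply hm, intervalIntegral.integral_of_le hlr, ← integral_Icc_eq_integral_Ioc,
    ofReal_integral_eq_lintegral_ofReal]
  · rw [← lintegral_indicator measurableSet_Icc]
    apply lintegral_congr
    intro x
    by_cases hx : x ∈ Icc l r
    · rw [indicator_of_mem hx, ← Real.volume_Icc]
      congr 1
      ext y; simp [hx.1, hx.2]
    · rw [indicator_of_notMem hx]
      convert measure_empty (μ := volume)
      ext y
      simp only [mem_preimage, mem_ofPred_eq, mem_empty_iff_false, iff_false]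
      exact fun h => hx h.1
  · exact (hk.sub hf).continuousOn.integrableOn_Icc
  · filter_upwards [ae_restrict_mem measurableSet_Icc] with x hx
    simpa using hfk x hx

lemma int_quad (w Q x s : ℝ) : ∫ ξ in (x-s)..(x+s), (w - Q * (ξ - x)^2) = 2 * w * s - 2/3 * Q * s^3 := by
  rw [intervalIntegral.integral_comp_sub_right (fun σ => w - Q * σ^2) x]
  simp only [sub_sub_cancel_left, add_sub_cancel_left]
  rw [intervalIntegral.integral_sub (by simp) (by apply Continuous.intervalIntegrable; fun_prop)]
  simp [integral_pow]
  ring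

/-- Macbeath-type lemma -/
lemma wet_sym {S A : Set P2} {δ : ℝ} {z : P2} (hz : z ∈ wet S δ) (hA : MeasurableSet A) (hAS : A ⊆ S)
    (hsym : ∀ y ∈ A, z + z - y ∈ A) : volume A ≤ 2 * ENNReal.ofReal δ := by
  obtain ⟨hzS, n, c, hv, hc⟩ := hz
  have h1 : volume {y | y ∈ A ∧ c < dot2 n y} ≤ ENNReal.ofReal δ := (measure_mono (fun y hy => And.intro (hAS hy.1) hy.2)).trans hv
  have h2 : volume {y | y ∈ A ∧ dot2 n y ≤ c} ≤ ENNReal.ofReal δ := by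
    refine le_trans ?_ h1
    have e : volume ((fun y => z + z - y) ⁻¹' {y | y ∈ A ∧ c < dot2 n y}) = volume {y | y ∈ A ∧ c < dot2 n y} :=
      (Measure.measurePreserving_sub_left volume (z + z)).measure_preimage_equiv (f := MeasurableEquiv.subLeft (z+z)) _
    rw [← e]
    apply measure_mono
    rintro y ⟨hy1, hy2⟩
    refine ⟨hsym y hy1, ?_⟩
    simp only [dot2, Prod.fst_sub, Prod.snd_sub, Prod.fst_add, Prod.snd_add] at *
    linarith
  calc volume A ≤ volume ({y | y ∈ A ∧ c < dot2 n y} ∪ {y | y ∈ A ∧ dot2 n y ≤ c}) := by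
        apply measure_mono
        intro y hy
        rcases lt_or_ge c (dot2 n y) with h | h
        · exact Or.inl ⟨hy, h⟩
        · exact Or.inr ⟨hy, h⟩
    _ ≤ _ := measure_union_le _ _
    _ ≤ _ := by rw [two_mul]; exact add_le_add h1 h2

/-- room above -/
lemma Body.room {S : Set P2} {a b : ℝ} {g h : ℝ → ℝ} (B : Body S a b g h) {p : ℝ → ℝ} (hp : SubG a b g p) {x σ : ℝ}
    (hx : x ∈ Ioo a b) (hs : x + 4 * σ ∈ Ioo a b) : g x + p x * σ + 3/4 * (h x - g x) ≤ h (x + σ) := by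
  have h1 := B.ch.2 hx hs (show (0:ℝ) ≤ 3/4 by norm_num) (show (0:ℝ) ≤ 1/4 by norm_num) (by norm_num)
  have h2 := hp x hx _ hs
  have h3 := B.lt _ hs
  simp only [smul_eq_mul] at h1
  rw [show 3/4 * x + 1/4 * (x + 4 * σ) = x + σ by ring] at h1
  linarith

/-- the quadratic cap estimate -/
lemma Body.mac {S : Set P2} {a b : ℝ} {g h : ℝ → ℝ} (B : Body S a b g h) {p : ℝ → ℝ} (hp : SubG a b g p) {x s δ w v Q : ℝ}
    (hδ : 0 ≤ δ) (hs : 0 < s) (h1 : x - 4 * s ∈ Ioo a b) (h2 : x + 4 * s ∈ Ioo a b) (hQ : 0 ≤ Q) (hv : Q * s^2 ≤ v)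
    (hlow : ∀ σ, |σ| ≤ s → g (x + σ) ≤ g x + p x * σ + Q * σ^2 + (w - v)) (hup : w + v ≤ 3/4 * (h x - g x))
    (hw : (x, g x + w) ∈ wet S δ) : 2 * v * s - 2/3 * Q * s^3 ≤ δ := by
  have hx : x ∈ Ioo a b := ⟨by linarith [h1.1], by linarith [h2.2]⟩
  obtain ⟨hm, hvol⟩ := vol_reg (l := x - s) (r := x + s) (by linarith)
    (f := fun ξ => g x + w + p x * (ξ - x) - (v - Q * (ξ - x)^2)) (k := fun ξ => g x + w + p x * (ξ - x) + (v - Q * (ξ - x)^2))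
    (by fun_prop) (by fun_prop) (by
      intro ξ hξ
      have : (ξ - x)^2 ≤ s^2 := sq_le_sq' (by linarith [hξ.1]) (by linarith [hξ.2])
      nlinarith)
  have := wet_sym hw hm ?_ ?_
  · rw [hvol, show (2:ENNReal) = ENNReal.ofReal 2 by simp, ← ENNReal.ofReal_mul (by norm_num)] at this
    rw [ENNReal.ofReal_le_ofReal_iff (by positivity)] at this
    have e : ∀ ξ, (g x + w + p x * (ξ - x) + (v - Q * (ξ - x)^2) - (g x + w + p x * (ξ - x) - (v - Q * (ξ - x)^2))) = 2 * v - 2 * Q * (ξ - x)^2 := by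
      intro ξ; ring
    simp only [e] at this
    rw [int_quad] at this
    linarith
  · rintro ⟨ξ, y⟩ ⟨hξ, hy1, hy2⟩
    simp only at hξ hy1 hy2
    have hξI : ξ ∈ Ioo a b := ⟨by linarith [h1.1, hξ.1], by linarith [h2.2, hξ.2]⟩
    rw [B.mem ξ hξI]
    have hσ : |ξ - x| ≤ s := abs_le.2 ⟨by linarith [hξ.1], by linarith [hξ.2]⟩
    have e1 := hlow (ξ - x) hσ
    have e2 := B.room hp hx (σ := ξ - x) ⟨by linarith [h1.1, hξ.1], by linarith [h2.2, hξ.2]⟩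
    rw [add_sub_cancel] at e1 e2
    have e3 : 0 ≤ Q * (ξ - x)^2 := by positivity
    constructor <;> linarith
  · rintro ⟨ξ, y⟩ ⟨hξ, hy1, hy2⟩
    simp only at hξ hy1 hy2
    refine ⟨⟨?_, ?_⟩, ?_, ?_⟩ <;> simp only [Prod.fst_sub, Prod.snd_sub, Prod.fst_add, Prod.snd_add]
    · linarith [hξ.2]
    · linarith [hξ.1]
    · linarith
    · linarith

end partF3

section partF4

/-- the floating body constant, `cc^3 = 9/32` -/
def cc : ℝ := (9/32 : ℝ)^((1:ℝ)/3)

lemma cc_pos : 0 < cc := by unfold cc; positivity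

lemma cc_cube : cc^3 = 9/32 := by
  unfold cc
  rw [← Real.rpow_natCast, ← Real.rpow_mul (by norm_num)]; norm_num

lemma rpow_third_cube {r : ℝ} (hr : 0 ≤ r) : (r^((1:ℝ)/3))^3 = r := by
  rw [← Real.rpow_natCast, ← Real.rpow_mul hr]; norm_num

lemma rpow_twothird_cube {r : ℝ} (hr : 0 ≤ r) : (r^((2:ℝ)/3))^3 = r^2 := by
  rw [← Real.rpow_natCast, ← Real.rpow_mul hr]; norm_num

/-- star-shapedness of the defect -/
lemma Body.defect {a b : ℝ} {g p : ℝ → ℝ} (cg : ConvexOn ℝ (Ioo a b) g) (hp : SubG a b g p) {x σ t : ℝ} (hx : x ∈ Ioo a b) (hs : x + σ ∈ Ioo a b) (ht0 : 0 ≤ t)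
    (ht1 : t ≤ 1) : g (x + t * σ) - g x - p x * (t * σ) ≤ g (x + σ) - g x - p x * σ := by
  have h1 := cg.2 hx hs (show (0:ℝ) ≤ 1 - t by linarith) ht0 (by ring)
  simp only [smul_eq_mul] at h1
  rw [show (1 - t) * x + t * (x + σ) = x + t * σ by ring] at h1
  have h2 := hp x hx _ hs
  nlinarith

lemma Body.defect' {a b : ℝ} {g p : ℝ → ℝ} (cg : ConvexOn ℝ (Ioo a b) g) (hp : SubG a b g p) {x s : ℝ} (h1 : x - s ∈ Ioo a b) (h2 : x + s ∈ Ioo a b) {σ : ℝ} (hs : 0 < s)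
    (hσ : |σ| ≤ s) : g (x + σ) - g x - p x * σ ≤ sd g x s := by
  have hx : x ∈ Ioo a b := ⟨by linarith [h1.1], by linarith [h2.2]⟩
  have e1 := hp x hx _ h1
  have e2 := hp x hx _ h2
  have hb := abs_le.1 hσ
  unfold sd
  rcases le_total 0 σ with h0 | h0
  · have := Body.defect cg hp hx h2 (t := σ/s) (by positivity) ((div_le_one hs).2 hb.2)
    rw [div_mul_cancel₀ _ hs.ne'] at this
    linarith
  · have := Body.defect cg hp hx (σ := -s) h1 (t := -σ/s) (div_nonneg (by linarith) hs.le) ((div_le_one hs).2 (by linarith))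
    rw [show -σ/s * -s = σ by field_simp] at this
    rw [← sub_eq_add_neg] at this
    linarith

lemma Body.dom {S : Set P2} {a b M : ℝ} {g h : ℝ → ℝ} (B : Body S a b g h) (hM : ∀ x ∈ Ioo a b, |g x| ≤ M ∧ |h x| ≤ M)
    {x f δ w : ℝ} (hx : x ∈ Ioo a b) (hf1 : (min (x-a) (b-x))^(-(2:ℝ)/3) ≤ f)
    (hf2 : ∀ s, 0 < s → s ≤ min (x-a) (b-x)/4 → (sd g x s / s^2)^((1:ℝ)/3) ≤ f) (hδ : 0 < δ) (hw : 2 * w ≤ h x - g x)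
    (hwet : (x, g x + w) ∈ wet S δ) : w ≤ (2048 * M + 64) * f * δ^((2:ℝ)/3) := by
  have hp := SubG_of_convex B.cg
  set d := min (x-a) (b-x) with hd
  have hd0 : 0 < d := lt_min (by linarith [hx.1]) (by linarith [hx.2])
  have hda : d ≤ x - a := min_le_left _ _
  have hdb : d ≤ b - x := min_le_right _ _
  have hf0 : 0 < f := lt_of_lt_of_le (by positivity) hf1
  have hM0 : 0 ≤ M := (abs_nonneg _).trans (hM x hx).1
  rcases le_or_gt w 0 with hw0 | hw0
  · exact hw0.trans (by positivity)
  have hw2M : w ≤ M := by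
    have := abs_le.1 (hM x hx).1
    have := abs_le.1 (hM x hx).2
    linarith
  have hf3 : d^2 * f^3 ≥ 1 := by
    have : (d^(-(2:ℝ)/3))^3 ≤ f^3 := by gcongr
    have e : (d^(-(2:ℝ)/3))^3 = (d^2)⁻¹ := by
      rw [neg_div, Real.rpow_neg hd0.le, inv_pow, rpow_twothird_cube hd0.le]
    rw [e, inv_le_iff_one_le_mul₀ (by positivity)] at this
    linarith
  have hgen : ∀ s, 0 < s → s ≤ d/8 → sd g x s ≤ w/4 → w * s ≤ 2 * δ := by
    intro s hs hs1 hs2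
    have := B.mac hp (x := x) (s := s) (δ := δ) (w := w) (v := w/4) (Q := 0) hδ.le hs ⟨by linarith, by linarith⟩ ⟨by linarith, by linarith⟩ le_rfl
      (by linarith) ?_ (by linarith) hwet
    · linarith
    · intro σ hσ
      have := Body.defect' B.cg hp (x := x) (s := s) ⟨by linarith, by linarith⟩ ⟨by linarith, by linarith⟩ hs hσ
      linarith
  have hsd : ∀ s, 0 < s → s ≤ d/8 → sd g x s ≤ f^3 * s^2 := by
    intro s hs hs1
    have hn : 0 ≤ sd g x s := by
      have e1 := hp x hx (x - s) ⟨by linarith, by linarith⟩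
      have e2 := hp x hx (x + s) ⟨by linarith, by linarith⟩
      unfold sd; linarith
    have h3 : ((sd g x s / s^2)^((1:ℝ)/3))^3 ≤ f^3 := by
      have := hf2 s hs (by linarith); gcongr
    rw [rpow_third_cube (by positivity), div_le_iff₀ (by positivity)] at h3
    exact h3
  have hcube : w^3 ≤ (2048 * M + 64) * (f^3 * δ^2) := by
    set r := Real.sqrt (w/(4*f^3)) with hr
    have hr2 : r^2 = w/(4*f^3) := Real.sq_sqrt (by positivity)
    have hr0 : 0 < r := Real.sqrt_pos.2 (by positivity)
    rcases le_total r (d/8) with h | h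
    · have h1 := hgen r hr0 h ((hsd r hr0 h).trans (le_of_eq (by rw [hr2]; field_simp)))
      have h2 : (w * r)^2 ≤ (2*δ)^2 := by gcongr
      rw [mul_pow, hr2] at h2
      have h3 : w^3 ≤ 16 * (f^3 * δ^2) := by
        have e : w^2 * (w / (4 * f^3)) = w^3 / (4 * f^3) := by ring
        rw [e, div_le_iff₀ (by positivity)] at h2
        nlinarith
      nlinarith [show 0 ≤ f^3 * δ^2 by positivity, mul_nonneg hM0 (show 0 ≤ f^3 * δ^2 by positivity)]
    · have h1 := hgen (d/8) (by positivity) le_rfl ((hsd _ (by positivity) le_rfl).trans (by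
        have : (d/8)^2 ≤ r^2 := by gcongr
        rw [hr2, le_div_iff₀ (by positivity)] at this
        linarith))
      have h2 : (w * d)^2 ≤ (16*δ)^2 := by
        have : w * d ≤ 16 * δ := by linarith
        gcongr
      have h4 : w^2 ≤ (16*δ)^2 * f^3 := by
        calc w^2 ≤ w^2 * (d^2 * f^3) := by nlinarith [sq_nonneg w]
          _ = (w*d)^2 * f^3 := by ring
          _ ≤ _ := by gcongr
      calc w^3 = w^2 * w := by ring
        _ ≤ ((16*δ)^2 * f^3) * M := by gcongr
        _ ≤ _ := by nlinarith [show 0 ≤ f^3 * δ^2 by positivity, mul_nonneg hM0 (show 0 ≤ f^3 * δ^2 by positivity)]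
  refine le_of_pow_le_pow_left₀ (n := 3) (by norm_num) (by positivity) (hcube.trans ?_)
  rw [mul_pow, mul_pow, rpow_twothird_cube hδ.le]
  have hC : (1:ℝ) ≤ 2048 * M + 64 := by linarith
  have : 2048 * M + 64 ≤ (2048 * M + 64)^3 := le_self_pow₀ hC (by norm_num)
  rw [mul_assoc]
  gcongr

/-- depth tends to zero -/
lemma Body.small {S : Set P2} {a b : ℝ} {g h p : ℝ → ℝ} (B : Body S a b g h) (hp : SubG a b g p) {x q : ℝ} (hx : x ∈ Ioo a b)
    (hq : HasDerivAt p q x) {w0 : ℝ} (hw0 : 0 < w0) : ∃ δ0 > 0, ∀ δ, 0 < δ → δ < δ0 → ∀ w, 2 * w ≤ h x - g x → (x, g x + w) ∈ wet S δ → w ≤ w0 := by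
  obtain ⟨s0, hs0, hl, hr, hpe⟩ := hp.peano hx hq one_pos
  obtain ⟨s, hs, hs1, hs2⟩ : ∃ s > 0, 4 * s ≤ s0 ∧ (|q| + 1) * s^2 ≤ w0 := by
    refine ⟨min (s0/4) (min 1 (w0/(|q|+1))), by positivity, ?_, ?_⟩
    · linarith [min_le_left (s0/4) (min 1 (w0/(|q|+1)))]
    · set s := min (s0/4) (min 1 (w0/(|q|+1))) with hs
      have h0 : 0 < s := by positivity
      have h1 : s ≤ 1 := (min_le_right _ _).trans (min_le_left _ _)
      have h2 : s ≤ w0/(|q|+1) := (min_le_right _ _).trans (min_le_right _ _)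
      rw [le_div_iff₀ (by positivity)] at h2
      nlinarith [abs_nonneg q]
  refine ⟨w0 * s / 2, by positivity, ?_⟩
  intro δ hδ hδ0 w hw hwet
  by_contra hc
  push Not at hc
  have := B.mac hp (x := x) (s := s) (δ := δ) (w := w) (v := w/4) (Q := 0) hδ.le hs ⟨by linarith [hl.1], by linarith [hr.2]⟩ ⟨by linarith [hl.1], by linarith [hr.2]⟩ le_rfl
      (by linarith) ?_ (by linarith) hwet
  · nlinarith
  · intro σ hσ
    have h1 := (hpe σ (by linarith)).2
    have h2 : σ^2 ≤ s^2 := by rw [← sq_abs]; gcongr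
    have h3 : (q + 1) * σ^2 ≤ (|q| + 1) * s^2 := by
      have := le_abs_self q
      have : 0 ≤ |q| := abs_nonneg q
      calc (q+1) * σ^2 ≤ (|q| + 1) * σ^2 := by gcongr
        _ ≤ _ := by gcongr
    linarith

lemma Body.upper {S : Set P2} {a b : ℝ} {g h p : ℝ → ℝ} (B : Body S a b g h) (hp : SubG a b g p) {x q : ℝ} (hx : x ∈ Ioo a b)
    (hq : HasDerivAt p q x) (hq0 : 0 ≤ q) {ε : ℝ} (hε : 0 < ε) : ∃ δ0 > 0, ∀ δ, 0 < δ → δ < δ0 → ∀ w, 2 * w ≤ h x - g x → (x, g x + w) ∈ wet S δ →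
      w ≤ cc * (q + ε)^((1:ℝ)/3) * δ^((2:ℝ)/3) := by
  obtain ⟨s0, hs0, hl, hr, hpe⟩ := hp.peano hx hq hε
  have hH := B.lt x hx
  set w0 := min (3/8 * (h x - g x)) ((q + ε) * (s0/4)^2 / 2) with hw0
  have hw0p : 0 < w0 := by
    have : 0 < h x - g x := by linarith
    positivity
  obtain ⟨δ0, hδ0, hsm⟩ := B.small hp hx hq hw0p
  refine ⟨δ0, hδ0, ?_⟩
  intro δ hδ hδδ w hw hwet
  rcases le_or_gt w 0 with hwn | hwp
  · exact hwn.trans (by have := cc_pos; positivity)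
  have hle := hsm δ hδ hδδ w hw hwet
  have hle1 : w ≤ 3/8 * (h x - g x) := hle.trans (min_le_left _ _)
  have hle2 : w ≤ (q + ε) * (s0/4)^2 / 2 := hle.trans (min_le_right _ _)
  set s := Real.sqrt (2*w/(q+ε)) with hs
  have hs2 : s^2 = 2*w/(q+ε) := Real.sq_sqrt (by positivity)
  have hsp : 0 < s := Real.sqrt_pos.2 (by positivity)
  have hs4 : s ≤ s0/4 := by
    apply le_of_pow_le_pow_left₀ (n := 2) (by norm_num) (by positivity)
    rw [hs2, div_le_iff₀ (by positivity)]; linarith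
  have hQs : (q+ε)/2 * s^2 = w := by rw [hs2]; field_simp
  have := B.mac hp (x := x) (s := s) (δ := δ) (w := w) (v := w) (Q := (q+ε)/2) hδ.le hsp ⟨by linarith [hl.1], by linarith [hr.2]⟩ ⟨by linarith [hl.1], by linarith [hr.2]⟩ (by positivity)
      hQs.le ?_ (by linarith) hwet
  · have h1 : 4/3 * w * s ≤ δ := by
      have : (q+ε)/2 * s^3 = w * s := by rw [← hQs]; ring
      linarith
    have h2 : (4/3 * w * s)^2 ≤ δ^2 := by gcongr
    rw [mul_pow, hs2] at h2
    have h3 : w^3 ≤ 9/32 * (q+ε) * δ^2 := by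
      rw [show (4/3*w)^2 * (2 * w/(q+ε)) = 32/9 * w^3/(q+ε) by ring, div_le_iff₀ (by positivity)] at h2
      linarith
    refine le_of_pow_le_pow_left₀ (n := 3) (by norm_num) (by have := cc_pos; positivity) (h3.trans ?_)
    rw [mul_pow, mul_pow, rpow_twothird_cube hδ.le, rpow_third_cube (by positivity), cc_cube]
  · intro σ hσ
    have h1 := (hpe σ (by linarith)).2
    linarith

lemma Body.lower {S : Set P2} {a b : ℝ} {g h p : ℝ → ℝ} (B : Body S a b g h) (hp : SubG a b g p) {x q : ℝ} (hx : x ∈ Ioo a b)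
    (hq : HasDerivAt p q x) {ε : ℝ} (hε : 0 < ε) (hεq : ε < q) : ∃ δ0 > 0, ∀ δ, 0 < δ → δ < δ0 →
      2 * (cc * (q - ε)^((1:ℝ)/3) * δ^((2:ℝ)/3)) ≤ h x - g x ∧ ∀ w, 0 ≤ w → w < cc * (q - ε)^((1:ℝ)/3) * δ^((2:ℝ)/3) → (x, g x + w) ∈ wet S δ := by
  obtain ⟨s0, hs0, hl, hr, hpe⟩ := hp.peano hx hq hε
  have hH := B.lt x hx
  set R := q - ε with hR
  have hR0 : 0 < R := by linarith
  have hcc := cc_pos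
  set w0 := min (1/2 * (h x - g x)) (R * s0^2 / 2) with hw0
  have hw0p : 0 < w0 := by
    have : 0 < h x - g x := by linarith
    positivity
  have hlim : Tendsto (fun δ : ℝ => cc * R^((1:ℝ)/3) * δ^((2:ℝ)/3)) (nhds 0) (nhds 0) := by
    have : Continuous (fun δ : ℝ => cc * R^((1:ℝ)/3) * δ^((2:ℝ)/3)) := by
      apply continuous_const.mul
      exact Real.continuous_rpow_const (by norm_num)
    have h2 := this.tendsto 0
    simpa [Real.zero_rpow] using h2
  obtain ⟨δ0, hδ0, hδ1⟩ := Metric.eventually_nhds_iff.1 (hlim.eventually_lt_const hw0p)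
  refine ⟨δ0, hδ0, ?_⟩
  intro δ hδ hδδ
  have hlt := hδ1 (y := δ) (by rw [Real.dist_eq, sub_zero, abs_of_pos hδ]; exact hδδ)
  set w' := cc * R^((1:ℝ)/3) * δ^((2:ℝ)/3) with hw'
  have hw'0 : 0 < w' := by positivity
  have hle1 : w' < 1/2 * (h x - g x) := hlt.trans_le (min_le_left _ _)
  have hle2 : w' < R * s0^2 / 2 := hlt.trans_le (min_le_right _ _)
  refine ⟨by linarith, ?_⟩
  intro w hw hww
  refine ⟨(B.mem x hx _).2 ⟨by linarith, by linarith⟩, (p x, -1), p x * x - g x - w', ?_, ?_⟩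
  swap
  · simp only [dot2]; linarith
  set s := Real.sqrt (2*w'/R) with hs
  have hs2 : s^2 = 2*w'/R := Real.sq_sqrt (by positivity)
  have hsp : 0 < s := Real.sqrt_pos.2 (by positivity)
  have hs4 : s ≤ s0 := by
    apply le_of_pow_le_pow_left₀ (n := 2) (by norm_num) (by positivity)
    rw [hs2, div_le_iff₀ (by positivity)]; linarith
  have hQs : R/2 * s^2 = w' := by rw [hs2]; field_simp
  have harea : 4/3 * w' * s = δ := by
    have h1 : (4/3 * w' * s)^2 = δ^2 := by
      rw [mul_pow, hs2, show (4/3*w')^2 * (2 * w'/R) = 32/9 * w'^3/R by ring, hw', mul_pow, mul_pow, rpow_twothird_cube hδ.le, rpow_third_cube hR0.le, cc_cube]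
      field_simp
    exact (pow_left_inj₀ (by positivity) hδ.le (by norm_num)).1 h1
  obtain ⟨-, hvol⟩ := vol_reg (l := x - s) (r := x + s) (by linarith)
    (f := fun ξ => g x + p x * (ξ - x) + R/2 * (ξ - x)^2) (k := fun ξ => g x + p x * (ξ - x) + w')
    (by fun_prop) (by fun_prop) (by
      intro ξ hξ
      have : (ξ - x)^2 ≤ s^2 := sq_le_sq' (by linarith [hξ.1]) (by linarith [hξ.2])
      nlinarith)
  have e : ∀ ξ, (g x + p x * (ξ - x) + w' - (g x + p x * (ξ - x) + R/2 * (ξ - x)^2)) = w' - R/2 * (ξ - x)^2 := by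
    intro ξ; ring
  simp only [e] at hvol
  rw [int_quad] at hvol
  have hcol : ∀ c : ℝ, volume {z : P2 | z.1 = c} = 0 := by
    intro c
    rw [show {z : P2 | z.1 = c} = ({c} : Set ℝ) ×ˢ univ by ext; simp, Measure.volume_eq_prod, Measure.prod_prod]
    simp
  have hsub : {y | y ∈ S ∧ p x * x - g x - w' < dot2 (p x, -1) y} ⊆
      {z : P2 | z.1 ∈ Icc (x-s) (x+s) ∧ g x + p x * (z.1 - x) + R/2 * (z.1 - x)^2 ≤ z.2 ∧ z.2 ≤ g x + p x * (z.1 - x) + w'} ∪ ({z | z.1 = a} ∪ {z | z.1 = b}) := by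
    rintro ⟨ξ, y⟩ ⟨hy, hc⟩
    simp only [dot2] at hc
    by_cases hxa : ξ = a
    · right; left; exact hxa
    by_cases hxb : ξ = b
    · right; right; exact hxb
    left
    have ho := B.out _ hy
    have hξ : ξ ∈ Ioo a b := ⟨lt_of_le_of_ne ho.1 (Ne.symm hxa), lt_of_le_of_ne ho.2 hxb⟩
    have hgy := ((B.mem ξ hξ y).1 hy).1
    have habs : |ξ - x| ≤ s := by
      by_contra hcon
      push Not at hcon
      have hpos : 0 < |ξ - x| := hsp.trans hcon
      have h1 := Body.defect B.cg hp hx (σ := ξ - x) (by simpa using hξ) (t := s/|ξ-x|) (by positivity) ((div_le_one hpos).2 hcon.le)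
      have h2 := (hpe (s/|ξ-x| * (ξ - x)) (by
        rw [abs_mul, abs_div, abs_abs, abs_of_pos hsp, div_mul_cancel₀ _ hpos.ne']; exact hs4)).1
      have h3 : (s/|ξ-x| * (ξ - x))^2 = s^2 := by
        rw [mul_pow, div_pow, sq_abs]
        have : (ξ - x)^2 ≠ 0 := by rw [← sq_abs]; positivity
        rw [div_mul_cancel₀ _ this]
      rw [h3] at h2
      rw [add_sub_cancel] at h1
      linarith
    have h2 := (hpe (ξ - x) (by linarith)).1
    rw [add_sub_cancel] at h2
    have habs' := abs_le.1 habs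
    refine ⟨⟨by linarith, by linarith⟩, ?_, ?_⟩ <;> simp only <;> linarith
  refine (measure_mono hsub).trans ((measure_union_le _ _).trans ?_)
  rw [measure_union_null (hcol a) (hcol b), add_zero, hvol]
  apply ENNReal.ofReal_le_ofReal
  have : R/2 * s^3 = w' * s := by rw [← hQs]; ring
  linarith

/-- length of the lower wet part of a column -/
def lw (S : Set P2) (g h : ℝ → ℝ) (δ x : ℝ) : ENNReal := volume {y : ℝ | (x, y) ∈ wet S δ ∧ 2 * y < g x + h x}

lemma lw_le {S : Set P2} {a b : ℝ} {g h : ℝ → ℝ} (B : Body S a b g h) {x δ W : ℝ} (hx : x ∈ Ioo a b)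
    (hW : ∀ w, 2 * w ≤ h x - g x → (x, g x + w) ∈ wet S δ → w ≤ W) : lw S g h δ x ≤ ENNReal.ofReal W := by
  have : {y : ℝ | (x, y) ∈ wet S δ ∧ 2 * y < g x + h x} ⊆ Icc (g x) (g x + W) := by
    rintro y ⟨h1, h2⟩
    have h3 := ((B.mem x hx y).1 h1.1).1
    have := hW (y - g x) (by linarith) (by rwa [add_sub_cancel])
    exact ⟨h3, by linarith⟩
  refine (measure_mono this).trans ?_
  rw [Real.volume_Icc]; simp

lemma Body.lim {S : Set P2} {a b : ℝ} {g h p : ℝ → ℝ} (B : Body S a b g h) (hp : SubG a b g p) {x q : ℝ} (hx : x ∈ Ioo a b)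
    (hq : HasDerivAt p q x) (hq0 : 0 ≤ q) : Tendsto (fun δ : ℝ => lw S g h δ x / ENNReal.ofReal (δ^((2:ℝ)/3))) (nhdsWithin 0 (Ioi 0))
      (nhds (ENNReal.ofReal (cc * q^((1:ℝ)/3)))) := by
  have hcc := cc_pos
  have hcont : ∀ k : ℝ, Tendsto (fun ε : ℝ => ENNReal.ofReal (cc * (q + k * ε)^((1:ℝ)/3))) (nhdsWithin 0 (Ioi 0)) (nhds (ENNReal.ofReal (cc * q^((1:ℝ)/3)))) := by
    intro k
    have : Continuous (fun ε : ℝ => ENNReal.ofReal (cc * (q + k * ε)^((1:ℝ)/3))) := by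
      apply ENNReal.continuous_ofReal.comp
      apply continuous_const.mul
      exact (Real.continuous_rpow_const (by norm_num)).comp (by fun_prop)
    have h2 := (this.tendsto 0).mono_left (nhdsWithin_le_nhds (s := Ioi 0))
    simpa using h2
  have hpos : ∀ δ : ℝ, 0 < δ → ENNReal.ofReal (δ^((2:ℝ)/3)) ≠ 0 := by
    intro δ hδ; rw [ENNReal.ofReal_ne_zero_iff]; positivity
  rw [tendsto_order]
  constructor
  · intro L hL
    have hqp : 0 < q := by
      rcases hq0.lt_or_eq with h | h
      · exact h
      · rw [← h] at hL; simp at hL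
    obtain ⟨ε, hε1, hε2⟩ := (((hcont (-1)).eventually_const_lt hL).and (Ioo_mem_nhdsGT hqp)).exists
    obtain ⟨δ0, hδ0, hlow⟩ := B.lower hp hx hq hε2.1 hε2.2
    filter_upwards [Ioo_mem_nhdsGT hδ0] with δ hδ
    obtain ⟨h1, h2⟩ := hlow δ hδ.1 hδ.2
    refine hε1.trans_le ?_
    rw [ENNReal.le_div_iff_mul_le (Or.inl (hpos δ hδ.1)) (Or.inl ENNReal.ofReal_ne_top)]
    rw [← ENNReal.ofReal_mul (by have := hε2.2; have : 0 ≤ q + -1 * ε := by linarith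
                                 positivity), show q + -1 * ε = q - ε by ring]
    set w' := cc * (q - ε)^((1:ℝ)/3) * δ^((2:ℝ)/3)
    calc ENNReal.ofReal w' = volume (Ico (g x) (g x + w')) := by rw [Real.volume_Ico]; simp
      _ ≤ _ := by
        apply measure_mono
        rintro y ⟨hy1, hy2⟩
        have := h2 (y - g x) (by linarith) (by linarith)
        rw [add_sub_cancel] at this
        exact ⟨this, by linarith⟩
  · intro L hL
    obtain ⟨ε, hε1, hε2⟩ := (((hcont 1).eventually_lt_const hL).and self_mem_nhdsWithin).exists
    obtain ⟨δ0, hδ0, hup⟩ := B.upper hp hx hq hq0 hε2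
    filter_upwards [Ioo_mem_nhdsGT hδ0] with δ hδ
    have h1 := lw_le B hx (hup δ hδ.1 hδ.2)
    refine lt_of_le_of_lt ?_ hε1
    apply ENNReal.div_le_of_le_mul
    have hε3 : 0 < ε := hε2
    rw [← ENNReal.ofReal_mul (by positivity), one_mul]
    exact h1

end partF4

section partF5

/-- affine length of the graph of a convex function -/
def aff (a b : ℝ) (g : ℝ → ℝ) : ENNReal := ∫⁻ x in Ioo a b, ENNReal.ofReal ((deriv (rdv g) x)^((1:ℝ)/3))

lemma lw_dom {S : Set P2} {a b : ℝ} {g h : ℝ → ℝ} (B : Body S a b g h) :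
    ∃ F : ℝ → ENNReal, Measurable F ∧ ∫⁻ x in Ioo a b, F x ≠ ⊤ ∧ ∀ᵐ x ∂(volume.restrict (Ioo a b)), ∀ δ : ℝ, 0 < δ →
      lw S g h δ x / ENNReal.ofReal (δ^((2:ℝ)/3)) ≤ F x := by
  obtain ⟨M, hM⟩ := B.bdd
  have hM0 : 0 ≤ M := by
    have := (hM ((a+b)/2) ⟨by linarith [B.hab], by linarith [B.hab]⟩).1
    exact (abs_nonneg _).trans this
  obtain ⟨F, hF1, hF2, hF3⟩ := dom_all B.hab (SubG_of_convex B.cg) (fun x hx => (hM x hx).1)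
  refine ⟨fun x => ENNReal.ofReal (2048 * M + 64) * F x, hF1.const_mul _, ?_, ?_⟩
  · rw [lintegral_const_mul _ hF1]
    exact ENNReal.mul_ne_top ENNReal.ofReal_ne_top hF2
  filter_upwards [hF3, ae_restrict_mem measurableSet_Ioo] with x hx hxI
  intro δ hδ
  apply ENNReal.div_le_of_le_mul
  by_cases hF : F x = ⊤
  · rw [hF, ENNReal.mul_top, ENNReal.top_mul]
    · exact le_top
    · rw [ENNReal.ofReal_ne_zero_iff]; positivity
    · rw [ENNReal.ofReal_ne_zero_iff]; positivity
  have h1 := lw_le B hxI (δ := δ) (W := (2048 * M + 64) * (F x).toReal * δ^((2:ℝ)/3)) (fun w hw hwet =>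
    B.dom hM hxI ((ENNReal.ofReal_le_iff_le_toReal hF).1 hx.1) (fun s hs hs1 => (ENNReal.ofReal_le_iff_le_toReal hF).1 (hx.2 s hs hs1)) hδ hw hwet)
  refine h1.trans (le_of_eq ?_)
  rw [ENNReal.ofReal_mul (by positivity), ENNReal.ofReal_mul (by positivity), ENNReal.ofReal_toReal hF]

lemma rdv_ae {a b : ℝ} {g : ℝ → ℝ} (cg : ConvexOn ℝ (Ioo a b) g) :
    ∀ᵐ x ∂(volume.restrict (Ioo a b)), HasDerivAt (rdv g) (deriv (rdv g) x) x ∧ 0 ≤ deriv (rdv g) x := by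
  have hm := (SubG_of_convex cg).mono
  filter_upwards [hm.ae_differentiableWithinAt measurableSet_Ioo, ae_restrict_mem measurableSet_Ioo] with x hx hxI
  have hd : DifferentiableAt ℝ (rdv g) x := hx.differentiableAt (isOpen_Ioo.mem_nhds hxI)
  refine ⟨hd.hasDerivAt, ?_⟩
  rw [← derivWithin_of_isOpen isOpen_Ioo hxI]
  exact hm.derivWithin_nonneg

lemma lw_lim {S : Set P2} {a b : ℝ} {g h : ℝ → ℝ} (B : Body S a b g h) : ∀ᵐ x ∂(volume.restrict (Ioo a b)),
    Tendsto (fun δ : ℝ => lw S g h δ x / ENNReal.ofReal (δ^((2:ℝ)/3))) (nhdsWithin 0 (Ioi 0))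
      (nhds (ENNReal.ofReal cc * ENNReal.ofReal ((deriv (rdv g) x)^((1:ℝ)/3)))) := by
  filter_upwards [rdv_ae B.cg, ae_restrict_mem measurableSet_Ioo] with x hx hxI
  have := B.lim (SubG_of_convex B.cg) hxI hx.1 hx.2
  rwa [ENNReal.ofReal_mul cc_pos.le] at this

lemma mp_neg (a b : ℝ) : MeasurePreserving (fun x : ℝ => -x) (volume.restrict (Ioo a b)) (volume.restrict (Ioo (-b) (-a))) := by
  have := (Measure.measurePreserving_neg (volume : Measure ℝ)).restrict_preimage (measurableSet_Ioo (a := -b) (b := -a))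
  convert this using 2
  ext x; simp only [mem_Ioo, mem_preimage]
  constructor <;> rintro ⟨h1, h2⟩ <;> constructor <;> linarith

lemma wet_meas {S : Set P2} (hS : IsClosed S) (δ : ℝ) : MeasurableSet (wet S δ) := by
  have : wet S δ = S ∩ ⋃ (n : P2) (c : ℝ) (_ : volume {y | y ∈ S ∧ c < dot2 n y} ≤ ENNReal.ofReal δ), {z | c < dot2 n z} := by
    ext z
    simp only [wet, mem_ofPred_eq, mem_inter_iff, mem_iUnion, exists_prop]
  rw [this]
  refine hS.measurableSet.inter (IsOpen.measurableSet ?_)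
  refine isOpen_iUnion fun n => isOpen_iUnion fun c => isOpen_iUnion fun _ => ?_
  exact isOpen_lt continuous_const (by unfold dot2; fun_prop)

lemma slice_split {S : Set P2} {g h : ℝ → ℝ} (δ x : ℝ) :
    volume {y : ℝ | (x, y) ∈ wet S δ} = lw S g h δ x + lw (-S) (fun x => - h (-x)) (fun x => - g (-x)) δ (-x) := by
  rw [← measure_inter_add_sdiff {y : ℝ | (x, y) ∈ wet S δ} (measurableSet_Iio (a := (g x + h x)/2))]
  congr 1
  · unfold lw
    congr 1
    ext y
    simp only [mem_inter_iff, mem_ofPred_eq, mem_Iio]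
    rw [lt_div_iff₀ two_pos, mul_comm]
  · rw [sdiff_eq, compl_Iio]
    rw [measure_congr ((ae_eq_refl _).inter (Ioi_ae_eq_Ici (μ := volume) (a := (g x + h x)/2)).symm)]
    unfold lw
    rw [← Measure.measure_neg volume ({y : ℝ | (x, y) ∈ wet S δ} ∩ Ioi ((g x + h x)/2)), wet_neg]
    congr 1
    ext y
    simp only [Set.mem_neg, mem_inter_iff, mem_ofPred_eq, mem_Ioi, Prod.neg_mk, neg_neg]
    rw [div_lt_iff₀ two_pos]
    refine and_congr Iff.rfl ?_
    constructor <;> intro h <;> linarith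

lemma vol_wet {S : Set P2} {a b : ℝ} {g h : ℝ → ℝ} (B : Body S a b g h) (hS : IsClosed S) (δ : ℝ) :
    volume (wet S δ) = ∫⁻ x in Ioo a b, volume {y : ℝ | (x, y) ∈ wet S δ} := by
  rw [Measure.volume_eq_prod, Measure.prod_apply (wet_meas hS δ), restrict_Ioo_eq_restrict_Icc, ← lintegral_indicator measurableSet_Icc]
  apply lintegral_congr
  intro x
  by_cases hx : x ∈ Icc a b
  · rw [indicator_of_mem hx]; rfl
  · rw [indicator_of_notMem hx]
    convert measure_empty (μ := volume)
    ext y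
    simp only [mem_preimage, mem_empty_iff_false, iff_false]
    exact fun h => hx (B.out _ h.1)

theorem wet_lim {S : Set P2} {a b : ℝ} {g h : ℝ → ℝ} (B : Body S a b g h) (hS : IsClosed S) :
    aff a b g + aff (-b) (-a) (fun x => - h (-x)) ≠ ⊤ ∧
    Tendsto (fun δ : ℝ => volume (wet S δ) / ENNReal.ofReal (δ^((2:ℝ)/3))) (nhdsWithin 0 (Ioi 0))
      (nhds (ENNReal.ofReal cc * (aff a b g + aff (-b) (-a) (fun x => - h (-x))))) := by
  set g' : ℝ → ℝ := fun x => - h (-x) with hg'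
  obtain ⟨F, hF1, hF2, hF3⟩ := lw_dom B
  obtain ⟨G, hG1, hG2, hG3⟩ := lw_dom B.neg
  have hl1 := lw_lim B
  have hl2 := lw_lim B.neg
  have hcc : ENNReal.ofReal cc ≠ 0 := by rw [ENNReal.ofReal_ne_zero_iff]; exact cc_pos
  have fin : ∀ {S : Set P2} {a b : ℝ} {g h : ℝ → ℝ} (B : Body S a b g h), aff a b g ≠ ⊤ := by
    intro S a b g h B
    obtain ⟨F, hF1, hF2, hF3⟩ := lw_dom B
    have hl1 := lw_lim B
    have : ENNReal.ofReal cc * aff a b g ≤ ∫⁻ x in Ioo a b, F x := by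
      unfold aff
      rw [← lintegral_const_mul' _ _ ENNReal.ofReal_ne_top]
      apply lintegral_mono_ae
      filter_upwards [hF3, hl1] with x h1 h2
      refine le_of_tendsto h2 ?_
      filter_upwards [self_mem_nhdsWithin] with δ hδ using h1 δ hδ
    intro htop
    rw [htop, ENNReal.mul_top hcc] at this
    exact hF2 (top_le_iff.1 this)
  refine ⟨ENNReal.add_ne_top.2 ⟨fin B, fin B.neg⟩, ?_⟩
  have e1 : ∀ δ : ℝ, 0 < δ → volume (wet S δ) / ENNReal.ofReal (δ^((2:ℝ)/3)) = ∫⁻ x in Ioo a b, volume {y : ℝ | (x, y) ∈ wet S δ} / ENNReal.ofReal (δ^((2:ℝ)/3)) := by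
    intro δ hδ
    rw [vol_wet B hS]
    simp only [div_eq_mul_inv]
    rw [lintegral_mul_const']
    rw [ENNReal.inv_ne_top, ENNReal.ofReal_ne_zero_iff]; positivity
  have e2 : ENNReal.ofReal cc * (aff a b g + aff (-b) (-a) g') =
      ∫⁻ x in Ioo a b, (ENNReal.ofReal cc * ENNReal.ofReal ((deriv (rdv g) x)^((1:ℝ)/3)) + ENNReal.ofReal cc * ENNReal.ofReal ((deriv (rdv g') (-x))^((1:ℝ)/3))) := by
    have hm1 : Measurable (fun x => ENNReal.ofReal ((deriv (rdv g) x)^((1:ℝ)/3))) := by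
      have := measurable_deriv (rdv g); fun_prop
    have hm2 : Measurable (fun x => ENNReal.ofReal ((deriv (rdv g') x)^((1:ℝ)/3))) := by
      have := measurable_deriv (rdv g'); fun_prop
    rw [lintegral_add_left (hm1.const_mul _), lintegral_const_mul _ hm1, lintegral_const_mul' _ _ ENNReal.ofReal_ne_top, mul_add]
    congr 2
    exact ((mp_neg a b).lintegral_comp hm2).symm
  rw [e2]
  refine Tendsto.congr' (f₁ := fun δ => ∫⁻ x in Ioo a b, volume {y : ℝ | (x, y) ∈ wet S δ} / ENNReal.ofReal (δ^((2:ℝ)/3))) ?_ ?_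
  · filter_upwards [self_mem_nhdsWithin] with δ hδ using (e1 δ hδ).symm
  apply tendsto_lintegral_filter_of_dominated_convergence (fun x => F x + G (-x))
  · refine Eventually.of_forall fun δ => ?_
    exact (measurable_measure_prodMk_left (wet_meas hS δ)).div_const _
  · filter_upwards [self_mem_nhdsWithin] with δ hδ
    filter_upwards [hF3, (mp_neg a b).quasiMeasurePreserving.ae hG3] with x h1 h2
    rw [slice_split (g := g) (h := h), ENNReal.add_div]
    exact add_le_add (h1 δ hδ) (h2 δ hδ)
  · rw [lintegral_add_left hF1]
    refine ENNReal.add_ne_top.2 ⟨hF2, ?_⟩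
    have := (mp_neg a b).lintegral_comp hG1
    rwa [this]
  · filter_upwards [hl1, (mp_neg a b).quasiMeasurePreserving.ae hl2] with x h1 h2
    have := h1.add h2
    refine this.congr fun δ => ?_
    rw [slice_split (g := g) (h := h), ENNReal.add_div]

end partF5

section partF6

lemma SubG.hasDeriv {a b : ℝ} {g p : ℝ → ℝ} (h : SubG a b g p) {x q : ℝ} (hx : x ∈ Ioo a b) (hq : HasDerivAt p q x) : HasDerivAt g (p x) x := by
  obtain ⟨s0, hs0, -, -, hpe⟩ := h.peano hx hq one_pos
  rw [hasDerivAt_iff_isLittleO_nhds_zero]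
  refine Asymptotics.IsBigO.trans_isLittleO ?_ (Asymptotics.isLittleO_pow_id (𝕜 := ℝ) (n := 2) (by norm_num))
  apply Asymptotics.IsBigO.of_bound (|q| + 1)
  filter_upwards [Metric.ball_mem_nhds (0:ℝ) hs0] with σ hσ
  rw [Metric.mem_ball, Real.dist_eq, sub_zero] at hσ
  obtain ⟨h1, h2⟩ := hpe σ hσ.le
  rw [Real.norm_eq_abs, Real.norm_eq_abs, abs_of_nonneg (sq_nonneg σ), abs_le]
  have h3 := le_abs_self q
  have h4 := neg_abs_le q
  have h5 := sq_nonneg σ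
  simp only [smul_eq_mul]
  constructor
  · nlinarith [mul_nonneg (abs_nonneg q) h5, mul_nonneg (sub_nonneg.2 h3) h5, mul_nonneg (sub_nonneg.2 h4) h5]
  · nlinarith [mul_nonneg (abs_nonneg q) h5, mul_nonneg (sub_nonneg.2 h3) h5, mul_nonneg (sub_nonneg.2 h4) h5]

/-- `∫ φ^{-1/2}` for linear `φ` -/
lemma int_inv_sqrt {x0 x1 α β : ℝ} (hx : x0 < x1) (hα : 0 < α) (hβ : 0 < β) :
    IntervalIntegrable (fun ξ => 1 / Real.sqrt ((α^2 * (x1 - ξ) + β^2 * (ξ - x0)) / (x1 - x0))) volume x0 x1 ∧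
    ∫ ξ in x0..x1, 1 / Real.sqrt ((α^2 * (x1 - ξ) + β^2 * (ξ - x0)) / (x1 - x0)) = 2 * (x1 - x0) / (α + β) := by
  set φ : ℝ → ℝ := fun ξ => (α^2 * (x1 - ξ) + β^2 * (ξ - x0)) / (x1 - x0) with hφ
  have hl : 0 < x1 - x0 := sub_pos.2 hx
  have hpos : ∀ ξ ∈ uIcc x0 x1, 0 < φ ξ := by
    intro ξ hξ
    rw [uIcc_of_le hx.le] at hξ
    apply div_pos _ hl
    rcases hξ.1.lt_or_eq with h | h
    · have := hξ.2
      have h1 : 0 < β^2 * (ξ - x0) := mul_pos (by positivity) (by linarith)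
      have h2 : 0 ≤ α^2 * (x1 - ξ) := mul_nonneg (by positivity) (by linarith)
      linarith
    · have h1 : 0 < α^2 * (x1 - ξ) := mul_pos (by positivity) (by linarith)
      rw [← h] at h1 ⊢; simpa using h1
  have hnonem : IntervalIntegrable (fun ξ => 1 / Real.sqrt (φ ξ)) volume x0 x1 := by
    apply ContinuousOn.intervalIntegrable
    apply ContinuousOn.div continuousOn_const
    · apply Continuous.continuousOn; fun_prop
    · intro ξ hξ
      exact (Real.sqrt_pos.2 (hpos ξ hξ)).ne'
  refine ⟨hnonem, ?_⟩
  have hder : ∀ ξ ∈ uIcc x0 x1, HasDerivAt (fun ξ => 2 * (ξ - x0) / (Real.sqrt (φ ξ) + α)) (1 / Real.sqrt (φ ξ)) ξ := by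
    intro ξ hξ
    have hp := hpos ξ hξ
    have hsq := Real.sqrt_pos.2 hp
    have hφd : HasDerivAt φ ((β^2 - α^2)/(x1 - x0)) ξ := by
      have h1 : HasDerivAt (fun ξ => α^2 * (x1 - ξ) + β^2 * (ξ - x0)) (α^2 * (-1) + β^2 * 1) ξ := by
        exact (((hasDerivAt_id ξ).const_sub x1).const_mul _).add (((hasDerivAt_id ξ).sub_const x0).const_mul _)
      exact (h1.div_const (x1 - x0)).congr_deriv (by ring)
    have h2 := hφd.sqrt hp.ne'
    have h3 := ((((hasDerivAt_id ξ).sub_const x0).const_mul 2).div (h2.add_const α) (by positivity))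
    refine h3.congr_deriv (Eq.symm ?_)
    have hs2 : Real.sqrt (φ ξ)^2 = φ ξ := Real.sq_sqrt hp.le
    have hu : (ξ - x0) * ((β^2 - α^2)/(x1-x0)) = Real.sqrt (φ ξ)^2 - α^2 := by
      rw [hs2, hφ]; field_simp; ring
    set r := Real.sqrt (φ ξ)
    rw [id, show 2 * (ξ - x0) * ((β^2 - α^2)/(x1-x0)/(2*r)) = (r^2 - α^2)/r by rw [← hu]; field_simp]
    field_simp; ring
  rw [intervalIntegral.integral_eq_sub_of_hasDerivAt hder hnonem]
  have e1 : φ x1 = β^2 := by simp only [hφ]; field_simp; ring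
  rw [e1, Real.sqrt_sq hβ.le]
  simp [add_comm]

lemma young_third {q φ : ℝ} (hq : 0 ≤ q) (hφ : 0 < φ) : q^((1:ℝ)/3) ≤ 1/3 * (φ * q) + 2/3 * (1 / Real.sqrt φ) := by
  have := Real.geom_mean_le_arith_mean2_weighted (w₁ := 1/3) (w₂ := 2/3) (p₁ := φ * q) (p₂ := 1/Real.sqrt φ) (by norm_num) (by norm_num) (by positivity) (by positivity) (by norm_num)
  refine le_trans (le_of_eq ?_) this
  rw [Real.mul_rpow hφ.le hq, Real.sqrt_eq_rpow, one_div (φ^((1:ℝ)/2)), ← Real.rpow_neg hφ.le, ← Real.rpow_mul hφ.le]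
  rw [mul_right_comm, ← Real.rpow_add hφ]
  norm_num

lemma pair_young {a b : ℝ} {g p : ℝ → ℝ} (h : SubG a b g p) {x0 x1 y0 y1 P0 P1 : ℝ} (hx : x0 < x1) (hsub : Ioo x0 x1 ⊆ Ioo a b)
    (s0 : ∀ ξ ∈ Ioo x0 x1, y0 + P0 * (ξ - x0) ≤ g ξ) (s1 : ∀ ξ ∈ Ioo x0 x1, y1 + P1 * (ξ - x1) ≤ g ξ)
    (t0 : ∀ ξ ∈ Ioo x0 x1, g ξ + p ξ * (x0 - ξ) ≤ y0) (t1 : ∀ ξ ∈ Ioo x0 x1, g ξ + p ξ * (x1 - ξ) ≤ y1)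
    {A B α β : ℝ} (hA : y1 - y0 - P0 * (x1 - x0) ≤ A * (x1 - x0)) (hB : P1 * (x1 - x0) - (y1 - y0) ≤ B * (x1 - x0)) (hα : 0 < α) (hβ : 0 < β) :
    ∫⁻ ξ in Ioo x0 x1, ENNReal.ofReal ((deriv p ξ)^((1:ℝ)/3)) ≤ ENNReal.ofReal (1/3 * (α^2 * A + β^2 * B) + 4/3 * ((x1 - x0)/(α+β))) := by
  have hl : 0 < x1 - x0 := sub_pos.2 hx
  have hP0 : ∀ ξ ∈ Ioo x0 x1, P0 ≤ p ξ := by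
    intro ξ hξ
    have h1 := s0 ξ hξ; have h2 := t0 ξ hξ
    by_contra hc
    push Not at hc
    nlinarith [mul_pos (sub_pos.2 hc) (sub_pos.2 hξ.1)]
  have hP1 : ∀ ξ ∈ Ioo x0 x1, p ξ ≤ P1 := by
    intro ξ hξ
    have h1 := s1 ξ hξ; have h2 := t1 ξ hξ
    by_contra hc
    push Not at hc
    nlinarith [mul_pos (sub_pos.2 hc) (sub_pos.2 hξ.2)]
  set φ : ℝ → ℝ := fun ξ => (α^2 * (x1 - ξ) + β^2 * (ξ - x0)) / (x1 - x0) with hφ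
  set Ψ : ℝ → ℝ := fun ξ => (α^2 * ((x1 - ξ) * p ξ + g ξ) + β^2 * ((ξ - x0) * p ξ - g ξ)) / (x1 - x0) with hΨ
  set lo : ℝ := (α^2 * (P0 * (x1 - x0) + y0) + β^2 * (-y0)) / (x1 - x0) with hlo
  set hi : ℝ := (α^2 * y1 + β^2 * (P1 * (x1 - x0) - y1)) / (x1 - x0) with hhi
  have hα2 : 0 < α^2 := by positivity
  have hβ2 : 0 < β^2 := by positivity
  have blo : ∀ ξ ∈ Ioo x0 x1, lo ≤ Ψ ξ := by
    intro ξ hξ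
    rw [hlo, hΨ]
    have h1 := s0 ξ hξ; have h2 := t0 ξ hξ; have h3 := hP0 ξ hξ
    have h4 : 0 ≤ (x1 - ξ) * (p ξ - P0) := mul_nonneg (by linarith [hξ.2]) (by linarith)
    have e1 : P0*(x1-x0)+y0 ≤ (x1-ξ)*p ξ + g ξ := by linarith
    have e2 : -y0 ≤ (ξ-x0)*p ξ - g ξ := by linarith
    exact div_le_div_of_nonneg_right (add_le_add (mul_le_mul_of_nonneg_left e1 hα2.le) (mul_le_mul_of_nonneg_left e2 hβ2.le)) hl.le
  have bhi : ∀ ξ ∈ Ioo x0 x1, Ψ ξ ≤ hi := by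
    intro ξ hξ
    rw [hhi, hΨ]
    have h1 := s1 ξ hξ; have h2 := t1 ξ hξ; have h3 := hP1 ξ hξ
    have h4 : 0 ≤ (ξ - x0) * (P1 - p ξ) := mul_nonneg (by linarith [hξ.1]) (by linarith)
    have e1 : (x1-ξ)*p ξ + g ξ ≤ y1 := by linarith
    have e2 : (ξ-x0)*p ξ - g ξ ≤ P1*(x1-x0) - y1 := by linarith
    exact div_le_div_of_nonneg_right (add_le_add (mul_le_mul_of_nonneg_left e1 hα2.le) (mul_le_mul_of_nonneg_left e2 hβ2.le)) hl.le
  have bmono : MonotoneOn Ψ (Ioo x0 x1) := by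
    intro ξ hξ η hη hle
    have h1 := h ξ (hsub hξ) η (hsub hη)
    have h2 := h η (hsub hη) ξ (hsub hξ)
    have h3 := h.mono (hsub hξ) (hsub hη) hle
    have h4 : 0 ≤ (x1 - η) * (p η - p ξ) := mul_nonneg (by linarith [hη.2]) (by linarith)
    have h5 : 0 ≤ (ξ - x0) * (p η - p ξ) := mul_nonneg (by linarith [hξ.1]) (by linarith)
    simp only [hΨ]
    gcongr ?_ / _
    have e1 : (x1 - ξ) * p ξ + g ξ ≤ (x1 - η) * p η + g η := by linarith
    have e2 : (ξ - x0) * p ξ - g ξ ≤ (η - x0) * p η - g η := by linarith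
    gcongr
  set Φ : ℝ → ℝ := fun ξ => if ξ ≤ x0 then lo else if x1 ≤ ξ then hi else Ψ ξ with hΦ
  have hlohi : lo ≤ hi := by
    have hm : (x0 + x1)/2 ∈ Ioo x0 x1 := ⟨by linarith, by linarith⟩
    exact (blo _ hm).trans (bhi _ hm)
  have hΦmono : MonotoneOn Φ (uIcc x0 x1) := by
    intro ξ _ η _ hle
    simp only [hΦ]
    split_ifs with c1 c2 c3 c4 c5 c6 <;> try linarith
    · exact blo _ ⟨by linarith, by linarith⟩
    · exact bhi _ ⟨by linarith, by linarith⟩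
    · exact bmono ⟨by linarith, by linarith⟩ ⟨by linarith, by linarith⟩ hle
  have hnonem := hΦmono.intervalIntegrable_deriv
  have hval := hΦmono.intervalIntegral_deriv_mem_uIcc
  have hΦ0 : Φ x0 = lo := by simp [hΦ]
  have hΦ1 : Φ x1 = hi := by simp [hΦ, hx]
  rw [hΦ0, hΦ1, uIcc_of_le (by linarith)] at hval
  obtain ⟨hi2, hv2⟩ := int_inv_sqrt hx hα hβ
  have hpmono : MonotoneOn p (Ioo x0 x1) := h.mono.mono hsub
  have hae : ∀ᵐ ξ ∂(volume.restrict (Ioo x0 x1)), 0 ≤ deriv p ξ ∧ deriv Φ ξ = φ ξ * deriv p ξ ∧ 0 < φ ξ := by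
    filter_upwards [hpmono.ae_differentiableWithinAt measurableSet_Ioo, ae_restrict_mem measurableSet_Ioo] with ξ hξ hξI
    have hd : DifferentiableAt ℝ p ξ := hξ.differentiableAt (isOpen_Ioo.mem_nhds hξI)
    refine ⟨?_, ?_, ?_⟩
    · rw [← derivWithin_of_isOpen isOpen_Ioo hξI]
      exact hpmono.derivWithin_nonneg
    · have e : Φ =ᶠ[nhds ξ] Ψ := by
        filter_upwards [isOpen_Ioo.mem_nhds hξI] with η hη
        simp [hΦ, not_le.2 hη.1, not_le.2 hη.2]
      rw [e.deriv_eq]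
      have hpd := hd.hasDerivAt
      have hgd := h.hasDeriv (hsub hξI) hpd
      have h1 := ((((((hasDerivAt_id ξ).const_sub x1).mul hpd).add hgd).const_mul (α^2)).add (((((hasDerivAt_id ξ).sub_const x0).mul hpd).sub hgd).const_mul (β^2))).div_const (x1 - x0)
      have h2 := h1.deriv
      have h3 : deriv Ψ ξ = _ := h2
      rw [h3, hφ]; simp only [id]; ring
    · apply div_pos _ hl
      have e1 : 0 < x1 - ξ := by linarith [hξI.2]
      have e2 : 0 < ξ - x0 := by linarith [hξI.1]
      positivity
  rw [intervalIntegrable_iff_integrableOn_Ioo_of_le hx.le] at hnonem hi2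
  calc ∫⁻ ξ in Ioo x0 x1, ENNReal.ofReal ((deriv p ξ)^((1:ℝ)/3))
      ≤ ∫⁻ ξ in Ioo x0 x1, ENNReal.ofReal (1/3 * deriv Φ ξ + 2/3 * (1 / Real.sqrt (φ ξ))) := by
        apply lintegral_mono_ae
        filter_upwards [hae] with ξ hξ
        apply ENNReal.ofReal_le_ofReal
        rw [hξ.2.1]
        exact young_third hξ.1 hξ.2.2
    _ = ENNReal.ofReal (∫ ξ in Ioo x0 x1, (1/3 * deriv Φ ξ + 2/3 * (1 / Real.sqrt (φ ξ)))) := by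
        rw [ofReal_integral_eq_lintegral_ofReal]
        · exact (hnonem.const_mul _).add (hi2.const_mul _)
        · filter_upwards [hae] with ξ hξ
          simp only [Pi.zero_apply]
          rw [hξ.2.1]
          have := hξ.1; have := hξ.2.2
          positivity
    _ ≤ _ := by
        apply ENNReal.ofReal_le_ofReal
        rw [integral_add (hnonem.const_mul _) (hi2.const_mul _), integral_const_mul, integral_const_mul]
        rw [intervalIntegral.integral_of_le hx.le, integral_Ioc_eq_integral_Ioo] at hval hv2
        rw [hv2]
        have hd : hi - lo ≤ α^2 * A + β^2 * B := by
          rw [hhi, hlo, ← sub_div, div_le_iff₀ hl]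
          nlinarith [mul_le_mul_of_nonneg_left hA hα2.le, mul_le_mul_of_nonneg_left hB hβ2.le]
        have e : 2 * (x1 - x0)/(α+β) = 2 * ((x1 - x0)/(α+β)) := by ring
        rw [e]
        linarith [hval.2]

lemma pair_pos {a b : ℝ} {g p : ℝ → ℝ} (h : SubG a b g p) {x0 x1 y0 y1 P0 P1 : ℝ} (hx : x0 < x1) (hsub : Ioo x0 x1 ⊆ Ioo a b)
    (s0 : ∀ ξ ∈ Ioo x0 x1, y0 + P0 * (ξ - x0) ≤ g ξ) (s1 : ∀ ξ ∈ Ioo x0 x1, y1 + P1 * (ξ - x1) ≤ g ξ)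
    (t0 : ∀ ξ ∈ Ioo x0 x1, g ξ + p ξ * (x0 - ξ) ≤ y0) (t1 : ∀ ξ ∈ Ioo x0 x1, g ξ + p ξ * (x1 - ξ) ≤ y1)
    {A B : ℝ} (hA : y1 - y0 - P0 * (x1 - x0) ≤ A * (x1 - x0)) (hB : P1 * (x1 - x0) - (y1 - y0) ≤ B * (x1 - x0)) (hA0 : 0 < A) (hB0 : 0 < B) :
    ∫⁻ ξ in Ioo x0 x1, ENNReal.ofReal ((deriv p ξ)^((1:ℝ)/3)) ≤ ENNReal.ofReal (2 * ((x1 - x0)^2 * A * B / (A + B) / 2)^((1:ℝ)/3)) := by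
  have hl : 0 < x1 - x0 := sub_pos.2 hx
  set l := x1 - x0 with hldef
  set κ := (2 * l / (A * B * (A+B)^2))^((1:ℝ)/3) with hκ
  have hκ0 : 0 < κ := by positivity
  have hκ3 : κ^3 = 2 * l / (A * B * (A+B)^2) := rpow_third_cube (by positivity)
  refine (pair_young h hx hsub s0 s1 t0 t1 hA hB (α := κ * B) (β := κ * A) (by positivity) (by positivity)).trans ?_
  apply ENNReal.ofReal_le_ofReal
  have hl2 : l = κ^3 * (A * B * (A+B)^2) / 2 := by rw [hκ3]; field_simp
  have e : 1/3 * ((κ * B)^2 * A + (κ * A)^2 * B) + 4/3 * (l/(κ * B + κ * A)) = κ^2 * (A * B * (A+B)) := by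
    rw [hl2]; field_simp; ring
  rw [← hldef, e]
  refine le_of_pow_le_pow_left₀ (n := 3) (by norm_num) (by positivity) (le_of_eq ?_)
  rw [mul_pow, mul_pow, mul_pow 2, rpow_third_cube (by positivity), show (κ^2)^3 = (κ^3)^2 by ring, hκ3]
  field_simp

lemma pair_main {a b : ℝ} {g p : ℝ → ℝ} (h : SubG a b g p) {x0 x1 y0 y1 P0 P1 : ℝ} (hx : x0 < x1) (hsub : Ioo x0 x1 ⊆ Ioo a b)
    (s0 : ∀ ξ ∈ Ioo x0 x1, y0 + P0 * (ξ - x0) ≤ g ξ) (s1 : ∀ ξ ∈ Ioo x0 x1, y1 + P1 * (ξ - x1) ≤ g ξ)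
    (t0 : ∀ ξ ∈ Ioo x0 x1, g ξ + p ξ * (x0 - ξ) ≤ y0) (t1 : ∀ ξ ∈ Ioo x0 x1, g ξ + p ξ * (x1 - ξ) ≤ y1)
    (hP : P0 < P1) (hA0 : 0 ≤ y1 - y0 - P0 * (x1 - x0)) (hB0 : 0 ≤ P1 * (x1 - x0) - (y1 - y0)) :
    ∫⁻ ξ in Ioo x0 x1, ENNReal.ofReal ((deriv p ξ)^((1:ℝ)/3)) ≤
      ENNReal.ofReal (2 * ((y1 - y0 - P0 * (x1 - x0)) * (P1 * (x1 - x0) - (y1 - y0)) / (P1 - P0) / 2)^((1:ℝ)/3)) := by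
  have hl : 0 < x1 - x0 := sub_pos.2 hx
  set A := (y1 - y0 - P0 * (x1 - x0))/(x1 - x0) with hA
  set B := (P1 * (x1 - x0) - (y1 - y0))/(x1 - x0) with hB
  have hA1 : 0 ≤ A := div_nonneg hA0 hl.le
  have hB1 : 0 ≤ B := div_nonneg hB0 hl.le
  have hAl : A * (x1 - x0) = y1 - y0 - P0 * (x1 - x0) := div_mul_cancel₀ _ hl.ne'
  have hBl : B * (x1 - x0) = P1 * (x1 - x0) - (y1 - y0) := div_mul_cancel₀ _ hl.ne'
  have hAB : A + B = P1 - P0 := by rw [hA, hB]; field_simp; ring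
  have hlim : Tendsto (fun η : ℝ => ENNReal.ofReal (2 * ((x1 - x0)^2 * (A+η) * (B+η) / ((A+η) + (B+η)) / 2)^((1:ℝ)/3))) (nhdsWithin 0 (Ioi 0))
      (nhds (ENNReal.ofReal (2 * ((x1 - x0)^2 * (A+0) * (B+0) / ((A+0) + (B+0)) / 2)^((1:ℝ)/3)))) := by
    apply Tendsto.mono_left _ nhdsWithin_le_nhds
    apply ContinuousAt.tendsto
    apply ENNReal.continuous_ofReal.continuousAt.comp
    apply ContinuousAt.mul continuousAt_const
    apply ContinuousAt.rpow_const
    · apply ContinuousAt.div_const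
      apply ContinuousAt.div (by fun_prop) (by fun_prop)
      simp only [add_zero]; rw [hAB]; linarith
    · right; norm_num
  have := ge_of_tendsto hlim (b := ∫⁻ ξ in Ioo x0 x1, ENNReal.ofReal ((deriv p ξ)^((1:ℝ)/3))) (by
    filter_upwards [self_mem_nhdsWithin] with η hη
    have hη' : 0 < η := hη
    exact pair_pos h hx hsub s0 s1 t0 t1 (by rw [← hAl]; gcongr; linarith) (by rw [← hBl]; gcongr; linarith) (by linarith) (by linarith))
  refine this.trans (le_of_eq ?_)
  rw [add_zero, add_zero, ← hAl, ← hBl, hAB]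
  congr 5
  ring

end partF6

section partF6b

lemma Body.above {S : Set P2} {a b : ℝ} {g h p : ℝ → ℝ} (B : Body S a b g h) (hconv : Convex ℝ S) (hp : SubG a b g p) {z : P2} (hz : z ∈ S)
    {ξ : ℝ} (hξ : ξ ∈ Ioo a b) : g ξ + p ξ * (z.1 - ξ) ≤ z.2 := by
  have h1 : (ξ, g ξ) ∈ S := (B.mem ξ hξ _).2 ⟨le_rfl, (B.lt ξ hξ).le⟩
  have h2 := hconv hz h1 (a := 1/2) (b := 1/2) (by norm_num) (by norm_num) (by norm_num)
  have h3 := B.out z hz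
  have e : (1/2:ℝ) • z + (1/2:ℝ) • ((ξ, g ξ) : P2) = ((z.1 + ξ)/2, (z.2 + g ξ)/2) := by
    ext
    · simp; ring
    · simp; ring
  rw [e] at h2
  have hm : (z.1 + ξ)/2 ∈ Ioo a b := ⟨by linarith [h3.1, hξ.1], by linarith [h3.2, hξ.2]⟩
  have h4 := ((B.mem _ hm _).1 h2).1
  have h5 := hp ξ hξ _ hm
  linarith

lemma Body.pair {S : Set P2} {a b : ℝ} {g h p : ℝ → ℝ} (B : Body S a b g h) (hconv : Convex ℝ S) (hp : SubG a b g p)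
    {u u' z z' : P2} (hu : u.2 < 0) (hu' : u'.2 < 0) (hd : 0 < det2 u u') (hz : z ∈ S) (hz' : z' ∈ S)
    (hm : ∀ w ∈ S, dot2 u w ≤ dot2 u z) (hm' : ∀ w ∈ S, dot2 u' w ≤ dot2 u' z') :
    ∫⁻ ξ in Ioo z.1 z'.1, ENNReal.ofReal ((deriv p ξ)^((1:ℝ)/3)) ≤
      ENNReal.ofReal (2 * (dot2 u (z - z') * dot2 u' (z' - z) / det2 u u' / 2)^((1:ℝ)/3)) := by
  rcases le_or_gt z'.1 z.1 with hx | hx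
  · rw [Ioo_eq_empty (by linarith)]; simp
  have hsub : Ioo z.1 z'.1 ⊆ Ioo a b := Ioo_subset_Ioo (B.out z hz).1 (B.out z' hz').2
  obtain ⟨U, hU⟩ : ∃ U, U = -u.2 := ⟨_, rfl⟩
  obtain ⟨U', hU'⟩ : ∃ U, U = -u'.2 := ⟨_, rfl⟩
  obtain ⟨P, hP⟩ : ∃ P, P = u.1 / U := ⟨_, rfl⟩
  obtain ⟨P', hP'⟩ : ∃ P, P = u'.1 / U' := ⟨_, rfl⟩
  have hU0 : 0 < U := by linarith
  have hU0' : 0 < U' := by linarith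
  have e1 : u.1 = P * U := by rw [hP]; field_simp
  have e1' : u'.1 = P' * U' := by rw [hP']; field_simp
  have e2 : u.2 = -U := by linarith
  have e2' : u'.2 = -U' := by linarith
  have hdot : ∀ w, dot2 u w = U * (P * w.1 - w.2) := fun w => by simp only [dot2, e1, e2]; ring
  have hdot' : ∀ w, dot2 u' w = U' * (P' * w.1 - w.2) := fun w => by simp only [dot2, e1', e2']; ring
  have hdet : det2 u u' = U * U' * (P' - P) := by simp only [det2, e1, e2, e1', e2']; ring
  have hPP : P < P' := by
    rw [hdet] at hd
    have := (mul_pos_iff_of_pos_left (by positivity)).1 hd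
    linarith
  have m1 : ∀ w ∈ S, P * w.1 - w.2 ≤ P * z.1 - z.2 := fun w hw => by
    have := hm w hw
    rw [hdot, hdot] at this
    exact le_of_mul_le_mul_left this hU0
  have m2 : ∀ w ∈ S, P' * w.1 - w.2 ≤ P' * z'.1 - z'.2 := fun w hw => by
    have := hm' w hw
    rw [hdot', hdot'] at this
    exact le_of_mul_le_mul_left this hU0'
  have hmem : ∀ ξ ∈ Ioo z.1 z'.1, (ξ, g ξ) ∈ S := fun ξ hξ => (B.mem ξ (hsub hξ) _).2 ⟨le_rfl, (B.lt ξ (hsub hξ)).le⟩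
  have := pair_main hp hx hsub (y0 := z.2) (y1 := z'.2) (P0 := P) (P1 := P')
    (fun ξ hξ => by have := m1 _ (hmem ξ hξ); dsimp only at this; linarith)
    (fun ξ hξ => by have := m2 _ (hmem ξ hξ); dsimp only at this; linarith)
    (fun ξ hξ => B.above hconv hp hz (hsub hξ)) (fun ξ hξ => B.above hconv hp hz' (hsub hξ)) hPP
    (by have := m1 _ hz'; linarith) (by have := m2 _ hz; linarith)
  refine this.trans (le_of_eq ?_)
  congr 4
  rw [dot2_sub, dot2_sub, hdot, hdot, hdot', hdot', hdet]
  have : P' - P ≠ 0 := by linarith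
  field_simp
  ring

lemma chain_int (x : ℕ → ℝ) (f : ℝ → ENNReal) (n : ℕ) :
    ∫⁻ ξ in Ioo (x 0) (x n), f ξ ≤ ∑ r ∈ Finset.range n, ∫⁻ ξ in Ioo (x r) (x (r+1)), f ξ := by
  induction n with
  | zero => simp
  | succ n ih =>
    rw [Finset.sum_range_succ]
    have hsub : Ioo (x 0) (x (n+1)) ⊆ (Ioo (x 0) (x n) ∪ Ioo (x n) (x (n+1))) ∪ {x n} := by
      intro ξ hξ
      rcases lt_trichotomy ξ (x n) with h | h | h
      · left; left; exact ⟨hξ.1, h⟩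
      · right; exact h
      · left; right; exact ⟨h, hξ.2⟩
    calc _ ≤ ∫⁻ ξ in (Ioo (x 0) (x n) ∪ Ioo (x n) (x (n+1))) ∪ {x n}, f ξ := lintegral_mono_set hsub
      _ ≤ _ := lintegral_union_le _ _ _
      _ ≤ (∫⁻ ξ in Ioo (x 0) (x n), f ξ) + (∫⁻ ξ in Ioo (x n) (x (n+1)), f ξ) + 0 := by
          refine add_le_add (lintegral_union_le _ _ _) (le_of_eq ?_)
          rw [Measure.restrict_singleton]; simp
      _ ≤ _ := by rw [add_zero]; gcongr

lemma aff_le {S : Set P2} {a b : ℝ} {g h : ℝ → ℝ} (B : Body S a b g h) (hconv : Convex ℝ S) {M : ℝ} (hM : ∀ z ∈ S, |z.2| ≤ M)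
    (hfin : aff a b g ≠ ⊤) {η : ENNReal} (hη : η ≠ 0) : ∃ τ : ℝ, 0 < τ ∧ ∀ k : ℕ, 2 ≤ k → Real.tan (Real.pi / (2 * k)) ≤ τ →
    ∀ c : ℕ → P2, (∀ r, c r ∈ S) → (∀ r : ℕ, ∀ z ∈ S, dot2 (-(uz (2*k) r)) z ≤ dot2 (-(uz (2*k) r)) (c r)) →
    aff a b g ≤ ∑ r ∈ Finset.range (k-1), ENNReal.ofReal (2 * (dot2 (-(uz (2*k) r)) (c r - c (r+1)) * dot2 (-(uz (2*k) (r+1:ℕ))) (c (r+1) - c r)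
      / det2 (uz (2*k) r) (uz (2*k) (r+1:ℕ)) / 2)^((1:ℝ)/3)) + η := by
  obtain ⟨δ, hδ, hnonem⟩ := exists_pos_setLIntegral_lt_of_measure_lt hfin hη
  have hm0 : (a+b)/2 ∈ Ioo a b := ⟨by linarith [B.hab], by linarith [B.hab]⟩
  have hM0 : 0 ≤ M := (abs_nonneg _).trans (hM _ ((B.mem _ hm0 _).2 ⟨le_rfl, (B.lt _ hm0).le⟩))
  -- choose τ
  obtain ⟨δ', hδ'0, hδ'⟩ : ∃ δ' : ℝ, 0 < δ' ∧ ENNReal.ofReal δ' < δ := by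
    obtain ⟨e, he1, he2⟩ := exists_between hδ
    have het : e ≠ ⊤ := (he2.trans_le le_top).ne
    exact ⟨e.toReal, ENNReal.toReal_pos he1.ne' het, by rwa [ENNReal.ofReal_toReal het]⟩
  refine ⟨δ' / (4 * M + 1), by positivity, ?_⟩
  intro k hk htan c hc hmax
  have hk0 : (2:ℝ) ≤ k := by exact_mod_cast hk
  have hpi := Real.pi_pos
  have hth : thm (2*k) = Real.pi / k := by unfold thm; push_cast; field_simp
  have hang : ∀ r : ℕ, r < k → 0 < Real.sin ((((r:ℕ):ℤ) + 1/2) * thm (2*k)) := by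
    intro r hr
    have : (r:ℝ) + 1 ≤ k := by exact_mod_cast hr
    rw [hth]; push_cast
    apply Real.sin_pos_of_pos_of_lt_pi
    · positivity
    · rw [← mul_div_assoc, div_lt_iff₀ (by linarith), mul_comm Real.pi]
      exact mul_lt_mul_of_pos_right (by linarith) hpi
  have hneg : ∀ r : ℕ, r < k → (-(uz (2*k) r)).2 < 0 := by
    intro r hr
    have := hang r hr
    simp only [uz, Prod.snd_neg]
    linarith
  have hdet : ∀ r : ℕ, 0 < det2 (-(uz (2*k) r)) (-(uz (2*k) (r+1:ℕ))) ∧ det2 (-(uz (2*k) r)) (-(uz (2*k) (r+1:ℕ))) = det2 (uz (2*k) r) (uz (2*k) (r+1:ℕ)) := by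
    intro r
    have e : det2 (-(uz (2*k) r)) (-(uz (2*k) (r+1:ℕ))) = det2 (uz (2*k) r) (uz (2*k) (r+1:ℕ)) := by
      simp [det2]
    refine ⟨?_, e⟩
    rw [e, det_uz, hth]
    push_cast
    rw [show ((r:ℝ) + 1 - r) * (Real.pi/k) = Real.pi / k by ring]
    apply Real.sin_pos_of_pos_of_lt_pi
    · positivity
    · rw [div_lt_iff₀ (by linarith)]; nlinarith
  have hp := SubG_of_convex B.cg
  have hch := chain_int (fun r => (c r).1) (fun ξ => ENNReal.ofReal ((deriv (rdv g) ξ)^((1:ℝ)/3))) (k-1)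
  have hsum : ∑ r ∈ Finset.range (k-1), ∫⁻ ξ in Ioo (c r).1 (c (r+1)).1, ENNReal.ofReal ((deriv (rdv g) ξ)^((1:ℝ)/3)) ≤ 
    ∑ r ∈ Finset.range (k-1), ENNReal.ofReal (2 * (dot2 (-(uz (2*k) r)) (c r - c (r+1)) * dot2 (-(uz (2*k) (r+1:ℕ))) (c (r+1) - c r)
      / det2 (uz (2*k) r) (uz (2*k) (r+1:ℕ)) / 2)^((1:ℝ)/3)) := by
    apply Finset.sum_le_sum
    intro r hr
    have hr' : r < k - 1 := Finset.mem_range.1 hr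
    rw [← (hdet r).2]
    exact B.pair hconv hp (hneg r (by omega)) (hneg (r+1) (by omega)) (hdet r).1 (hc _) (hc _) (hmax r) (hmax (r+1))
  -- end pieces
  set θ := Real.pi / (2*k) with hθ
  have hθ0 : 0 < θ := by positivity
  have hθ1 : θ < Real.pi / 2 := by
    rw [hθ]; apply div_lt_div_of_pos_left hpi (by norm_num); linarith
  have hcos : 0 < Real.cos θ := Real.cos_pos_of_mem_Ioo ⟨by linarith, hθ1⟩
  have hsin : 0 < Real.sin θ := Real.sin_pos_of_pos_of_lt_pi hθ0 (by linarith)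
  have hu0 : uz (2*k) (0:ℕ) = (Real.cos θ, Real.sin θ) := by
    unfold uz; rw [hth]; push_cast
    rw [show ((0:ℝ) + 1/2) * (Real.pi/k) = θ by rw [hθ]; field_simp; ring]
  have hul : uz (2*k) (k-1:ℕ) = (-Real.cos θ, Real.sin θ) := by
    unfold uz; rw [hth]; push_cast [Nat.cast_sub (show 1 ≤ k by omega)]
    rw [show ((k:ℝ) - 1 + 1/2) * (Real.pi/k) = Real.pi - θ by rw [hθ]; field_simp; ring, Real.cos_pi_sub, Real.sin_pi_sub]
  set τ := Real.tan θ * (2 * M) with hτ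
  have htc : Real.tan θ * Real.cos θ = Real.sin θ := Real.tan_mul_cos hcos.ne'
  have hleft : ∀ ξ ∈ Ioo a b, (c 0).1 - ξ ≤ τ := by
    intro ξ hξ
    have hS : (ξ, g ξ) ∈ S := (B.mem ξ hξ _).2 ⟨le_rfl, (B.lt ξ hξ).le⟩
    have h1 := hmax 0 _ hS
    rw [hu0] at h1
    simp only [dot2, Prod.fst_neg, Prod.snd_neg] at h1
    have h2 := abs_le.1 (hM _ hS); have h3 := abs_le.1 (hM _ (hc 0))
    dsimp only at h2
    refine le_of_mul_le_mul_right ?_ hcos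
    rw [hτ, mul_right_comm, htc]
    nlinarith
  have hright : ∀ ξ ∈ Ioo a b, ξ - (c (k-1)).1 ≤ τ := by
    intro ξ hξ
    have hS : (ξ, g ξ) ∈ S := (B.mem ξ hξ _).2 ⟨le_rfl, (B.lt ξ hξ).le⟩
    have h1 := hmax (k-1) _ hS
    rw [hul] at h1
    simp only [dot2, Prod.fst_neg, Prod.snd_neg] at h1
    have h2 := abs_le.1 (hM _ hS); have h3 := abs_le.1 (hM _ (hc (k-1)))
    dsimp only at h2
    refine le_of_mul_le_mul_right ?_ hcos
    rw [hτ, mul_right_comm, htc]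
    nlinarith
  have htan0 : 0 ≤ Real.tan θ := (Real.tan_pos_of_pos_of_lt_pi_div_two hθ0 hθ1).le
  have hτ0 : 0 ≤ τ := by positivity
  have hτ2 : 2 * τ ≤ δ' := by
    rw [le_div_iff₀ (by positivity)] at htan
    rw [hτ]; nlinarith
  set A : Set ℝ := Icc ((c 0).1 - τ) (c 0).1 ∪ Icc (c (k-1)).1 ((c (k-1)).1 + τ) with hA
  have hAm : (volume.restrict (Ioo a b)) A < δ := by
    refine (Measure.restrict_apply_le _ _).trans_lt ((measure_union_le _ _).trans_lt ?_)
    rw [Real.volume_Icc, Real.volume_Icc, ← ENNReal.ofReal_add (by linarith) (by linarith)]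
    refine lt_of_le_of_lt (ENNReal.ofReal_le_ofReal ?_) hδ'
    linarith
  have hA2 := hnonem A hAm
  have hcov : Ioo a b ⊆ Ioo (c 0).1 (c (k-1)).1 ∪ (A ∩ Ioo a b) := by
    intro ξ hξ
    have h1 := hleft ξ hξ; have h2 := hright ξ hξ
    by_cases h3 : ξ ≤ (c 0).1
    · right; exact ⟨Or.inl ⟨by linarith, h3⟩, hξ⟩
    · by_cases h4 : (c (k-1)).1 ≤ ξ
      · right; exact ⟨Or.inr ⟨h4, by linarith⟩, hξ⟩
      · left; exact ⟨by linarith, by linarith⟩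
  have hAmeas : MeasurableSet A := measurableSet_Icc.union measurableSet_Icc
  rw [Measure.restrict_restrict hAmeas] at hA2
  unfold aff
  refine (lintegral_mono_set hcov).trans ((lintegral_union_le _ _ _).trans ?_)
  exact add_le_add (hch.trans hsum) hA2.le

lemma uz_half (k : ℕ) (hk : 0 < k) (j : ℤ) : uz (2*k) (j + k) = -(uz (2*k) j) := by
  have hk0 : (0:ℝ) < k := by exact_mod_cast hk
  have hth : thm (2*k) = Real.pi / k := by unfold thm; push_cast; field_simp
  unfold uz
  rw [show (((j + k : ℤ) : ℝ) + 1/2) * thm (2*k) = (j + 1/2) * thm (2*k) + Real.pi by rw [hth]; push_cast; field_simp; ring]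
  rw [Real.cos_add_pi, Real.sin_add_pi]; rfl

/-- affine length is at most the sum of lengths of circumscribed parabola arcs -/
lemma aff_le_tl {S : Set P2} {a b : ℝ} {g h : ℝ → ℝ} (B : Body S a b g h) (hc : IsCompact S) (hconv : Convex ℝ S)
    {η : ℝ} (hη : 0 < η) : ∃ k0 : ℕ, ∀ k : ℕ, k0 ≤ k → ∀ [NeZero (2*k)] (h4 : 4 ≤ 2*k), ∃ c : Fin (2*k) → P2, (∀ i, c i ∈ S) ∧ SupC (DZ (2*k) h4) c ∧
    aff a b g + aff (-b) (-a) (fun x => -h (-x)) ≤ ENNReal.ofReal (2 * ∑ i, tl (DZ (2*k) h4) c i + η) := by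
  have hfin := (wet_lim B hc.isClosed).1
  obtain ⟨M, hM⟩ := hc.isBounded.exists_norm_le
  have hM2 : ∀ z ∈ S, |z.2| ≤ M := fun z hz => by
    have := hM z hz
    rw [Prod.norm_def] at this
    exact (le_max_right _ _).trans this
  have hM2' : ∀ z ∈ -S, |z.2| ≤ M := fun z hz => by
    have := hM2 _ hz
    rwa [Prod.snd_neg, abs_neg] at this
  have hη2 : ENNReal.ofReal (η/2) ≠ 0 := by simpa using hη
  obtain ⟨τ1, hτ1, H1⟩ := aff_le B hconv hM2 (fun h => hfin (by simp [h])) hη2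
  obtain ⟨τ2, hτ2, H2⟩ := aff_le B.neg hconv.neg hM2' (fun h => hfin (by simp [h])) hη2
  have htend : Tendsto (fun k : ℕ => Real.tan (Real.pi / (2 * k))) atTop (nhds 0) := by
    have h1 : Tendsto (fun k : ℕ => Real.pi / (2 * k)) atTop (nhds 0) := by
      have := tendsto_const_div_atTop_nhds_zero_nat (Real.pi/2)
      refine this.congr (fun k => by rw [div_div])
    have h2 : ContinuousAt Real.tan 0 := Real.continuousAt_tan.2 (by simp)
    have h3 := h2.tendsto
    rw [Real.tan_zero] at h3
    exact h3.comp h1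
  obtain ⟨k1, hk1⟩ := eventually_atTop.1 (htend.eventually (gt_mem_nhds (lt_min hτ1 hτ2)))
  refine ⟨k1, ?_⟩
  intro k hk _ h4
  have hk2 : 2 ≤ k := by omega
  have hne : S.Nonempty := by
    have hm0 : (a+b)/2 ∈ Ioo a b := ⟨by linarith [B.hab], by linarith [B.hab]⟩
    exact ⟨_, (B.mem _ hm0 _).2 ⟨le_rfl, (B.lt _ hm0).le⟩⟩
  have hex : ∀ j : ℕ, ∃ z ∈ S, ∀ w ∈ S, dot2 (uz (2*k) j) w ≤ dot2 (uz (2*k) j) z := by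
    intro j
    obtain ⟨z, hz, hmx⟩ := hc.exists_isMaxOn hne (f := fun w => dot2 (uz (2*k) j) w) (by
      apply Continuous.continuousOn; unfold dot2; fun_prop)
    exact ⟨z, hz, fun w hw => hmx hw⟩
  choose f hfS hfm using hex
  have ht := hk1 k hk
  have B1 := H1 k hk2 (ht.le.trans (min_le_left _ _)) (fun r => f (r + k)) (fun r => hfS _) (by
    intro r z hz
    rw [← uz_half k (by omega)]
    have := hfm (r+k) z hz
    push_cast at this
    exact this)
  have B2 := H2 k hk2 (ht.le.trans (min_le_right _ _)) (fun r => - f r) (fun r => by simpa using hfS r) (by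
    intro r z hz
    have := hfm r (-z) hz
    simp only [dot2, Prod.fst_neg, Prod.snd_neg] at this ⊢
    linarith)
  set D := DZ (2*k) h4
  have hsup : SupC D (fun i => f i.val) := fun i j => hfm _ _ (hfS _)
  refine ⟨fun i => f i.val, fun i => hfS _, hsup, ?_⟩
  set T : ℕ → ℝ := fun j => (dot2 (uz (2*k) j) (f j - f (j+1)) * dot2 (uz (2*k) (j+1:ℕ)) (f (j+1) - f j)
      / det2 (uz (2*k) j) (uz (2*k) (j+1:ℕ)) / 2)^((1:ℝ)/3) with hT
  have hTtl : ∀ (j : ℕ) (hj : j + 1 < 2*k), T j = tl D (fun i => f i.val) ⟨j, by omega⟩ := by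
    intro j hj
    simp only [hT, tl, dl]
    have e : D.nxt ⟨j, by omega⟩ = ⟨j+1, hj⟩ := by
      simp only [D, DZ, fnx, Fin.mk.injEq]
      exact Nat.mod_eq_of_lt hj
    rw [e]; rfl
  have hT0 : ∀ (j : ℕ) (hj : j + 1 < 2*k), 0 ≤ T j := fun j hj => by rw [hTtl j hj]; exact tl_nonneg D hsup _
  have e1 : ∀ r : ℕ, (dot2 (-(uz (2*k) r)) (f (r+k) - f (r+1+k)) * dot2 (-(uz (2*k) (r+1:ℕ))) (f (r+1+k) - f (r+k))
      / det2 (uz (2*k) r) (uz (2*k) (r+1:ℕ)) / 2)^((1:ℝ)/3) = T (r+k) := by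
    intro r
    simp only [hT]
    have q1 : uz (2*k) ((r+k:ℕ):ℤ) = -(uz (2*k) r) := by push_cast; exact uz_half k (by omega) r
    have q2 : uz (2*k) ((r+k+1:ℕ):ℤ) = -(uz (2*k) (r+1:ℕ)) := by rw [← uz_half k (by omega)]; push_cast; ring_nf
    have q3 : ∀ u v : P2, det2 (-u) (-v) = det2 u v := fun u v => by simp [det2]
    rw [q1, q2, q3, show r + 1 + k = r + k + 1 by ring]
  have e2 : ∀ r : ℕ, (dot2 (-(uz (2*k) r)) (-f r - -f (r+1)) * dot2 (-(uz (2*k) (r+1:ℕ))) (-f (r+1) - -f r)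
      / det2 (uz (2*k) r) (uz (2*k) (r+1:ℕ)) / 2)^((1:ℝ)/3) = T r := by
    intro r
    simp only [hT]
    have q : ∀ u v w : P2, dot2 (-u) (-v - -w) = dot2 u (v - w) := fun u v w => by simp [dot2]; ring
    rw [q, q]
  simp only [e1] at B1
  simp only [e2] at B2
  rw [← ENNReal.ofReal_sum_of_nonneg (fun r hr => by have := Finset.mem_range.1 hr; have := hT0 (r+k) (by omega); positivity),
    ← ENNReal.ofReal_add (Finset.sum_nonneg (fun r hr => by have := Finset.mem_range.1 hr; have := hT0 (r+k) (by omega); positivity)) (by linarith)] at B1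
  rw [← ENNReal.ofReal_sum_of_nonneg (fun r hr => by have := Finset.mem_range.1 hr; have := hT0 r (by omega); positivity),
    ← ENNReal.ofReal_add (Finset.sum_nonneg (fun r hr => by have := Finset.mem_range.1 hr; have := hT0 r (by omega); positivity)) (by linarith)] at B2
  refine (add_le_add B1 B2).trans ?_
  have n1 : 0 ≤ ∑ r ∈ Finset.range (k-1), 2 * T (r+k) := Finset.sum_nonneg (fun r hr => by have := Finset.mem_range.1 hr; have := hT0 (r+k) (by omega); positivity)
  have n2 : 0 ≤ ∑ r ∈ Finset.range (k-1), 2 * T r := Finset.sum_nonneg (fun r hr => by have := Finset.mem_range.1 hr; have := hT0 r (by omega); positivity)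
  rw [← ENNReal.ofReal_add (by linarith) (by linarith)]
  apply ENNReal.ofReal_le_ofReal
  -- compare sums
  have key : ∑ r ∈ Finset.range (k-1), T (r+k) + ∑ r ∈ Finset.range (k-1), T r ≤ ∑ i, tl D (fun i => f i.val) i := by
    set T' : ℕ → ℝ := fun j => if hj : j < 2*k then tl D (fun i => f i.val) ⟨j, hj⟩ else 0 with hT'
    have s1 : ∑ i, tl D (fun i => f i.val) i = ∑ j ∈ Finset.range (2*k), T' j := by
      rw [Finset.sum_range]
      apply Finset.sum_congr rfl
      intro i _
      simp [hT']
    have hT'0 : ∀ j, 0 ≤ T' j := fun j => by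
      simp only [hT']; split_ifs
      · exact tl_nonneg D hsup _
      · exact le_rfl
    have s2 : ∀ j, j + 1 < 2 * k → T j = T' j := fun j hj => by
      rw [hTtl j hj]; simp [hT', show j < 2*k by omega]
    rw [s1, two_mul, Finset.sum_range_add, add_comm]
    apply add_le_add
    · rw [Finset.sum_congr rfl (fun r hr => s2 r (by have := Finset.mem_range.1 hr; omega))]
      exact Finset.sum_le_sum_of_subset_of_nonneg (Finset.range_mono (by omega)) (fun _ _ _ => hT'0 _)
    · rw [Finset.sum_congr rfl (fun r hr => s2 (r+k) (by have := Finset.mem_range.1 hr; omega))]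
      simp only [add_comm k]
      exact Finset.sum_le_sum_of_subset_of_nonneg (Finset.range_mono (by omega)) (fun _ _ _ => hT'0 _)
  rw [← Finset.mul_sum, ← Finset.mul_sum]
  linarith

end partF6b

section partF7

/-- parabola coordinates of a triangle -/
def Ps (x v y p : P2) : P2 := x + ((2 * p.1) • (v - x) + p.2 • (y - v - (v - x)))

/-- tangent functional -/
def ell (x v y : P2) (t : ℝ) (w : P2) : ℝ :=
  t * det2 (v - w) (y - v) + (1 - t) * det2 (v - x) (w - x) - t * (1 - t) * det2 (v - x) (y - v)

lemma ell_dot (x v y : P2) (t : ℝ) : ∃ (n : P2) (k : ℝ), ∀ w, ell x v y t w = k - dot2 n w := by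
  refine ⟨(t * (y - v).2 + (1 - t) * (v - x).2, -(t * (y - v).1 + (1 - t) * (v - x).1)),
    t * det2 v (y - v) - (1 - t) * det2 (v - x) x - t * (1 - t) * det2 (v - x) (y - v), fun w => ?_⟩
  simp only [ell, det2, dot2, Prod.fst_sub, Prod.snd_sub]
  ring

lemma ell_Ps (x v y p : P2) (t : ℝ) : ell x v y t (Ps x v y p) = det2 (v - x) (y - v) * (p.2 - 2 * t * p.1 + t^2) := by
  simp only [ell, Ps, det2, Prod.fst_sub, Prod.snd_sub, Prod.fst_add, Prod.snd_add, Prod.smul_fst, Prod.smul_snd, smul_eq_mul]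
  ring

lemma Ps_surj {x v y : P2} (h : det2 (v - x) (y - v) ≠ 0) (w : P2) : ∃ p, Ps x v y p = w := by
  set Y := det2 (v - x) (w - x) / det2 (v - x) (y - v) with hY
  set X := (1 + Y - det2 (v - w) (y - v) / det2 (v - x) (y - v)) / 2 with hX
  refine ⟨(X, Y), ?_⟩
  have h2 := h
  simp only [det2, Prod.fst_sub, Prod.snd_sub] at h2
  ext
  · simp only [Ps, hX, hY, det2, Prod.fst_sub, Prod.snd_sub, Prod.fst_add, Prod.smul_fst, smul_eq_mul]
    field_simp
    ring
  · simp only [Ps, hX, hY, det2, Prod.fst_sub, Prod.snd_sub, Prod.snd_add, Prod.smul_snd, smul_eq_mul]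
    field_simp
    ring

lemma vol_Ps {x v y : P2} (h : 0 < det2 (v - x) (y - v)) (A : Set P2) : volume (Ps x v y '' A) = ENNReal.ofReal (2 * det2 (v - x) (y - v)) * volume A := by
  let L : P2 →ₗ[ℝ] P2 := 
    { toFun := fun p => (2 * p.1) • (v - x) + p.2 • (y - v - (v - x))
      map_add' := by intro p q; ext <;> simp <;> ring
      map_smul' := by intro c p; ext <;> simp <;> ring }
  have hL : LinearMap.det L = 2 * det2 (v - x) (y - v) := by
    rw [det_P2]; simp [L, det2]; ring
  have e : Ps x v y '' A = (fun w => x + w) '' (L '' A) := by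
    rw [image_image]; rfl
  rw [e, image_add_left, measure_preimage_add, Measure.addHaar_image_linearMap, hL, abs_of_pos (by positivity)]

lemma Ps_mem {x v y p : P2} {C : Set P2} (hC : Convex ℝ C) (hx : x ∈ C) (hv : v ∈ C) (hy : y ∈ C) (h1 : p.1^2 ≤ p.2) (h2 : p.2 ≤ p.1) : Ps x v y p ∈ C := by
  have h0 : 0 ≤ p.2 := (sq_nonneg _).trans h1
  have e : Ps x v y p = (1 - 2 * p.1 + p.2) • x + (2 * p.1 - 2 * p.2) • v + p.2 • y := by
    unfold Ps; module
  rw [e]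
  refine convex_iff_sum_mem.1 hC |> fun H => ?_
  have := hC.sum_mem (t := Finset.univ) (w := ![1 - 2 * p.1 + p.2, 2 * p.1 - 2 * p.2, p.2]) (z := ![x, v, y]) (by
    intro i _
    fin_cases i
    · simp; nlinarith [sq_nonneg (1 - p.1)]
    · simp; linarith
    · simpa using h0) (by simp [Fin.sum_univ_three]; ring) (by
    intro i _
    fin_cases i
    · simpa using hx
    · simpa using hv
    · simpa using hy)
  simpa [Fin.sum_univ_three] using this

/-- the part of `K` beyond all parabola arcs -/
def arcS {ι : Type} (K : Set P2) (x v y : ι → P2) : Set P2 :=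
  {w | w ∈ K ∧ ∀ i, ∀ t ∈ Icc (0:ℝ) 1, 0 ≤ ell (x i) (v i) (y i) t w}

lemma ell_cone {x v y w : P2} (h : w ∈ coneC x v y) {t : ℝ} (ht : t ∈ Icc (0:ℝ) 1) : 0 ≤ ell x v y t w := by
  obtain ⟨h1, h2, h3⟩ := h
  have e : ell x v y t w = t^2 * det2 (v - w) (y - v) + (1-t)^2 * det2 (v - x) (w - x) 
    + t * (1 - t) * (det2 (v-x) (w-x) + det2 (v-w) (y-v) - det2 (v-x) (y-v)) := by unfold ell; ring
  rw [e]
  have h4 : 0 ≤ 1 - t := by linarith [ht.2]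
  have h5 := ht.1
  have h6 : 0 ≤ det2 (v-x) (w-x) + det2 (v-w) (y-v) - det2 (v-x) (y-v) := by linarith
  positivity

lemma arcS_convex {ι : Type} {K : Set P2} (hK : Convex ℝ K) (x v y : ι → P2) : Convex ℝ (arcS K x v y) := by
  intro w1 h1 w2 h2 α β hα hβ hαβ
  refine ⟨hK h1.1 h2.1 hα hβ hαβ, fun i t ht => ?_⟩
  obtain ⟨n, k, hnk⟩ := ell_dot (x i) (v i) (y i) t
  have q1 := h1.2 i t ht
  have q2 := h2.2 i t ht
  rw [hnk] at q1 q2 ⊢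
  have e : k - dot2 n (α • w1 + β • w2) = α * (k - dot2 n w1) + β * (k - dot2 n w2) := by
    have : β = 1 - α := by linarith
    subst this
    simp [dot2]; ring
  rw [e]; positivity

lemma arcS_closed {ι : Type} {K : Set P2} (hK : IsClosed K) (x v y : ι → P2) : IsClosed (arcS K x v y) := by
  have e : arcS K x v y = K ∩ ⋂ i, ⋂ t ∈ Icc (0:ℝ) 1, {w | 0 ≤ ell (x i) (v i) (y i) t w} := by
    ext w
    simp only [arcS, mem_ofPred_eq, mem_inter_iff, mem_iInter]
  rw [e]
  refine hK.inter (isClosed_iInter fun i => isClosed_biInter fun t _ => ?_)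
  apply isClosed_le continuous_const
  unfold ell det2
  fun_prop

section arcs
variable {ι : Type} {K : Set P2} {x v y : ι → P2}

lemma arc_mem (hF : VFam x v y) (hK : Convex ℝ K) (hx : ∀ i, x i ∈ K) (hv : ∀ i, v i ∈ K) (hy : ∀ i, y i ∈ K) (i : ι) {p : P2}
    (h1 : p.1^2 ≤ p.2) (h2 : p.2 ≤ p.1) : Ps (x i) (v i) (y i) p ∈ arcS K x v y := by
  refine ⟨Ps_mem hK (hx i) (hv i) (hy i) h1 h2, fun j t ht => ?_⟩
  by_cases hij : j = i
  · subst hij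
    rw [ell_Ps]
    apply mul_nonneg (hF.pos j).le
    nlinarith [sq_nonneg (p.1 - t)]
  · obtain ⟨q1, q2, q3⟩ := hF.sep j i hij
    exact ell_cone (Ps_mem (convex_coneC _ _ _) q1 q2 q3 h1 h2) ht

lemma cap_vol (hF : VFam x v y) (i : ι) {t s : ℝ} (hs : 0 < s) (h0 : s ≤ t) (h1 : t + s ≤ 1) :
    volume {w | w ∈ arcS K x v y ∧ ell (x i) (v i) (y i) t w < det2 (v i - x i) (y i - v i) * s^2} ≤
      ENNReal.ofReal (8/3 * det2 (v i - x i) (y i - v i) * s^3) := by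
  have hΔ := hF.pos i
  set Δ := det2 (v i - x i) (y i - v i) with hΔd
  have hsub : {w | w ∈ arcS K x v y ∧ ell (x i) (v i) (y i) t w < Δ * s^2} ⊆
      Ps (x i) (v i) (y i) '' {p | p.1 ∈ Icc (t - s) (t + s) ∧ (fun X => X^2) p.1 ≤ p.2 ∧ p.2 ≤ (fun X => 2 * t * X - t^2 + s^2) p.1} := by
    rintro w ⟨hw, hlt⟩
    obtain ⟨p, rfl⟩ := Ps_surj hΔ.ne' w
    refine ⟨p, ?_, rfl⟩
    rw [ell_Ps] at hlt
    have hlt' := lt_of_mul_lt_mul_left hlt hΔ.le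
    have hall : ∀ r ∈ Icc (0:ℝ) 1, 0 ≤ p.2 - 2 * r * p.1 + r^2 := by
      intro r hr
      have := hw.2 i r hr
      rw [ell_Ps] at this
      exact nonneg_of_mul_nonneg_right this hΔ
    have q1 := hall (t + s) ⟨by linarith, h1⟩
    have q2 := hall (t - s) ⟨by linarith, by linarith⟩
    have b1 : p.1 ≤ t + s := by
      by_contra hc; push Not at hc
      nlinarith [mul_pos hs (sub_pos.2 hc)]
    have b2 : t - s ≤ p.1 := by
      by_contra hc; push Not at hc
      nlinarith [mul_pos hs (sub_pos.2 hc)]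
    have q3 := hall p.1 ⟨by linarith, by linarith⟩
    refine ⟨⟨b2, b1⟩, ?_, ?_⟩
    · dsimp only; nlinarith
    · dsimp only; nlinarith
  refine (measure_mono hsub).trans ?_
  rw [vol_Ps hΔ, (vol_reg (l := t - s) (r := t + s) (f := fun X => X^2) (k := fun X => 2 * t * X - t^2 + s^2) (by linarith) (by fun_prop) (by fun_prop) (fun X hX => by
    have := mul_nonneg (sub_nonneg.2 hX.1) (sub_nonneg.2 hX.2)
    nlinarith)).2]
  have e : ∀ X : ℝ, 2 * t * X - t^2 + s^2 - X^2 = s^2 - 1 * (X - t)^2 := fun X => by ring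
  simp only [e]
  rw [int_quad, ← ENNReal.ofReal_mul (by positivity)]
  apply le_of_eq
  congr 1
  ring

lemma strip_wet (hF : VFam x v y) (hK : Convex ℝ K) (hx : ∀ i, x i ∈ K) (hv : ∀ i, v i ∈ K) (hy : ∀ i, y i ∈ K) (i : ι) {p : P2} {s δ : ℝ}
    (hs : 0 < s) (h0 : s ≤ p.1) (h1 : p.1 + s ≤ 1) (h2 : p.1^2 ≤ p.2) (h3 : p.2 ≤ p.1) (h4 : p.2 < p.1^2 + s^2)
    (hδ : 8/3 * det2 (v i - x i) (y i - v i) * s^3 ≤ δ) : Ps (x i) (v i) (y i) p ∈ wet (arcS K x v y) δ := by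
  refine ⟨arc_mem hF hK hx hv hy i h2 h3, ?_⟩
  obtain ⟨n, k, hnk⟩ := ell_dot (x i) (v i) (y i) p.1
  refine ⟨n, k - det2 (v i - x i) (y i - v i) * s^2, ?_, ?_⟩
  · refine le_trans (le_of_eq ?_) ((cap_vol hF i hs h0 h1 (K := K)).trans (ENNReal.ofReal_le_ofReal hδ))
    congr 1
    ext w
    simp only [mem_ofPred_eq, hnk]
    constructor
    · rintro ⟨a1, a2⟩; exact ⟨a1, by linarith⟩
    · rintro ⟨a1, a2⟩; exact ⟨a1, by linarith⟩
  · have := ell_Ps (x i) (v i) (y i) p p.1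
    rw [hnk] at this
    have hΔ := hF.pos i
    have : det2 (v i - x i) (y i - v i) * (p.2 - 2 * p.1 * p.1 + p.1^2) < det2 (v i - x i) (y i - v i) * s^2 :=
      mul_lt_mul_of_pos_left (by linarith [sq p.1]) hΔ
    linarith

/-- the strip along a unit parabola arc -/
def strip (η w : ℝ) : Set P2 := {p | p.1 ∈ Icc η (1 - η) ∧ (fun X => X^2) p.1 ≤ p.2 ∧ p.2 ≤ (fun X => X^2 + w) p.1}

lemma strip_vol {η w : ℝ} (hη : η ≤ 1/2) (hw : 0 ≤ w) : volume (strip η w) = ENNReal.ofReal ((1 - 2 * η) * w) := by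
  unfold strip
  rw [(vol_reg (l := η) (r := 1 - η) (f := fun X => X^2) (k := fun X => X^2 + w) (by linarith) (by fun_prop) (by fun_prop) (fun X _ => by linarith)).2]
  simp only [add_sub_cancel_left, intervalIntegral.integral_const, smul_eq_mul]
  congr 1; ring

lemma strip_compact (η w : ℝ) : IsCompact (strip η w) := by
  have e : strip η w = (fun q : P2 => (q.1, q.1^2 + q.2)) '' (Icc η (1-η) ×ˢ Icc 0 w) := by
    ext p
    simp only [strip, mem_ofPred_eq, mem_image, mem_prod]
    constructor
    · rintro ⟨h1, h2, h3⟩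
      exact ⟨(p.1, p.2 - p.1^2), ⟨h1, by dsimp only; linarith, by dsimp only; linarith⟩, by ext <;> simp⟩
    · rintro ⟨q, ⟨h1, h2⟩, rfl⟩
      exact ⟨h1, by dsimp only; linarith [h2.1], by dsimp only; linarith [h2.2]⟩
  rw [e]
  exact (isCompact_Icc.prod isCompact_Icc).image (by fun_prop)

lemma Ps_cont (x v y : P2) : Continuous (Ps x v y) := by unfold Ps; fun_prop

lemma arc_wet_vol [Fintype ι] (hF : VFam x v y) (hK : Convex ℝ K) (hx : ∀ i, x i ∈ K) (hv : ∀ i, v i ∈ K) (hy : ∀ i, y i ∈ K)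
    {η : ℝ} (hη0 : 0 < η) (hη : η ≤ 1/2) {δ : ℝ} {s : ι → ℝ} (hs : ∀ i, 0 < s i) (hsη : ∀ i, s i ≤ η)
    (hδ : ∀ i, 8/3 * det2 (v i - x i) (y i - v i) * s i^3 ≤ δ) :
    ∑ i, ENNReal.ofReal (2 * det2 (v i - x i) (y i - v i) * ((1 - 2 * η) * ((1 - η) * s i^2))) ≤ volume (wet (arcS K x v y) δ) := by
  set A : ι → Set P2 := fun i => Ps (x i) (v i) (y i) '' strip η ((1-η) * s i^2) with hA
  have hp : ∀ i, ∀ p ∈ strip η ((1-η) * s i^2), p.1^2 ≤ p.2 ∧ p.2 < p.1 ∧ p.2 < p.1^2 + s i^2 := by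
    intro i p hp
    obtain ⟨⟨h1, h2⟩, h3, h4⟩ := hp
    dsimp only at h3 h4
    have hsi := hs i; have hsi' := hsη i
    have k1 : 0 ≤ (p.1 - η) * (1 - η - p.1) := mul_nonneg (by linarith) (by linarith)
    have k2 : s i^2 ≤ η^2 := by gcongr
    have k3 : 0 < s i^2 := by positivity
    refine ⟨h3, ?_, by nlinarith⟩
    nlinarith
  have hvol : ∀ i, volume (A i) = ENNReal.ofReal (2 * det2 (v i - x i) (y i - v i) * ((1 - 2 * η) * ((1 - η) * s i^2))) := by
    intro i
    have hΔ := hF.pos i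
    rw [hA]; dsimp only
    rw [vol_Ps hΔ, strip_vol hη (mul_nonneg (by linarith) (sq_nonneg _)), ← ENNReal.ofReal_mul (by positivity)]
  have hdisj : Pairwise (Function.onFun Disjoint A) := by
    intro i j hij
    rw [Function.onFun, Set.disjoint_left]
    rintro w ⟨p, hpi, rfl⟩ ⟨q, hqj, hq⟩
    obtain ⟨a1, a2, a3⟩ := hp i p hpi
    obtain ⟨b1, b2, b3⟩ := hp j q hqj
    obtain ⟨q1, q2, q3⟩ := hF.sep i j hij
    have hc := (Ps_mem (convex_coneC _ _ _) q1 q2 q3 b1 b2.le).2.2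
    rw [hq] at hc
    have e : det2 (v i - x i) (Ps (x i) (v i) (y i) p - x i) + det2 (v i - Ps (x i) (v i) (y i) p) (y i - v i) 
      = det2 (v i - x i) (y i - v i) * (1 - 2 * (p.1 - p.2)) := by
      simp only [Ps, det2, Prod.fst_sub, Prod.snd_sub, Prod.fst_add, Prod.snd_add, Prod.smul_fst, Prod.smul_snd, smul_eq_mul]
      ring
    rw [e] at hc
    nlinarith [hF.pos i, mul_pos (hF.pos i) (sub_pos.2 a2)]
  calc _ = ∑ i, volume (A i) := by simp only [hvol]
    _ = volume (⋃ i, A i) := by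
        rw [measure_iUnion hdisj (fun i => ((strip_compact _ _).image (Ps_cont _ _ _)).isClosed.measurableSet), tsum_fintype]
    _ ≤ _ := by
        apply measure_mono
        apply iUnion_subset
        rintro i w ⟨p, hpi, rfl⟩
        obtain ⟨a1, a2, a3⟩ := hp i p hpi
        exact strip_wet hF hK hx hv hy i (hs i) ((hsη i).trans hpi.1.1) (by linarith [hpi.1.2, hsη i]) a1 a2.le a3 (hδ i)

lemma arc_body [Fintype ι] [Nonempty ι] (hF : VFam x v y) (hK : Convex ℝ K) (hx : ∀ i, x i ∈ K) (hv : ∀ i, v i ∈ K) (hy : ∀ i, y i ∈ K) :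
    (interior (arcS K x v y)).Nonempty := by
  by_contra hc
  rw [not_nonempty_iff_eq_empty] at hc
  have h0 : volume (arcS K x v y) = 0 := by
    refine le_antisymm ?_ zero_le
    rw [← Convex.addHaar_frontier volume (arcS_convex hK x v y)]
    apply measure_mono
    rw [frontier, hc, sdiff_empty]
    exact subset_closure
  obtain ⟨i⟩ : Nonempty ι := inferInstance
  have hsub : Ps (x i) (v i) (y i) '' strip (1/4) (1/16) ⊆ arcS K x v y := by
    rintro w ⟨p, ⟨⟨h1, h2⟩, h3, h4⟩, rfl⟩
    dsimp only at h3 h4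
    exact arc_mem hF hK hx hv hy i h3 (by nlinarith)
  have := measure_mono (μ := volume) hsub
  rw [h0, vol_Ps (hF.pos i), strip_vol (by norm_num) (by norm_num), ← ENNReal.ofReal_mul (by have := hF.pos i; positivity)] at this
  have h2 := ENNReal.ofReal_eq_zero.1 (le_antisymm this zero_le)
  have := hF.pos i
  nlinarith

lemma arc_aff [Fintype ι] (hF : VFam x v y) (hK : Convex ℝ K) (hKc : IsClosed K) (hx : ∀ i, x i ∈ K) (hv : ∀ i, v i ∈ K) (hy : ∀ i, y i ∈ K)
    {t : ι → ℝ} (ht0 : ∀ i, 0 ≤ t i) (ht : ∀ i, 2 * t i^3 = det2 (v i - x i) (y i - v i))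
    {a b : ℝ} {g h : ℝ → ℝ} (B : Body (arcS K x v y) a b g h) :
    ENNReal.ofReal (2 * ∑ i, t i) ≤ aff a b g + aff (-b) (-a) (fun x => -h (-x)) := by
  obtain ⟨hfin, hlim⟩ := wet_lim B (arcS_closed hKc x v y)
  set L := aff a b g + aff (-b) (-a) (fun x => -h (-x)) with hL
  have hstep : ∀ η : ℝ, 0 < η → η ≤ 1/2 → ENNReal.ofReal ((1 - 2*η) * (1-η) * (cc * (2 * ∑ i, t i))) ≤ ENNReal.ofReal cc * L := by
    intro η hη0 hη
    refine ge_of_tendsto hlim ?_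
    set s : ℝ → ι → ℝ := fun δ i => (3 * δ / (8 * det2 (v i - x i) (y i - v i)))^((1:ℝ)/3) with hs
    have hsl : ∀ i, Tendsto (fun δ => s δ i) (nhdsWithin 0 (Ioi 0)) (nhds 0) := by
      intro i
      have : ContinuousAt (fun δ => s δ i) 0 := by
        apply ContinuousAt.rpow_const (by fun_prop) (Or.inr (by norm_num))
      have h2 := this.tendsto
      have h3 : s 0 i = 0 := by simp [hs]
      rw [h3] at h2
      exact h2.mono_left nhdsWithin_le_nhds
    have hev : ∀ᶠ δ in nhdsWithin (0:ℝ) (Ioi 0), ∀ i, s δ i < η := by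
      rw [eventually_all]
      intro i
      exact (hsl i).eventually (gt_mem_nhds hη0)
    filter_upwards [hev, self_mem_nhdsWithin] with δ hδη hδ
    have hδ0 : 0 < δ := hδ
    have hs3 : ∀ i, s δ i ^ 3 = 3 * δ / (8 * det2 (v i - x i) (y i - v i)) := fun i => by
      have := hF.pos i
      exact rpow_third_cube (by positivity)
    have hs0 : ∀ i, 0 < s δ i := fun i => by have := hF.pos i; simp only [hs]; positivity
    have hw := arc_wet_vol hF hK hx hv hy hη0 hη hs0 (fun i => (hδη i).le) (δ := δ) (fun i => by
      have := hF.pos i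
      rw [hs3]; apply le_of_eq; field_simp)
    have hterm : ∀ i, 2 * det2 (v i - x i) (y i - v i) * s δ i^2 = cc * (2 * t i) * δ^((2:ℝ)/3) := by
      intro i
      have hΔ := hF.pos i
      have := cc_pos; have := ht0 i; have := hs0 i
      have e3 : (2 * det2 (v i - x i) (y i - v i) * s δ i^2)^3 = (cc * (2 * t i) * δ^((2:ℝ)/3))^3 := by
        rw [mul_pow, mul_pow (cc * _), mul_pow cc, rpow_twothird_cube hδ0.le, cc_cube, show (s δ i^2)^3 = (s δ i^3)^2 by ring, hs3,
          show (2 * t i)^3 = 4 * (2 * t i^3) by ring, ht i]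
        field_simp; ring
      exact (pow_left_inj₀ (by positivity) (by positivity) (by norm_num)).1 e3
    have e : ∀ i, 2 * det2 (v i - x i) (y i - v i) * ((1 - 2 * η) * ((1 - η) * s δ i^2)) = (1 - 2*η) * (1-η) * (cc * (2 * t i)) * δ^((2:ℝ)/3) := by
      intro i
      linear_combination ((1 - 2*η) * (1-η)) * hterm i
    have hq : 0 ≤ (1 - 2*η) * (1-η) := mul_nonneg (by linarith) (by linarith)
    rw [ENNReal.le_div_iff_mul_le (Or.inl (by simpa using Real.rpow_pos_of_pos hδ0 _)) (Or.inl ENNReal.ofReal_ne_top)]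
    refine le_trans (le_of_eq ?_) hw
    have hcc := cc_pos
    rw [← ENNReal.ofReal_mul (by have := Finset.sum_nonneg (fun i (_ : i ∈ Finset.univ) => ht0 i); positivity), ← ENNReal.ofReal_sum_of_nonneg (fun i _ => by
      rw [e i]; have := ht0 i; positivity)]
    congr 1
    simp only [e]
    rw [← Finset.sum_mul, ← Finset.mul_sum, ← Finset.mul_sum, ← Finset.mul_sum]
  have hcc := cc_pos
  have hlim2 : Tendsto (fun η : ℝ => ENNReal.ofReal ((1 - 2*η) * (1-η) * (cc * (2 * ∑ i, t i)))) (nhdsWithin 0 (Ioi 0))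
      (nhds (ENNReal.ofReal ((1 - 2*0) * (1-0) * (cc * (2 * ∑ i, t i))))) := by
    apply Tendsto.mono_left _ nhdsWithin_le_nhds
    apply ENNReal.tendsto_ofReal
    apply Continuous.tendsto (f := fun η : ℝ => (1 - 2*η) * (1-η) * (cc * (2 * ∑ i, t i)))
    fun_prop
  have := le_of_tendsto hlim2 (b := ENNReal.ofReal cc * L) (by
    have : Ioc (0:ℝ) (1/2) ∈ nhdsWithin (0:ℝ) (Ioi 0) := Ioc_mem_nhdsGT (by norm_num)
    filter_upwards [this] with η hη
    exact hstep η hη.1 hη.2)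
  rw [mul_zero, sub_zero, mul_one, one_mul, ENNReal.ofReal_mul hcc.le] at this
  exact (ENNReal.mul_le_mul_iff_right (by simpa using hcc) ENNReal.ofReal_ne_top).1 this

end arcs

end partF7

section partH1

/-- coordinates -/
def eP : E 2 ≃L[ℝ] P2 := (EuclideanSpace.equiv (Fin 2) ℝ).trans (ContinuousLinearEquiv.finTwoArrow ℝ ℝ)

lemma eP_apply (x : E 2) : eP x = (x 0, x 1) := rfl

lemma eP_mp : MeasurePreserving (eP : E 2 → P2) := by
  exact (volume_preserving_finTwoArrow ℝ).comp (PiLp.volume_preserving_ofLp (Fin 2))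

lemma eP_me : MeasurableEmbedding (eP : E 2 → P2) := eP.toHomeomorph.measurableEmbedding

lemma eP_vol (s : Set P2) : volume (eP ⁻¹' s) = volume s := eP_mp.measure_preimage_emb eP_me s

lemma eP_vol' (s : Set (E 2)) : volume (eP '' s) = volume s := by
  rw [← eP_vol, preimage_image_eq _ eP.injective]

lemma eP_CP {n : ℕ} (x : Fin n → E 2) : ConvexPosition (range x) ↔ CP (fun i => eP (x i)) := by
  unfold ConvexPosition CP
  rw [forall_mem_range]
  apply forall_congr'
  intro i
  have : range (fun i => eP (x i)) \ {eP (x i)} = eP '' (range x \ {x i}) := by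
    rw [image_sdiff eP.injective, image_singleton, ← range_comp]; rfl
  rw [this]
  have h2 := (eP : E 2 →ₗ[ℝ] P2).image_convexHull (range x \ {x i})
  have h3 : (⇑(eP : E 2 →ₗ[ℝ] P2)) = (eP : E 2 → P2) := rfl
  rw [h3] at h2
  rw [← h2, eP.injective.mem_set_image]

lemma pConvex_eq {K : Set (E 2)} (hK : MeasurableSet K) (harea : volume K = 1) (n : ℕ) :
    pConvex 2 n K = (volume {z : Fin n → P2 | (∀ i, z i ∈ eP '' K) ∧ CP z}).toReal := by
  unfold pConvex sampleMeasure unifOn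
  simp only [harea, inv_one, one_smul]
  rw [← Measure.restrict_pi_pi, Measure.restrict_apply' (MeasurableSet.univ_pi fun _ => hK)]
  have hmp : MeasurePreserving (fun (x : Fin n → E 2) i => eP (x i)) := volume_preserving_pi (fun _ => eP_mp)
  have hme : MeasurableEmbedding (fun (x : Fin n → E 2) i => eP (x i)) :=
    (Homeomorph.piCongrRight (fun _ : Fin n => eP.toHomeomorph)).measurableEmbedding
  rw [← hmp.measure_preimage_emb hme]
  congr 2
  ext x
  simp only [mem_inter_iff, mem_preimage, mem_ofPred_eq, mem_univ_pi, eP.injective.mem_set_image, eP_CP]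
  tauto

lemma float_wet {S : Set (E 2)} (δ : ℝ) : eP '' (floatingBody S δ) = (eP '' S) \ wet (eP '' S) δ := by
  have hvol : ∀ (f : E 2 → ℝ) (q : P2 → ℝ) (c : ℝ), (∀ y, f y = q (eP y)) → volume {y ∈ S | c < f y} = volume {y | y ∈ eP '' S ∧ c < q y} := by
    intro f q c h
    rw [← eP_vol]
    congr 1
    ext y
    simp [h]
  ext z
  obtain ⟨x, rfl⟩ := eP.surjective z
  rw [eP.injective.mem_set_image, Set.mem_sdiff, eP.injective.mem_set_image]
  unfold floatingBody wet
  simp only [mem_ofPred_eq, eP.injective.mem_set_image]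
  constructor
  · rintro ⟨h1, h2⟩
    refine ⟨h1, ?_⟩
    rintro ⟨-, n, c, hv, hc⟩
    let f : E 2 →L[ℝ] ℝ := (LinearMap.toContinuousLinearMap
      { toFun := fun p : P2 => dot2 n p, map_add' := by intro p q; simp [dot2]; ring, map_smul' := by intro r p; simp [dot2]; ring } : P2 →L[ℝ] ℝ).comp (eP : E 2 →L[ℝ] P2)
    have hf : ∀ y, f y = dot2 n (eP y) := fun y => rfl
    have := h2 f c (by rw [hvol f (dot2 n) c hf]; exact hv)
    rw [hf] at this
    linarith
  · rintro ⟨h1, h2⟩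
    refine ⟨h1, fun f c hv => ?_⟩
    by_contra hc
    push Not at hc
    apply h2
    have hf : ∀ y, f y = dot2 (f (EuclideanSpace.single 0 1), f (EuclideanSpace.single 1 1)) (eP y) := by
      intro y
      have : y = y 0 • EuclideanSpace.single 0 (1:ℝ) + y 1 • EuclideanSpace.single 1 (1:ℝ) := by
        ext i; fin_cases i <;> simp
      conv_lhs => rw [this]
      rw [map_add, map_smul, map_smul, eP_apply]
      simp [dot2]; ring
    refine ⟨h1, (f (EuclideanSpace.single 0 1), f (EuclideanSpace.single 1 1)), c, ?_, ?_⟩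
    · rw [← hvol f _ c hf]; exact hv
    · rw [← hf]; exact hc

lemma const_cc : (4 * Real.sqrt 2 / 3) ^ ((2:ℝ)/3) * cc = 1 := by
  have h : ((4 * Real.sqrt 2 / 3) ^ ((2:ℝ)/3) * cc)^3 = 1 := by
    rw [mul_pow, cc_cube, rpow_twothird_cube (by positivity)]
    rw [div_pow, mul_pow, Real.sq_sqrt (by norm_num)]; norm_num
  have h0 : 0 ≤ (4 * Real.sqrt 2 / 3) ^ ((2:ℝ)/3) * cc := mul_nonneg (by positivity) cc_pos.le
  exact (pow_eq_one_iff_of_nonneg h0 (by norm_num)).1 h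

lemma ap_eq {S : Set (E 2)} (hc : IsCompact S) {a b : ℝ} {g h : ℝ → ℝ} (B : Body (eP '' S) a b g h) :
    affinePerimeter S = (aff a b g + aff (-b) (-a) (fun x => - h (-x))).toReal := by
  have hc' : IsCompact (eP '' S) := hc.image eP.continuous
  obtain ⟨hf, hl⟩ := wet_lim B hc'.isClosed
  unfold affinePerimeter
  have key : Tendsto (fun δ : ℝ => ((volume S).toReal - (volume (floatingBody S δ)).toReal) / δ ^ ((2:ℝ)/3)) (nhdsWithin 0 (Ioi 0))
      (nhds (ENNReal.ofReal cc * (aff a b g + aff (-b) (-a) (fun x => - h (-x)))).toReal) := by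
    have := (ENNReal.tendsto_toReal (ENNReal.mul_ne_top ENNReal.ofReal_ne_top hf)).comp hl
    refine this.congr' ?_
    filter_upwards [self_mem_nhdsWithin] with δ hδ
    have hδ : (0:ℝ) < δ := hδ
    have hw : wet (eP '' S) δ ⊆ eP '' S := fun z hz => hz.1
    have hfin : volume (wet (eP '' S) δ) ≠ ⊤ := ((measure_mono hw).trans_lt hc'.measure_lt_top).ne
    have h1 : volume (floatingBody S δ) = volume S - volume (wet (eP '' S) δ) := by
      rw [← eP_vol', float_wet, measure_sdiff hw (wet_meas hc'.isClosed δ).nullMeasurableSet hfin, eP_vol']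
    simp only [Function.comp]
    rw [h1, ENNReal.toReal_sub_of_le _ hc.measure_lt_top.ne, ENNReal.toReal_div, ENNReal.toReal_ofReal (by positivity)]
    · ring
    · rw [← eP_vol' S]; exact measure_mono hw
  rw [key.limUnder_eq, ENNReal.toReal_mul, ENNReal.toReal_ofReal cc_pos.le, ← mul_assoc, const_cc, one_mul]

lemma ap_deg {S : Set (E 2)} (hconv : Convex ℝ S) (hnonem : ¬ (interior S).Nonempty) : affinePerimeter S = 0 := by
  have h0 : volume S = 0 := by
    have h1 := hconv.addHaar_frontier (volume : Measure (E 2))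
    have h2 : S ⊆ frontier S := by
      rw [not_nonempty_iff_eq_empty] at hnonem
      rw [frontier, hnonem, sdiff_empty]; exact subset_closure
    exact measure_mono_null h2 h1
  have h1 : ∀ δ, volume (floatingBody S δ) = 0 := fun δ => measure_mono_null (fun x hx => hx.1) h0
  unfold affinePerimeter
  simp only [h0, h1, ENNReal.toReal_zero, sub_self, zero_div]
  rw [(tendsto_const_nhds).limUnder_eq, mul_zero]

end partH1

section partH2

/-- the probability in coordinates -/
def qv (K : Set P2) (n : ℕ) : ℝ := (volume {z : Fin n → P2 | (∀ i, z i ∈ K) ∧ CP z}).toReal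

lemma q_lower {K : Set P2} (hK : Convex ℝ K) (hK1 : volume K ≤ 1) {T : ℝ} (hF : FamIn K T) (hT : 0 < T) {c : ℝ}
    (hc : c < Real.exp 2 * (2 * T^3)) : ∀ᶠ n : ℕ in atTop, c < (n:ℝ)^2 * (qv K n) ^ ((1:ℝ)/n) := by
  obtain ⟨ι, _, x, v, y, t, hV, hx, hv, hy, ht0, ht, hs⟩ := hF
  have : Nonempty ι := by
    by_contra hne
    rw [not_nonempty_iff] at hne
    simp at hs; linarith
  refine asymp_lower (by positivity) (4 * Fintype.card ι) (fun n => ?_) hc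
  have h := lower_main hV hK hx hv hy t ht0 ht n
  rw [hs] at h
  have hfin : volume {z : Fin n → P2 | (∀ i, z i ∈ K) ∧ CP z} ≠ ⊤ := by
    have h1 : volume (Set.pi univ (fun _ : Fin n => K)) ≤ 1 := by
      rw [volume_pi, Measure.pi_pi]
      exact Finset.prod_le_one' (fun _ _ => hK1)
    refine ((measure_mono ?_).trans_lt (h1.trans_lt ENNReal.one_lt_top)).ne
    intro z hz; simpa using hz.1
  have h2 := ENNReal.toReal_mono hfin h
  rw [ENNReal.toReal_ofReal (by positivity)] at h2
  refine le_trans (le_of_eq ?_) h2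
  rw [mul_pow, ← pow_mul]

lemma q_upper {m : ℕ} (D : Dirs (Fin m)) {K : Set P2} (hK : MeasurableSet K) (hK1 : volume K ≤ 1) {T : ℝ} (hT0 : 0 < T)
    (hT : ∀ a : Fin m → P2, (∀ i, a i ∈ K) → SupC D a → ∑ i, tl D a i ≤ T) {c : ℝ}
    (hc : Real.exp 2 * (2 * T^3) < c) : ∀ᶠ n : ℕ in atTop, (n:ℝ)^2 * (qv K n) ^ ((1:ℝ)/n) < c := by
  refine asymp_upper (fun n => ENNReal.toReal_nonneg) (C := (max 1 (2 * T ^ 3)⁻¹) ^ Fintype.card (Fin m)) (by positivity) (by positivity)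
    (4 * Fintype.card (Fin m)) (fun n hn => ?_) hc
  exact ENNReal.toReal_le_of_le_ofReal (by positivity) (upper_main D hK hK1 hT0 hT n hn)

lemma tl_bdd {m : ℕ} (D : Dirs (Fin m)) {K : Set P2} (hK : IsCompact K) :
    ∃ T : ℝ, 0 < T ∧ ∀ a : Fin m → P2, (∀ i, a i ∈ K) → SupC D a → ∑ i, tl D a i ≤ T := by
  have hcont : Continuous (fun a : Fin m → P2 => ∑ i, tl D a i) := by
    refine continuous_finsetSum _ (fun i _ => ?_)
    unfold tl
    refine Continuous.rpow_const ?_ (fun _ => Or.inr (by norm_num))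
    unfold dl dot2
    fun_prop
  obtain ⟨T, hT⟩ := (isCompact_univ_pi (fun _ : Fin m => hK)).bddAbove_image hcont.continuousOn
  refine ⟨max T 1, by positivity, fun a ha _ => le_trans (hT ?_) (le_max_left _ _)⟩
  exact ⟨a, by simpa using ha, rfl⟩

lemma fam_bdd {K : Set P2} (hc : IsCompact K) (hK : Convex ℝ K) (hK1 : volume K ≤ 1) : ∃ T0 : ℝ, ∀ T, FamIn K T → T ≤ T0 := by
  obtain ⟨T0, h0, hT0⟩ := tl_bdd (DZ 4 le_rfl) hc
  refine ⟨T0, fun T hT => ?_⟩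
  by_contra hlt
  push Not at hlt
  have h1 : Real.exp 2 * (2 * T0^3) < Real.exp 2 * (2 * T^3) := by gcongr
  obtain ⟨c, hc1, hc2⟩ := exists_between h1
  have e1 := q_lower hK hK1 hT (h0.trans hlt) hc2
  have e2 := q_upper (DZ 4 le_rfl) hc.measurableSet hK1 h0 hT0 hc1
  obtain ⟨n, hn1, hn2⟩ := (e1.and e2).exists
  linarith

lemma famIn_zero (K : Set P2) : FamIn K 0 := by
  refine ⟨Empty, inferInstance, Empty.elim, Empty.elim, Empty.elim, Empty.elim, ⟨fun i => i.elim, fun i => i.elim⟩, ?_, ?_, ?_, ?_, ?_, ?_⟩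
  all_goals simp

lemma exists_box {K : Set P2} (hnonem : (interior K).Nonempty) :
    ∃ (o : P2) (ρ : ℝ), 0 < ρ ∧ ∀ w : P2, |w.1| ≤ ρ → |w.2| ≤ ρ → o + w ∈ K := by
  obtain ⟨z0, hz0⟩ := hnonem
  obtain ⟨r, hr, hball⟩ := Metric.isOpen_iff.1 isOpen_interior z0 hz0
  refine ⟨z0, r/2, by positivity, fun w h1 h2 => ?_⟩
  apply interior_subset (hball _)
  rw [Metric.mem_ball, Prod.dist_eq, Real.dist_eq, Real.dist_eq]
  simp; constructor <;> linarith

lemma exists_diam {K : Set P2} (hc : IsCompact K) : ∃ R : ℝ, 0 ≤ R ∧ ∀ x ∈ K, ∀ y ∈ K, dot2 (x - y) (x - y) ≤ R^2 := by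
  have hcont : Continuous (fun p : P2 × P2 => dot2 (p.1 - p.2) (p.1 - p.2)) := by unfold dot2; fun_prop
  obtain ⟨T, hT⟩ := (hc.prod hc).bddAbove_image hcont.continuousOn
  refine ⟨max T 1, by positivity, fun x hx y hy => ?_⟩
  have h1 : dot2 (x - y) (x - y) ≤ T := hT ⟨(x, y), ⟨hx, hy⟩, rfl⟩
  have h2 := le_max_left T 1
  have h3 := le_max_right T 1
  nlinarith

lemma famIn_pos {K : Set P2} (hnonem : (interior K).Nonempty) : ∃ T, 0 < T ∧ FamIn K T := by
  obtain ⟨o, ρ, hρ, ho⟩ := exists_box hnonem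
  refine ⟨(ρ^2/2)^((1:ℝ)/3), by positivity, Unit, inferInstance, fun _ => o, fun _ => o + (ρ, 0), fun _ => o + (ρ, ρ), fun _ => (ρ^2/2)^((1:ℝ)/3), ⟨?_, ?_⟩, ?_, ?_, ?_, ?_, ?_, ?_⟩
  · intro _; simp [det2]; positivity
  · intro i j h; exact absurd rfl h
  · intro _; simpa using ho 0 (by simpa using hρ.le) (by simpa using hρ.le)
  · intro _; exact ho _ (by simp [abs_of_pos hρ]) (by simpa using hρ.le)
  · intro _; exact ho _ (by simp [abs_of_pos hρ]) (by simp [abs_of_pos hρ])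
  · intro _; positivity
  · intro _; rw [rpow_third_cube (by positivity)]; simp [det2]; ring
  · simp

lemma thm_small {R ε ρ : ℝ} (hε : 0 < ε) (hρ : 0 < ρ) : ∀ᶠ k : ℕ in atTop, R * thm (2*k) ≤ ε * ρ := by
  have h : Tendsto (fun k : ℕ => R * thm (2*k)) atTop (nhds 0) := by
    have h1 : Tendsto (fun k : ℕ => (R * Real.pi) / (k:ℝ)) atTop (nhds 0) :=
      Tendsto.div_atTop tendsto_const_nhds tendsto_natCast_atTop_atTop
    refine h1.congr (fun k => ?_)
    unfold thm; push_cast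
    rw [mul_div_assoc, mul_div_mul_left _ _ (two_ne_zero)]
  exact h.eventually_le_const (by positivity)

lemma ap_fam {K S : Set (E 2)} (hKc : IsCompact K) (hK : Convex ℝ K) (hnonem : (interior (eP '' K)).Nonempty) (hSK : S ⊆ K) (hSc : IsCompact S)
    (hS : Convex ℝ S) {ε : ℝ} (hε : 0 < ε) : ∃ T, FamIn (eP '' K) T ∧ affinePerimeter S ≤ (1+ε)^((2:ℝ)/3) * (2 * T) + ε := by
  by_cases hi : (interior S).Nonempty
  swap
  · exact ⟨0, famIn_zero _, by rw [ap_deg hS hi]; simp [hε.le]⟩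
  have hi' : (interior (eP '' S)).Nonempty := by
    have := eP.toHomeomorph.image_interior S
    have h2 : eP '' interior S = interior (eP '' S) := this
    rw [← h2]; exact hi.image _
  have hKc' : IsCompact (eP '' K) := hKc.image eP.continuous
  have hK' : Convex ℝ (eP '' K) := hK.linear_image (eP : E 2 →ₗ[ℝ] P2)
  have hSc' : IsCompact (eP '' S) := hSc.image eP.continuous
  have hS' : Convex ℝ (eP '' S) := hS.linear_image (eP : E 2 →ₗ[ℝ] P2)
  obtain ⟨a, b, g, h, B⟩ := exists_body hSc' hS' hi'
  rw [ap_eq hSc B]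
  obtain ⟨k0, hk0⟩ := aff_le_tl B hSc' hS' hε
  obtain ⟨o, ρ, hρ, ho⟩ := exists_box hnonem
  obtain ⟨R, hR0, hR⟩ := exists_diam hKc'
  obtain ⟨k, hk1, hk2, hk3⟩ := ((thm_small (R := R) hε hρ).and ((eventually_ge_atTop k0).and (eventually_ge_atTop 2))).exists
  have : NeZero (2*k) := ⟨by omega⟩
  obtain ⟨c, hcS, hcs, hle⟩ := hk0 k hk2 (by omega)
  refine ⟨_, famIn_of_sup hK' hρ.le ho hR hR0 hε (2*k) (by omega) hk1 hcs (fun i => image_mono hSK (hcS i)), ?_⟩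
  have hnn : 0 ≤ ∑ i, tl (DZ (2*k) (by omega)) c i := Finset.sum_nonneg (fun i _ => tl_nonneg _ hcs i)
  refine (ENNReal.toReal_le_of_le_ofReal (by positivity) hle).trans (le_of_eq ?_)
  rw [Real.inv_rpow (by positivity)]
  have : (1+ε)^((2:ℝ)/3) ≠ 0 := by positivity
  field_simp

lemma ap_le_of_fam {K S : Set (E 2)} (hKc : IsCompact K) (hK : Convex ℝ K) (hnonem : (interior (eP '' K)).Nonempty) (hSK : S ⊆ K) (hSc : IsCompact S)
    (hS : Convex ℝ S) {A : ℝ} (hA : ∀ T, FamIn (eP '' K) T → 2 * T ≤ A) : affinePerimeter S ≤ A := by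
  have hlim : Tendsto (fun ε : ℝ => (1+ε)^((2:ℝ)/3) * A + ε) (nhdsWithin 0 (Ioi 0)) (nhds A) := by
    have hc : Continuous (fun ε : ℝ => (1+ε)^((2:ℝ)/3) * A + ε) := by
      refine Continuous.add (Continuous.mul (Continuous.rpow_const (by fun_prop) (fun _ => Or.inr (by norm_num))) continuous_const) continuous_id
    have := hc.tendsto 0
    simp only [add_zero, Real.one_rpow, one_mul] at this
    exact this.mono_left nhdsWithin_le_nhds
  refine ge_of_tendsto hlim ?_
  filter_upwards [self_mem_nhdsWithin] with ε hε
  have hε : (0:ℝ) < ε := hε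
  obtain ⟨T, hT, h⟩ := ap_fam hKc hK hnonem hSK hSc hS hε
  refine h.trans ?_
  gcongr
  exact hA T hT

lemma max_bdd {K : Set (E 2)} (hKc : IsCompact K) (hK : Convex ℝ K) (hnonem : (interior (eP '' K)).Nonempty) (hvol : volume (eP '' K) ≤ 1) :
    BddAbove {a | ∃ S, S ⊆ K ∧ Convex ℝ S ∧ IsCompact S ∧ a = affinePerimeter S} := by
  obtain ⟨T0, hT0⟩ := fam_bdd (hKc.image eP.continuous) (hK.linear_image (eP : E 2 →ₗ[ℝ] P2)) hvol
  refine ⟨2 * T0, ?_⟩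
  rintro _ ⟨S, hSK, hS, hSc, rfl⟩
  exact ap_le_of_fam hKc hK hnonem hSK hSc hS (fun T hT => by linarith [hT0 T hT])

lemma fam_le_max {K : Set (E 2)} (hKc : IsCompact K) (hK : Convex ℝ K) (hnonem : (interior (eP '' K)).Nonempty) (hvol : volume (eP '' K) ≤ 1)
    {T : ℝ} (hF : FamIn (eP '' K) T) : 2 * T ≤ maxAffinePerimeter K := by
  have hb := max_bdd hKc hK hnonem hvol
  unfold maxAffinePerimeter
  obtain ⟨ι, _, x, v, y, t, hV, hx, hv, hy, ht0, ht, hs⟩ := hF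
  cases isEmpty_or_nonempty ι
  · refine le_csSup_of_le hb ⟨∅, empty_subset _, convex_empty, isCompact_empty, rfl⟩ ?_
    rw [ap_deg convex_empty (by simp)]
    simp at hs; simp [← hs]
  have hKc' : IsCompact (eP '' K) := hKc.image eP.continuous
  have hK' : Convex ℝ (eP '' K) := hK.linear_image (eP : E 2 →ₗ[ℝ] P2)
  set S' := arcS (eP '' K) x v y with hS'
  have c1 : Convex ℝ S' := arcS_convex hK' x v y
  have c2 : IsCompact S' := hKc'.of_isClosed_subset (arcS_closed hKc'.isClosed x v y) (fun w hw => hw.1)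
  obtain ⟨a, b, g, h, B⟩ := exists_body c2 c1 (arc_body hV hK' hx hv hy)
  have hle := arc_aff hV hK' hKc'.isClosed hx hv hy ht0 ht B
  have hfin := (wet_lim B c2.isClosed).1
  have him : eP '' (eP.symm '' S') = S' := by
    rw [← image_comp]; simp
  have hSc : IsCompact (eP.symm '' S') := c2.image eP.symm.continuous
  have hap := ap_eq (S := eP.symm '' S') hSc (by rw [him]; exact B)
  refine le_csSup_of_le hb ⟨eP.symm '' S', ?_, c1.linear_image (eP.symm : P2 →ₗ[ℝ] E 2), hSc, rfl⟩ ?_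
  · rintro _ ⟨w, hw, rfl⟩
    obtain ⟨z, hz, rfl⟩ := hw.1
    simpa using hz
  · rw [hap, ← hs]
    exact (ENNReal.ofReal_le_iff_le_toReal hfin).1 hle

theorem main_aux (K : Set (E 2)) (hKc : IsCompact K) (hKconv : Convex ℝ K)
    (hKint : (interior K).Nonempty) (harea : volume K = 1) :
    Tendsto (fun n : ℕ => (n : ℝ) ^ 2 * (pConvex 2 n K) ^ ((1 : ℝ) / n)) atTop
      (nhds (Real.exp 2 / 4 * (maxAffinePerimeter K) ^ 3)) := by
  have hpq : ∀ n, pConvex 2 n K = qv (eP '' K) n := fun n => pConvex_eq hKc.measurableSet harea n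
  simp only [hpq]
  have hnonem : (interior (eP '' K)).Nonempty := by
    have h2 : eP '' interior K = interior (eP '' K) := eP.toHomeomorph.image_interior K
    rw [← h2]; exact hKint.image _
  have hKc' : IsCompact (eP '' K) := hKc.image eP.continuous
  have hK' : Convex ℝ (eP '' K) := hKconv.linear_image (eP : E 2 →ₗ[ℝ] P2)
  have hvol : volume (eP '' K) ≤ 1 := by rw [eP_vol', harea]
  have hfm := fun T hF => fam_le_max hKc hKconv hnonem hvol (T := T) hF
  set A := maxAffinePerimeter K with hA
  have hA0 : 0 < A := by
    obtain ⟨T, hT, hF⟩ := famIn_pos hnonem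
    linarith [hfm T hF]
  rw [tendsto_order]
  constructor
  · intro c hc
    have hev : ∀ᶠ x in nhdsWithin A (Iio A), c < Real.exp 2 / 4 * x^3 ∧ 0 < x := by
      have h1 : Tendsto (fun x : ℝ => Real.exp 2 / 4 * x^3) (nhdsWithin A (Iio A)) (nhds (Real.exp 2 / 4 * A^3)) :=
        ((continuous_const.mul (continuous_id.pow 3)).tendsto A).mono_left nhdsWithin_le_nhds
      exact (h1.eventually_const_lt hc).and ((eventually_gt_nhds hA0).filter_mono nhdsWithin_le_nhds)
    obtain ⟨A', ⟨h1, h2⟩, h3⟩ := (hev.and self_mem_nhdsWithin).exists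
    have h3 : A' < A := h3
    obtain ⟨T, hF, hT⟩ : ∃ T, FamIn (eP '' K) T ∧ A' < 2 * T := by
      by_contra hno
      push Not at hno
      have : A ≤ A' := by
        rw [hA]
        unfold maxAffinePerimeter
        refine csSup_le ⟨affinePerimeter ∅, ∅, empty_subset _, convex_empty, isCompact_empty, rfl⟩ ?_
        rintro _ ⟨S, hSK, hS, hSc, rfl⟩
        exact ap_le_of_fam hKc hKconv hnonem hSK hSc hS hno
      linarith
    refine q_lower hK' hvol hF (by linarith) (h1.trans ?_)
    have h4 : A'^3 < (2*T)^3 := pow_lt_pow_left₀ hT h2.le (by norm_num)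
    have := Real.exp_pos 2
    nlinarith
  · intro c hc
    have hev : ∀ᶠ ε in nhdsWithin (0:ℝ) (Ioi 0), Real.exp 2 / 4 * ((1+ε)^((2:ℝ)/3) * A)^3 < c := by
      have hcont : Continuous (fun ε : ℝ => Real.exp 2 / 4 * ((1+ε)^((2:ℝ)/3) * A)^3) :=
        continuous_const.mul (((Continuous.rpow_const (by fun_prop) (fun _ => Or.inr (by norm_num))).mul continuous_const).pow 3)
      have h1 := hcont.tendsto 0
      simp only [add_zero, Real.one_rpow, one_mul] at h1
      exact (h1.mono_left nhdsWithin_le_nhds).eventually_lt_const hc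
    obtain ⟨ε, h1, hε⟩ := (hev.and self_mem_nhdsWithin).exists
    have hε : (0:ℝ) < ε := hε
    obtain ⟨o, ρ, hρ, ho⟩ := exists_box hnonem
    obtain ⟨R, hR0, hR⟩ := exists_diam hKc'
    obtain ⟨k, hk1, hk3⟩ := ((thm_small (R := R) hε hρ).and (eventually_ge_atTop 2)).exists
    have : NeZero (2*k) := ⟨by omega⟩
    have h4 : 4 ≤ 2 * k := by omega
    refine q_upper (DZ (2*k) h4) hKc'.measurableSet hvol (T := (1+ε)^((2:ℝ)/3) * A / 2) (by positivity) (fun a haK ha => ?_) ?_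
    · have := hfm _ (famIn_of_sup hK' hρ.le ho hR hR0 hε (2*k) h4 hk1 ha haK)
      rw [Real.inv_rpow (by positivity)] at this
      have hp : 0 < (1+ε)^((2:ℝ)/3) := by positivity
      rw [mul_left_comm, inv_mul_le_iff₀ hp] at this
      linarith
    · refine lt_of_le_of_lt (le_of_eq ?_) h1
      ring

end partH2

/-- Theorem 1.1: for every planar convex body `K` of unit area,
`n² · p(n,K)^{1/n} → (e²/4) · A(K)³`. -/
theorem sylvester_asymptotics (K : Set (E 2)) (hKc : IsCompact K) (hKconv : Convex ℝ K)
    (hKint : (interior K).Nonempty) (harea : volume K = 1) :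
    Tendsto (fun n : ℕ => (n : ℝ) ^ 2 * (pConvex 2 n K) ^ ((1 : ℝ) / n)) atTop
      (nhds (Real.exp 2 / 4 * (maxAffinePerimeter K) ^ 3)) := by
  exact main_aux K hKc hKconv hKint harea
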